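/- Let κ > 0 be real, set α = 1/κ, and let m ≥ 1 be a positive integer. Put β = α·Γ(α+1)·(1 − (m+1)^{−α})·ζ(α+1) and δ = (α+2)/(2(α+1)), and let z₀ = −1/2 if α ∉ ℕ and z₀ = −α/(α+1) if α ∈ ℕ. Then there exists a sequence of real numbers λ(0), λ(1), …, λ(⌊α⌋) with λ(0) = (1+κ)β and λ(1) = (1 − (m+1)^{1−α})·ζ(α)·Γ(1+α)/2 if α > 1 (and λ(1) = 0 if α ≤ 1), such that p_{κ,m}(n) ~ ((m+1)^{z₀}/√(2πβ(α+1))) · (β/n)^{δ} · exp( Σ_{h=0}^{⌊α⌋} λ(h)·(n/β)^{(α−h)/(α+1)} ) as n → ∞. -/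

import Mathlib

open Filter Topology Real
open scoped Classical

/-- The Piatetski-Shapiro part: `⌊ℓ^κ⌋`. -/
noncomputable def psPart (κ : ℝ) (ℓ : ℕ) : ℕ := ⌊(ℓ : ℝ) ^ κ⌋₊

/-- `p_{κ,m}(n)`: number of partitions of `n` into parts from `(⌊ℓ^κ⌋)_{ℓ ≥ 1}`,
each index used at most `m` times. -/
noncomputable def pkm (κ : ℝ) (m : ℕ) (n : ℕ) : ℕ :=
  Nat.card {r : ℕ →₀ ℕ // (∀ ℓ, r ℓ ≤ m) ∧ (r.sum fun ℓ j => j * psPart κ (ℓ + 1)) = n}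

/-- Riemann zeta at a real argument (real-valued there). -/
noncomputable def realZeta (x : ℝ) : ℝ := (riemannZeta (x : ℂ)).re

namespace PS

/-- The additive character `x ↦ exp (2 π i x)`. -/
noncomputable def ee (x : ℝ) : ℂ := Complex.exp (2 * π * x * Complex.I)

lemma ee_eq (x : ℝ) : ee x = Complex.exp (((2 * π * x : ℝ) : ℂ) * Complex.I) := by
  unfold ee; push_cast; rfl

lemma norm_ee (x : ℝ) : ‖ee x‖ = 1 := by
  rw [ee_eq, Complex.norm_exp_ofReal_mul_I]

lemma ee_add (x y : ℝ) : ee (x + y) = ee x * ee y := by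
  unfold ee; rw [← Complex.exp_add]; congr 1; push_cast; ring

lemma ee_zero : ee 0 = 1 := by simp [ee]

lemma ee_sub_mul (x y : ℝ) : ee x * (starRingEnd ℂ) (ee y) = ee (x - y) := by
  have h : (starRingEnd ℂ) (ee y) = ee (-y) := by
    rw [ee_eq, ee_eq, ← Complex.exp_conj, map_mul, Complex.conj_ofReal, Complex.conj_I]
    congr 1; push_cast; ring
  rw [h, ← ee_add]; rfl

lemma norm_ee_sub_one (x : ℝ) : ‖ee x - 1‖ = 2 * |Real.sin (π * x)| := by
  rw [ee_eq, mul_comm, Complex.norm_exp_I_mul_ofReal_sub_one, norm_mul]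
  simp; congr 2; ring

lemma norm_ee_sub_one_ge {x : ℝ} (h0 : 0 ≤ x) (h1 : x ≤ 1 / 2) : 4 * x ≤ ‖ee x - 1‖ := by
  rw [norm_ee_sub_one]
  have h := Real.mul_le_sin (x := π * x) (by positivity) (by nlinarith [Real.pi_pos])
  have h2 : 2 / π * (π * x) = 2 * x := by field_simp
  have := le_abs_self (Real.sin (π * x))
  linarith

lemma norm_ee_sub_le (x y : ℝ) : ‖ee x - ee y‖ ≤ 2 * π * |x - y| := by
  have h : ee x - ee y = ee y * (ee (x - y) - 1) := by
    rw [mul_sub, ← ee_add]; simp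
  rw [h, norm_mul, norm_ee, one_mul, norm_ee_sub_one]
  have := Real.abs_sin_le_abs (x := π * (x - y))
  rw [abs_mul, abs_of_pos Real.pi_pos] at this
  linarith

lemma kusmin_landau (x : ℕ → ℝ) (δ : ℕ → ℝ) (hx : ∀ n, x (n + 1) = x n + δ n)
    (hanti : Antitone δ) (hpos : ∀ n, 0 < δ n) (h0 : δ 0 ≤ 1 / 2) (N : ℕ) :
    ‖∑ n ∈ Finset.range (N + 1), ee (x n)‖ ≤ 1 / δ N := by
  have hhalf : ∀ n, δ n ≤ 1 / 2 := fun n => (hanti (Nat.zero_le n)).trans h0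
  have hge : ∀ n, 4 * δ n ≤ ‖ee (δ n) - 1‖ := fun n => norm_ee_sub_one_ge (hpos n).le (hhalf n)
  have hne : ∀ n, ee (δ n) - 1 ≠ 0 := fun n h => by
    have := hge n; rw [h, norm_zero] at this; linarith [hpos n]
  set w : ℕ → ℂ := fun n => (ee (δ n) - 1)⁻¹ with hw
  have hwn : ∀ n, ‖w n‖ ≤ 1 / (4 * δ n) := fun n => by
    rw [hw, norm_inv, ← one_div]
    exact one_div_le_one_div_of_le (by linarith [hpos n]) (hge n)
  have hterm : ∀ n, ee (x n) = (ee (x (n + 1)) - ee (x n)) * w n := fun n => by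
    rw [hx, ee_add, hw]; have := hne n; field_simp
  have hdiff : ∀ n, ‖w (n + 1) - w n‖ ≤ π / 8 * (1 / δ (n + 1) - 1 / δ n) := fun n => by
    have e1 : w (n + 1) - w n = (ee (δ n) - ee (δ (n + 1))) * w n * w (n + 1) := by
      simp only [hw]; have h1 := hne n; have h2 := hne (n + 1); field_simp; ring
    rw [e1, norm_mul, norm_mul]
    have h1 := norm_ee_sub_le (δ n) (δ (n + 1))
    have h2 : δ (n + 1) ≤ δ n := hanti (Nat.le_succ n)
    rw [abs_of_nonneg (by linarith)] at h1
    have p1 := hpos n; have p2 := hpos (n + 1)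
    calc _ ≤ (2 * π * (δ n - δ (n + 1))) * (1 / (4 * δ n)) * (1 / (4 * δ (n + 1))) := by
          gcongr
          · exact hwn n
          · exact hwn _
      _ = _ := by field_simp; ring
  have key : ∀ N, ‖(∑ n ∈ Finset.range (N + 1), ee (x n)) - ee (x (N + 1)) * w N‖
      ≤ 1 / (4 * δ 0) + π / 8 * (1 / δ N - 1 / δ 0) := by
    intro N
    induction N with
    | zero =>
      simp only [zero_add, Finset.range_one, Finset.sum_singleton, sub_self, mul_zero, add_zero]
      have : ee (x 0) - ee (x 1) * w 0 = - (ee (x 0) * w 0) := by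
        nth_rewrite 1 [hterm 0]; ring
      rw [this, norm_neg, norm_mul, norm_ee, one_mul]; exact hwn 0
    | succ N ih =>
      rw [Finset.sum_range_succ]
      have : (∑ n ∈ Finset.range (N + 1), ee (x n)) + ee (x (N + 1)) - ee (x (N + 1 + 1)) * w (N + 1)
        = ((∑ n ∈ Finset.range (N + 1), ee (x n)) - ee (x (N + 1)) * w N)
          - ee (x (N + 1)) * (w (N + 1) - w N) := by
        linear_combination hterm (N + 1)
      rw [this]
      refine (norm_sub_le _ _).trans ?_
      rw [norm_mul, norm_ee, one_mul]
      have := hdiff N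
      linarith
  have h1 := key N
  have h2 : ‖∑ n ∈ Finset.range (N + 1), ee (x n)‖ ≤
      ‖(∑ n ∈ Finset.range (N + 1), ee (x n)) - ee (x (N + 1)) * w N‖ + ‖ee (x (N + 1)) * w N‖ := by
    have := norm_add_le ((∑ n ∈ Finset.range (N + 1), ee (x n)) - ee (x (N + 1)) * w N)
      (ee (x (N + 1)) * w N)
    simpa using this
  rw [norm_mul, norm_ee, one_mul] at h2
  have h3 := hwn N
  have h4 : 1 / δ 0 ≤ 1 / δ N := one_div_le_one_div_of_le (hpos N) (hanti (Nat.zero_le N))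
  have h5 : 0 < 1 / δ 0 := by have := hpos 0; positivity
  have h6 : 1 / (4 * δ N) = 1 / 4 * (1 / δ N) := by have := (hpos N).ne'; field_simp
  have h7 : 1 / (4 * δ 0) = 1 / 4 * (1 / δ 0) := by have := (hpos 0).ne'; field_simp
  rw [h6] at h3; rw [h7] at h1
  have := Real.pi_lt_four; have := Real.pi_pos
  nlinarith

lemma norm_sum_shift (u : ℕ → ℂ) (hu : ∀ n, ‖u n‖ ≤ 1) (N h : ℕ) :
    ‖(∑ n ∈ Finset.range N, u (n + h)) - ∑ n ∈ Finset.range N, u n‖ ≤ 2 * h := by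
  induction h with
  | zero => simp
  | succ h ih =>
    have e : (∑ n ∈ Finset.range N, u (n + (h + 1))) =
        (∑ n ∈ Finset.range N, u (n + h)) + u (N + h) - u h := by
      have h1 := Finset.sum_range_succ' (fun n => u (n + h)) N
      have h2 := Finset.sum_range_succ (fun n => u (n + h)) N
      rw [h1] at h2
      have h3 : ∀ n, u (n + 1 + h) = u (n + (h + 1)) := fun n => by congr 1; ring
      simp only [h3, zero_add] at h2
      rw [← h2]; ring
    rw [e]
    have : (∑ n ∈ Finset.range N, u (n + h)) + u (N + h) - u h - ∑ n ∈ Finset.range N, u n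
      = ((∑ n ∈ Finset.range N, u (n + h)) - ∑ n ∈ Finset.range N, u n) + u (N + h) - u h := by ring
    rw [this]
    have h1 := norm_sub_le (((∑ n ∈ Finset.range N, u (n + h)) - ∑ n ∈ Finset.range N, u n)
      + u (N + h)) (u h)
    have h2 := norm_add_le ((∑ n ∈ Finset.range N, u (n + h)) - ∑ n ∈ Finset.range N, u n)
      (u (N + h))
    have := hu (N + h); have := hu h
    push_cast; linarith

lemma van_der_corput (u : ℕ → ℂ) (hu : ∀ n, ‖u n‖ ≤ 1) (N H : ℕ) (η : ℝ) (hη : 0 ≤ η)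
    (hd : ∀ d, 1 ≤ d → d < H →
      ‖∑ n ∈ Finset.range N, u (n + d) * (starRingEnd ℂ) (u n)‖ ≤ η * N) :
    (H * ‖∑ n ∈ Finset.range N, u n‖ - 2 * (H : ℝ) ^ 2 ≤ 0) ∨
    (H * ‖∑ n ∈ Finset.range N, u n‖ - 2 * (H : ℝ) ^ 2) ^ 2 ≤
      N * (H * N + (H : ℝ) ^ 2 * (η * N + 2 * H)) := by
  by_cases hcase : H * ‖∑ n ∈ Finset.range N, u n‖ - 2 * (H : ℝ) ^ 2 ≤ 0
  · exact Or.inl hcase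
  right
  push Not at hcase
  set B : ℂ := ∑ n ∈ Finset.range N, ∑ h ∈ Finset.range H, u (n + h) with hB
  have h1 : H * ‖∑ n ∈ Finset.range N, u n‖ - 2 * (H : ℝ) ^ 2 ≤ ‖B‖ := by
    have e : (H : ℂ) * (∑ n ∈ Finset.range N, u n) =
        B - ∑ h ∈ Finset.range H, ((∑ n ∈ Finset.range N, u (n + h)) - ∑ n ∈ Finset.range N, u n) := by
      rw [Finset.sum_sub_distrib, hB, Finset.sum_comm]
      simp
    have e2 : ‖(H : ℂ) * (∑ n ∈ Finset.range N, u n)‖ ≤ ‖B‖ + 2 * (H : ℝ) ^ 2 := by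
      rw [e]
      refine (norm_sub_le _ _).trans ?_
      gcongr
      calc _ ≤ ∑ h ∈ Finset.range H, (2 * (H : ℝ)) := by
            refine (norm_sum_le _ _).trans (Finset.sum_le_sum fun h hh => ?_)
            refine (norm_sum_shift u hu N h).trans ?_
            have : (h : ℝ) ≤ H := by exact_mod_cast (Finset.mem_range.mp hh).le
            linarith
        _ = _ := by simp; ring
    rw [norm_mul, Complex.norm_natCast] at e2
    linarith
  have hoff : ∀ h h' : ℕ, h < H → h' < h →
      ‖∑ n ∈ Finset.range N, u (n + h) * (starRingEnd ℂ) (u (n + h'))‖ ≤ η * N + 2 * H := by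
    intro h h' hh hh'
    have h2 := norm_sum_shift (fun n => u (n + (h - h')) * (starRingEnd ℂ) (u n))
      (fun n => by
        rw [norm_mul, RCLike.norm_conj]
        exact mul_le_one₀ (hu _) (norm_nonneg _) (hu _)) N h'
    have e : ∀ n, n + h' + (h - h') = n + h := fun n => by omega
    simp only [e] at h2
    have h3 := hd (h - h') (by omega) (by omega)
    have h4 := norm_sub_norm_le (∑ n ∈ Finset.range N, u (n + h) * (starRingEnd ℂ) (u (n + h')))
      (∑ n ∈ Finset.range N, u (n + (h - h')) * (starRingEnd ℂ) (u n))
    have : (h' : ℝ) ≤ H := by exact_mod_cast (hh'.trans hh).le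
    linarith
  have hswap : ∀ h h' : ℕ, ‖∑ n ∈ Finset.range N, u (n + h) * (starRingEnd ℂ) (u (n + h'))‖ =
      ‖∑ n ∈ Finset.range N, u (n + h') * (starRingEnd ℂ) (u (n + h))‖ := by
    intro h h'
    rw [← RCLike.norm_conj (∑ n ∈ Finset.range N, u (n + h) * (starRingEnd ℂ) (u (n + h'))), map_sum]
    congr 1
    refine Finset.sum_congr rfl fun n _ => ?_
    simp [mul_comm]
  have hall : ∀ h < H, ∀ h' < H,
      ‖∑ n ∈ Finset.range N, u (n + h) * (starRingEnd ℂ) (u (n + h'))‖ ≤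
        (if h = h' then (N : ℝ) else 0) + (η * N + 2 * H) := by
    intro h hh h' hh'
    rcases lt_trichotomy h h' with hlt | heq | hgt
    · rw [hswap, if_neg hlt.ne, zero_add]; exact hoff _ _ hh' hlt
    · rw [if_pos heq, heq]
      have : ‖∑ n ∈ Finset.range N, u (n + h') * (starRingEnd ℂ) (u (n + h'))‖ ≤ N := by
        refine (norm_sum_le _ _).trans ?_
        calc _ ≤ ∑ n ∈ Finset.range N, (1 : ℝ) := Finset.sum_le_sum fun n _ => by
              rw [norm_mul, RCLike.norm_conj]
              exact mul_le_one₀ (hu _) (norm_nonneg _) (hu _)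
          _ = _ := by simp
      have : 0 ≤ η * N + 2 * H := by positivity
      linarith
    · rw [if_neg hgt.ne', zero_add]; exact hoff _ _ hh hgt
  have h2 : ‖B‖ ^ 2 ≤ N * ∑ n ∈ Finset.range N, ‖∑ h ∈ Finset.range H, u (n + h)‖ ^ 2 := by
    calc ‖B‖ ^ 2 ≤ (∑ n ∈ Finset.range N, ‖∑ h ∈ Finset.range H, u (n + h)‖) ^ 2 := by
          gcongr; exact norm_sum_le _ _
      _ ≤ _ := by
          have := sq_sum_le_card_mul_sum_sq (s := Finset.range N)
            (f := fun n => ‖∑ h ∈ Finset.range H, u (n + h)‖)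
          simpa using this
  have h3 : ((∑ n ∈ Finset.range N, ‖∑ h ∈ Finset.range H, u (n + h)‖ ^ 2 : ℝ) : ℂ) =
      ∑ h ∈ Finset.range H, ∑ h' ∈ Finset.range H,
        ∑ n ∈ Finset.range N, u (n + h) * (starRingEnd ℂ) (u (n + h')) := by
    push_cast
    have : ∀ n, ((‖∑ h ∈ Finset.range H, u (n + h)‖ : ℂ)) ^ 2 =
        ∑ h ∈ Finset.range H, ∑ h' ∈ Finset.range H, u (n + h) * (starRingEnd ℂ) (u (n + h')) := by
      intro n
      rw [← Complex.mul_conj', map_sum, Finset.sum_mul_sum]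
    simp only [this]
    rw [Finset.sum_comm]
    refine Finset.sum_congr rfl fun h _ => ?_
    rw [Finset.sum_comm]
  have h4 : ∑ n ∈ Finset.range N, ‖∑ h ∈ Finset.range H, u (n + h)‖ ^ 2 ≤
      H * N + (H : ℝ) ^ 2 * (η * N + 2 * H) := by
    have e : ∑ n ∈ Finset.range N, ‖∑ h ∈ Finset.range H, u (n + h)‖ ^ 2 =
      ‖((∑ n ∈ Finset.range N, ‖∑ h ∈ Finset.range H, u (n + h)‖ ^ 2 : ℝ) : ℂ)‖ := by
      rw [Complex.norm_real, Real.norm_of_nonneg]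
      exact Finset.sum_nonneg fun _ _ => sq_nonneg _
    rw [e, h3]
    calc _ ≤ ∑ h ∈ Finset.range H, ∑ h' ∈ Finset.range H,
          ((if h = h' then (N : ℝ) else 0) + (η * N + 2 * H)) := by
          refine (norm_sum_le _ _).trans (Finset.sum_le_sum fun h hh => ?_)
          refine (norm_sum_le _ _).trans (Finset.sum_le_sum fun h' hh' => ?_)
          exact hall h (Finset.mem_range.mp hh) h' (Finset.mem_range.mp hh')
      _ = _ := by
          simp only [Finset.sum_add_distrib, Finset.sum_const, Finset.card_range, nsmul_eq_mul]
          have : ∀ h ∈ Finset.range H, (∑ h' ∈ Finset.range H, if h = h' then (N : ℝ) else 0) = N := by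
            intro h hh
            rw [Finset.sum_ite_eq]; simp [Finset.mem_range.mp hh]
          rw [Finset.sum_congr rfl this]; simp; ring
  calc _ ≤ ‖B‖ ^ 2 := by gcongr
    _ ≤ _ := h2.trans (by gcongr)

/-- `WeylClass k f`: the `k`-th derivative of `f` on `[1, ∞)` is positive, decreasing, tends to `0`,
and tends to `0` more slowly than `1 / x`. -/
def WeylClass : ℕ → (ℝ → ℝ) → Prop
  | 0, g => AntitoneOn g (Set.Ici 1) ∧ (∀ x, 1 ≤ x → 0 < g x) ∧ Tendsto g atTop (𝓝 0) ∧
      Tendsto (fun x => x * g x) atTop atTop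
  | k + 1, f => ∃ f' : ℝ → ℝ, (∀ x, 1 ≤ x → HasDerivAt f (f' x) x) ∧ WeylClass k f'

lemma WeylClass.diff {k : ℕ} {f : ℝ → ℝ} (hf : WeylClass (k + 1) f) {h : ℕ} (hh : 1 ≤ h) :
    WeylClass k (fun x => f (x + h) - f x) := by
  have hh0 : (1 : ℝ) ≤ h := by exact_mod_cast hh
  induction k generalizing f with
  | zero =>
    obtain ⟨f', hd, hanti, hpos, hlim, hinf⟩ := hf
    have hmv : ∀ x : ℝ, 1 ≤ x → ∃ ξ ∈ Set.Ioo x (x + h), f (x + h) - f x = h * f' ξ := by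
      intro x hx
      obtain ⟨ξ, hξ, e⟩ := exists_hasDerivAt_eq_slope f f' (show x < x + h by linarith)
        (fun y hy => (hd y (hx.trans hy.1)).continuousAt.continuousWithinAt)
        (fun y hy => hd y (hx.trans hy.1.le))
      refine ⟨ξ, hξ, ?_⟩
      rw [add_sub_cancel_left] at e
      rw [e]; field_simp
    have hub : ∀ x : ℝ, 1 ≤ x → f (x + h) - f x ≤ h * f' x := by
      intro x hx
      obtain ⟨ξ, hξ, e⟩ := hmv x hx
      rw [e]; gcongr
      exact hanti hx (hx.trans hξ.1.le) hξ.1.le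
    have hlb : ∀ x : ℝ, 1 ≤ x → h * f' (x + h) ≤ f (x + h) - f x := by
      intro x hx
      obtain ⟨ξ, hξ, e⟩ := hmv x hx
      rw [e]; gcongr
      exact hanti (show (1:ℝ) ≤ ξ from hx.trans hξ.1.le) (show (1:ℝ) ≤ x + h by linarith) hξ.2.le
    have hp : ∀ x : ℝ, 1 ≤ x → 0 < f (x + h) - f x := fun x hx => by
      have := hlb x hx
      have := hpos (x + h) (by linarith)
      nlinarith
    refine ⟨?_, hp, ?_, ?_⟩
    · have hD : ∀ x, 1 ≤ x → HasDerivAt (fun x => f (x + h) - f x) (f' (x + h) - f' x) x :=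
        fun x hx => ((hd (x + h) (by linarith)).comp_add_const x (h:ℝ)).sub (hd x hx)
      refine antitoneOn_of_deriv_nonpos (convex_Ici 1)
        (fun x hx => (hD x hx).continuousAt.continuousWithinAt)
        (fun x hx => ?_) (fun x hx => ?_)
      · rw [interior_Ici] at hx
        exact (hD x (le_of_lt hx)).differentiableAt.differentiableWithinAt
      · rw [interior_Ici] at hx
        have hx : 1 < x := hx
        rw [(hD x hx.le).deriv]
        have := hanti (show (1:ℝ) ≤ x from hx.le) (show (1:ℝ) ≤ x + h by linarith)
          (show x ≤ x + h by linarith)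
        linarith
    · have : Tendsto (fun x => (h : ℝ) * f' x) atTop (𝓝 0) := by
        simpa using hlim.const_mul (h : ℝ)
      refine squeeze_zero' ?_ ?_ this
      · filter_upwards [eventually_ge_atTop 1] with x hx using (hp x hx).le
      · filter_upwards [eventually_ge_atTop 1] with x hx using hub x hx
    · have h1 : Tendsto (fun x : ℝ => (x + h) * f' (x + h)) atTop atTop :=
        hinf.comp (tendsto_atTop_add_const_right _ _ tendsto_id)
      have h2 : Tendsto (fun x : ℝ => ((x + h) * f' (x + h)) * (1 / 2)) atTop atTop :=
        h1.atTop_mul_const (by norm_num)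
      refine tendsto_atTop_mono' _ ?_ h2
      filter_upwards [eventually_ge_atTop (h:ℝ)] with x hx
      have hx1 : 1 ≤ x := hh0.trans hx
      have := hlb x hx1
      have hp' := hpos (x + h) (by linarith)
      have : f' (x + h) ≤ h * f' (x + h) := by nlinarith
      have h3 : (x + h) * f' (x + h) ≤ (2 * x) * f' (x + h) := by gcongr; linarith
      nlinarith
  | succ k ih =>
    obtain ⟨f', hd, hf'⟩ := hf
    refine ⟨fun x => f' (x + h) - f' x, fun x hx => ?_, ih hf'⟩
    exact ((hd (x + h) (by linarith)).comp_add_const x (h:ℝ)).sub (hd x hx)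

lemma WeylClass.weyl_sum {k : ℕ} {f : ℝ → ℝ} (hf : WeylClass (k + 1) f) {t₀ : ℝ} (ht₀ : 0 < t₀)
    (t₁ : ℝ) {ε : ℝ} (hε : 0 < ε) :
    ∃ N₀ : ℕ, ∀ N ≥ N₀, ∀ t ∈ Set.Icc t₀ t₁,
      ‖∑ n ∈ Finset.range N, ee (t * f (n + 1))‖ ≤ ε * N := by
  induction k generalizing f ε with
  | zero =>
    have hg := hf.diff (le_refl 1)
    simp only [Nat.cast_one] at hg
    obtain ⟨hanti, hpos, hlim, hinf⟩ := hg
    have hsmall : ∀ᶠ x in atTop, f (x + 1) - f x < 1 / (2 * (|t₁| + 1)) :=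
      hlim.eventually_lt_const (by positivity)
    obtain ⟨X, hX⟩ := eventually_atTop.mp hsmall
    obtain ⟨n₀, hn₀⟩ := exists_nat_ge X
    have hbig : ∀ᶠ x in atTop, 4 / (ε * t₀) ≤ x * (f (x + 1) - f x) :=
      hinf.eventually_ge_atTop _
    obtain ⟨Y, hY⟩ := eventually_atTop.mp hbig
    obtain ⟨n₁, hn₁⟩ := exists_nat_ge Y
    obtain ⟨n₂, hn₂⟩ := exists_nat_ge (2 * n₀ / ε)
    refine ⟨n₀ + n₁ + n₂ + 1, fun N hN t ht => ?_⟩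
    have htpos : 0 < t := ht₀.trans_le ht.1
    obtain ⟨M, rfl⟩ : ∃ M, N = n₀ + (M + 1) := ⟨N - n₀ - 1, by omega⟩
    rw [Finset.sum_range_add]
    have hkl := kusmin_landau (fun n => t * f ((n₀ + n : ℕ) + 1))
      (fun n => t * (f ((n₀ + n : ℕ) + 1 + 1) - f ((n₀ + n : ℕ) + 1)))
      (fun n => by push_cast; ring_nf)
      (fun a b hab => by
        have : f ((n₀ + b : ℕ) + 1 + 1) - f ((n₀ + b : ℕ) + 1) ≤
            f ((n₀ + a : ℕ) + 1 + 1) - f ((n₀ + a : ℕ) + 1) :=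
          hanti (by simp; positivity) (by simp; positivity)
            (by have : (a:ℝ) ≤ b := by exact_mod_cast hab
                push_cast; linarith)
        exact mul_le_mul_of_nonneg_left this htpos.le)
      (fun n => mul_pos htpos (hpos _ (by push_cast; nlinarith [n₀.cast_nonneg (α := ℝ), n.cast_nonneg (α := ℝ)])))
      (by
        have h1 := hX ((n₀ + 0 : ℕ) + 1) (by push_cast; linarith)
        have h2 : 0 < f ((n₀ + 0 : ℕ) + 1 + 1) - f ((n₀ + 0 : ℕ) + 1) :=
          hpos _ (by push_cast; nlinarith [n₀.cast_nonneg (α := ℝ)])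
        have h3 : t ≤ |t₁| + 1 := ht.2.trans ((le_abs_self _).trans (by linarith))
        calc _ ≤ (|t₁| + 1) * (1 / (2 * (|t₁| + 1))) := by gcongr
          _ = 1 / 2 := by have : |t₁| + 1 ≠ 0 := by positivity
                          field_simp) M
    have hb := hY ((n₀ + M : ℕ) + 1) (by
      have : (n₁ : ℝ) ≤ (n₀ + M : ℕ) := by exact_mod_cast (by omega)
      linarith)
    set d := f ((n₀ + M : ℕ) + 1 + 1) - f ((n₀ + M : ℕ) + 1) with hd
    have hdpos : 0 < d := hpos _ (by push_cast; nlinarith [n₀.cast_nonneg (α := ℝ), M.cast_nonneg (α := ℝ)])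
    have hfirst : ‖∑ x ∈ Finset.range n₀, ee (t * f (x + 1))‖ ≤ n₀ := by
      refine (norm_sum_le _ _).trans ?_
      simp [norm_ee]
    have hn₀' : (n₀ : ℝ) ≤ ε / 2 * (n₀ + (M + 1) : ℕ) := by
      have h5 : (n₂ : ℝ) ≤ (n₀ + (M + 1) : ℕ) := by exact_mod_cast (by omega)
      have h6 := hn₂.trans h5
      rw [div_le_iff₀ hε] at h6
      linarith
    have hsec : 1 / (t * d) ≤ ε / 2 * (n₀ + (M + 1) : ℕ) := by
      rw [div_le_iff₀ (by positivity)]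
      have e : ((n₀ + M : ℕ) : ℝ) + 1 = ((n₀ + (M + 1) : ℕ) : ℝ) := by push_cast; ring
      rw [e, div_le_iff₀ (by positivity)] at hb
      have h7 : t₀ * (ε * (((n₀ + (M + 1) : ℕ) : ℝ) * d)) ≤ t * (ε * (((n₀ + (M + 1) : ℕ) : ℝ) * d)) := by
        gcongr; exact ht.1
      nlinarith
    refine (norm_add_le _ _).trans ?_
    have : ‖∑ x ∈ Finset.range (M + 1), ee (t * f ((n₀ + x : ℕ) + 1))‖ ≤ 1 / (t * d) := hkl
    linarith
  | succ k ih =>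
    obtain ⟨H, hH⟩ := exists_nat_ge (max 1 (16 / ε ^ 2))
    have hH1 : (1 : ℝ) ≤ H := (le_max_left _ _).trans hH
    have hH2 : 16 / ε ^ 2 ≤ H := (le_max_right _ _).trans hH
    have hchoice : ∀ d : ℕ, ∃ N₀ : ℕ, 1 ≤ d → ∀ N ≥ N₀, ∀ t ∈ Set.Icc t₀ t₁,
        ‖∑ n ∈ Finset.range N, ee (t * (f (n + 1 + d) - f (n + 1)))‖ ≤ (ε ^ 2 / 16) * N := by
      intro d
      by_cases hd : 1 ≤ d
      · obtain ⟨N₀, h⟩ := ih (hf.diff hd) (ε := ε ^ 2 / 16) (by positivity)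
        exact ⟨N₀, fun _ => h⟩
      · exact ⟨0, fun h => absurd h hd⟩
    choose N₀ hN₀ using hchoice
    obtain ⟨n₁, hn₁⟩ := exists_nat_ge (32 * H / ε ^ 2)
    obtain ⟨n₂, hn₂⟩ := exists_nat_ge (4 * H / ε)
    refine ⟨(Finset.range H).sup N₀ + n₁ + n₂, fun N hN t ht => ?_⟩
    have hv := van_der_corput (fun n => ee (t * f (n + 1))) (fun n => (norm_ee _).le) N H
      (ε ^ 2 / 16) (by positivity) (fun d hd1 hdH => by
        have hle : N₀ d ≤ (Finset.range H).sup N₀ := Finset.le_sup (Finset.mem_range.mpr hdH)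
        have := hN₀ d hd1 N (by omega) t ht
        convert this using 4 with n
        rw [ee_sub_mul]; congr 1
        push_cast
        rw [show (n : ℝ) + d + 1 = n + 1 + d by ring]; ring)
    have hNn1 : 32 * H / ε ^ 2 ≤ (N : ℝ) := hn₁.trans (by exact_mod_cast (by omega))
    have hNn2 : 4 * H / ε ≤ (N : ℝ) := hn₂.trans (by exact_mod_cast (by omega))
    rw [div_le_iff₀ (by positivity)] at hNn1 hNn2 hH2
    set S := ‖∑ n ∈ Finset.range N, ee (t * f (n + 1))‖ with hS
    have hHpos : (0 : ℝ) < H := by linarith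
    have hN0 : (0 : ℝ) ≤ N := N.cast_nonneg
    have hmain : H * S - 2 * (H : ℝ) ^ 2 ≤ H * (ε / 2 * N) := by
      rcases hv with h | h
      · exact h.trans (by positivity)
      · refine le_of_sq_le_sq (h.trans ?_) (by positivity)
        have b1 : (H : ℝ) ≤ H ^ 2 * (ε ^ 2 / 16) := by nlinarith
        have b2 : 2 * (H : ℝ) ≤ ε ^ 2 / 16 * N := by nlinarith
        calc (N : ℝ) * (H * N + (H : ℝ) ^ 2 * (ε ^ 2 / 16 * N + 2 * H))
            ≤ N * ((H ^ 2 * (ε ^ 2 / 16)) * N + (H : ℝ) ^ 2 * (ε ^ 2 / 16 * N + ε ^ 2 / 16 * N)) := by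
              gcongr
          _ ≤ _ := by nlinarith [mul_nonneg (sq_nonneg (H * N : ℝ)) (sq_nonneg ε)]
    have : H * S ≤ H * (ε * N) := by nlinarith
    exact le_of_mul_le_mul_left this hHpos

lemma weylClass_rpow (k : ℕ) {γ C : ℝ} (hC : 0 < C) (h1 : k - 1 < γ) (h2 : γ < k) :
    WeylClass k (fun x => C * x ^ γ) := by
  induction k generalizing γ C with
  | zero =>
    simp only [Nat.cast_zero, zero_sub] at h1 h2
    refine ⟨fun x hx y hy hxy => ?_, fun x hx => by positivity, ?_, ?_⟩
    · have hx : (1:ℝ) ≤ x := hx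
      exact mul_le_mul_of_nonneg_left
        (Real.rpow_le_rpow_of_nonpos (by linarith) hxy h2.le) hC.le
    · have := (tendsto_rpow_neg_atTop (y := -γ) (by linarith)).const_mul C
      simpa using this
    · have := (tendsto_rpow_atTop (y := 1 + γ) (by linarith)).const_mul_atTop hC
      refine this.congr' ?_
      filter_upwards [eventually_gt_atTop 0] with x hx
      rw [Real.rpow_add hx, Real.rpow_one]; ring
  | succ k ih =>
    push_cast at h1 h2
    have hk : (0 : ℝ) ≤ k := k.cast_nonneg
    have hγ : 0 < γ := by linarith
    refine ⟨fun x => (C * γ) * x ^ (γ - 1), fun x hx => ?_,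
      ih (by positivity) (by linarith) (by linarith)⟩
    have := (Real.hasDerivAt_rpow_const (p := γ) (Or.inl (show x ≠ 0 by linarith))).const_mul C
    rwa [← mul_assoc] at this

/-- Uniform Weyl sums for `t n ^ γ` with non-integral `γ`. -/
lemma weyl_sum_rpow {γ : ℝ} (hγ : 0 < γ) (hn : ∀ j : ℕ, γ ≠ j) {t₀ : ℝ} (ht₀ : 0 < t₀)
    (t₁ : ℝ) {ε : ℝ} (hε : 0 < ε) :
    ∃ N₀ : ℕ, ∀ N ≥ N₀, ∀ t ∈ Set.Icc t₀ t₁,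
      ‖∑ n ∈ Finset.range N, ee (t * ((n : ℝ) + 1) ^ γ)‖ ≤ ε * N := by
  have hw : WeylClass (⌊γ⌋₊ + 1) (fun x => 1 * x ^ γ) := by
    refine weylClass_rpow _ one_pos ?_ ?_
    · push_cast
      have := Nat.floor_le hγ.le
      rcases this.lt_or_eq with h | h
      · linarith
      · exact absurd h.symm (hn _)
    · push_cast; exact Nat.lt_floor_add_one γ
  obtain ⟨N₀, h⟩ := hw.weyl_sum ht₀ t₁ hε
  refine ⟨N₀, fun N hN t ht => ?_⟩
  simpa using h N hN t ht

/-- The periodic extension of the second Bernoulli polynomial. -/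
noncomputable def bern2 (x : ℝ) : ℝ := Int.fract x ^ 2 - Int.fract x + 6⁻¹

lemma hasSum_bern2 (x : ℝ) :
    HasSum (fun h : ℕ => 1 / (h : ℝ) ^ 2 * (ee (h * x)).re) (π ^ 2 * bern2 x) := by
  have h := hasSum_one_div_nat_pow_mul_cos (k := 1) one_ne_zero (x := Int.fract x)
    ⟨Int.fract_nonneg x, (Int.fract_lt_one x).le⟩
  have e : ((-1 : ℝ) ^ (1 + 1) * (2 * π) ^ (2 * 1) / 2 / (2 * 1).factorial *
      (Polynomial.map (algebraMap ℚ ℝ) (Polynomial.bernoulli (2 * 1))).eval (Int.fract x)) =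
      π ^ 2 * bern2 x := by
    have := bernoulliFun_two (Int.fract x)
    unfold bernoulliFun at this
    rw [mul_one, this, bern2]
    simp [Nat.factorial]; exact Or.inl (by ring)
  rw [e] at h
  convert h using 2 with n
  rw [ee_eq, Complex.exp_ofReal_mul_I_re]
  simp only [mul_one]
  congr 1
  have : 2 * π * (n * x) = 2 * π * n * Int.fract x + ((n * ⌊x⌋ : ℤ) : ℝ) * (2 * π) := by
    push_cast; nth_rewrite 1 [← Int.floor_add_fract x]; ring
  rw [this, Real.cos_add_int_mul_two_pi]

lemma bern2_forward (x : ℝ) {δ : ℝ} (h0 : 0 ≤ δ) (h1 : δ ≤ 1) :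
    bern2 (x + δ) - bern2 x ≤ 2 * δ * (Int.fract x - 1 / 2 + δ / 2) := by
  have f0 := Int.fract_nonneg x
  have f1 := Int.fract_lt_one x
  unfold bern2
  by_cases h : Int.fract x + δ < 1
  · have e : Int.fract (x + δ) = Int.fract x + δ := by
      rw [Int.fract_eq_iff]
      exact ⟨by positivity, h, ⌊x⌋, by nth_rewrite 1 [← Int.floor_add_fract x]; ring⟩
    rw [e]; nlinarith
  · push Not at h
    have e : Int.fract (x + δ) = Int.fract x + δ - 1 := by
      rw [Int.fract_eq_iff]
      exact ⟨by linarith, by linarith, ⌊x⌋ + 1, by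
        push_cast; nth_rewrite 1 [← Int.floor_add_fract x]; ring⟩
    rw [e]; nlinarith

lemma bern2_backward (x : ℝ) {δ : ℝ} (h0 : 0 ≤ δ) (h1 : δ ≤ 1) :
    2 * δ * (Int.fract x - 1 / 2 - δ / 2) ≤ bern2 x - bern2 (x - δ) := by
  have f0 := Int.fract_nonneg x
  have f1 := Int.fract_lt_one x
  unfold bern2
  by_cases h : 0 ≤ Int.fract x - δ
  · have e : Int.fract (x - δ) = Int.fract x - δ := by
      rw [Int.fract_eq_iff]
      exact ⟨h, by linarith, ⌊x⌋, by nth_rewrite 1 [← Int.floor_add_fract x]; ring⟩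
    rw [e]; nlinarith
  · push Not at h
    have e : Int.fract (x - δ) = Int.fract x - δ + 1 := by
      rw [Int.fract_eq_iff]
      exact ⟨by linarith, by linarith, ⌊x⌋ - 1, by
        push_cast; nth_rewrite 1 [← Int.floor_add_fract x]; ring⟩
    rw [e]; nlinarith

/-- Uniform Weyl criterion for a family of sequences, tested on `bern2`. -/
lemma bern2_mean (F : Set (ℕ → ℝ))
    (hF : ∀ h : ℕ, 1 ≤ h → ∀ ε : ℝ, 0 < ε → ∃ N₀ : ℕ, ∀ N ≥ N₀, ∀ x ∈ F,
      ‖∑ n ∈ Finset.range N, ee (h * x n)‖ ≤ ε * N) {ε : ℝ} (hε : 0 < ε) :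
    ∃ N₀ : ℕ, ∀ N ≥ N₀, ∀ x ∈ F, ∀ y : ℝ,
      |∑ n ∈ Finset.range N, bern2 (x n + y)| ≤ ε * N := by
  have hs : Summable (fun h : ℕ => 1 / (h : ℝ) ^ 2) :=
    Real.summable_one_div_nat_pow.mpr (by norm_num)
  have htail := tendsto_sum_nat_add (fun h : ℕ => 1 / (h : ℝ) ^ 2)
  obtain ⟨H, hH⟩ := (htail.eventually_lt_const (show (0 : ℝ) < ε by exact hε)).exists
  set Z := ∑' h : ℕ, 1 / (h : ℝ) ^ 2 with hZ
  have hZ0 : 0 ≤ Z := tsum_nonneg fun h => by positivity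
  have hchoice : ∀ h : ℕ, ∃ N₀ : ℕ, 1 ≤ h → ∀ N ≥ N₀, ∀ x ∈ F,
      ‖∑ n ∈ Finset.range N, ee (h * x n)‖ ≤ (ε / (Z + 1)) * N := by
    intro h
    by_cases hh : 1 ≤ h
    · obtain ⟨N₀, h'⟩ := hF h hh (ε / (Z + 1)) (by positivity)
      exact ⟨N₀, fun _ => h'⟩
    · exact ⟨0, fun h' => absurd h' hh⟩
  choose N₀ hN₀ using hchoice
  refine ⟨(Finset.range H).sup N₀, fun N hN x hx y => ?_⟩
  have h1 : HasSum (fun h : ℕ => ∑ n ∈ Finset.range N, 1 / (h : ℝ) ^ 2 * (ee (h * (x n + y))).re)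
      (∑ n ∈ Finset.range N, π ^ 2 * bern2 (x n + y)) :=
    hasSum_sum fun n _ => hasSum_bern2 (x n + y)
  have hterm : ∀ h : ℕ, ∑ n ∈ Finset.range N, 1 / (h : ℝ) ^ 2 * (ee (h * (x n + y))).re =
      1 / (h : ℝ) ^ 2 * (ee (h * y) * ∑ n ∈ Finset.range N, ee (h * x n)).re := by
    intro h
    rw [← Finset.mul_sum]
    congr 1
    rw [Finset.mul_sum, Complex.re_sum]
    refine Finset.sum_congr rfl fun n _ => ?_
    rw [← ee_add]; congr 2; ring
  have hb : ∀ h : ℕ, |(ee (h * y) * ∑ n ∈ Finset.range N, ee (h * x n)).re| ≤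
      ‖∑ n ∈ Finset.range N, ee (h * x n)‖ := by
    intro h
    refine (Complex.abs_re_le_norm _).trans ?_
    rw [norm_mul, norm_ee, one_mul]
  have htriv : ∀ h : ℕ, ‖∑ n ∈ Finset.range N, ee (h * x n)‖ ≤ N := by
    intro h
    refine (norm_sum_le _ _).trans ?_
    simp [norm_ee]
  set g : ℕ → ℝ := fun h => ∑ n ∈ Finset.range N, 1 / (h : ℝ) ^ 2 * (ee (h * (x n + y))).re with hg
  have hbound : ∀ h, |g h| ≤ 1 / (h : ℝ) ^ 2 * N := fun h => by
    rw [hg]; dsimp only; rw [hterm, abs_mul, abs_of_nonneg (by positivity : (0:ℝ) ≤ 1 / (h:ℝ) ^ 2)]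
    gcongr
    exact (hb h).trans (htriv h)
  have hsum := h1.summable
  have e1 : ∑ n ∈ Finset.range N, π ^ 2 * bern2 (x n + y) =
      ∑ h ∈ Finset.range H, g h + ∑' h, g (h + H) := by
    rw [hsum.sum_add_tsum_nat_add, h1.tsum_eq]
  have e2 : |∑ h ∈ Finset.range H, g h| ≤ ε * N := by
    calc |∑ h ∈ Finset.range H, g h| ≤ ∑ h ∈ Finset.range H, 1 / (h : ℝ) ^ 2 * (ε / (Z + 1) * N) := by
          refine (Finset.abs_sum_le_sum_abs _ _).trans (Finset.sum_le_sum fun h hh => ?_)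
          rw [hg]; dsimp only
          rw [hterm, abs_mul, abs_of_nonneg (by positivity : (0:ℝ) ≤ 1 / (h:ℝ) ^ 2)]
          rcases Nat.eq_zero_or_pos h with rfl | hpos
          · simp
          · gcongr
            refine (hb h).trans (hN₀ h hpos N ?_ x hx)
            exact (Finset.le_sup hh).trans hN
      _ = (∑ h ∈ Finset.range H, 1 / (h : ℝ) ^ 2) * (ε / (Z + 1) * N) := by rw [Finset.sum_mul]
      _ ≤ Z * (ε / (Z + 1) * N) := by
          gcongr
          exact hs.sum_le_tsum _ (fun _ _ => by positivity)
      _ ≤ (Z + 1) * (ε / (Z + 1) * N) := by gcongr; linarith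
      _ = ε * N := by field_simp
  have e3 : |∑' h, g (h + H)| ≤ ε * N := by
    have hs' : Summable (fun h : ℕ => 1 / ((h + H : ℕ) : ℝ) ^ 2 * N) :=
      ((summable_nat_add_iff H).mpr hs).mul_right _
    calc |∑' h, g (h + H)| ≤ ∑' h : ℕ, 1 / ((h + H : ℕ) : ℝ) ^ 2 * N := by
          rw [← Real.norm_eq_abs]
          refine tsum_of_norm_bounded hs'.hasSum fun h => ?_
          exact hbound _
      _ = (∑' h : ℕ, 1 / ((h + H : ℕ) : ℝ) ^ 2) * N := tsum_mul_right
      _ ≤ ε * N := by gcongr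
  rw [← Finset.mul_sum] at e1
  have e4 : π ^ 2 * |∑ n ∈ Finset.range N, bern2 (x n + y)| ≤ 2 * (ε * N) := by
    rw [← abs_of_nonneg (sq_nonneg π), ← abs_mul, e1]
    refine (abs_add_le _ _).trans (by linarith)
  have hpi : (2 : ℝ) ≤ π ^ 2 := by nlinarith [Real.pi_gt_three]
  have := abs_nonneg (∑ n ∈ Finset.range N, bern2 (x n + y))
  nlinarith

lemma fract_mean (F : Set (ℕ → ℝ))
    (hF : ∀ h : ℕ, 1 ≤ h → ∀ ε : ℝ, 0 < ε → ∃ N₀ : ℕ, ∀ N ≥ N₀, ∀ x ∈ F,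
      ‖∑ n ∈ Finset.range N, ee (h * x n)‖ ≤ ε * N) {ε : ℝ} (hε : 0 < ε) :
    ∃ N₀ : ℕ, ∀ N ≥ N₀, ∀ x ∈ F,
      |∑ n ∈ Finset.range N, (Int.fract (x n) - 1 / 2)| ≤ ε * N := by
  set δ := min ε 1 with hδ
  have hδ0 : 0 < δ := lt_min hε one_pos
  obtain ⟨N₀, hN₀⟩ := bern2_mean F hF (ε := δ * δ / 2) (by positivity)
  refine ⟨N₀, fun N hN x hx => ?_⟩
  have hN0 : (0 : ℝ) ≤ N := N.cast_nonneg
  have a0 := abs_le.mp (hN₀ N hN x hx 0)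
  have a1 := abs_le.mp (hN₀ N hN x hx δ)
  have a2 := abs_le.mp (hN₀ N hN x hx (-δ))
  simp only [add_zero] at a0
  set S := ∑ n ∈ Finset.range N, (Int.fract (x n) - 1 / 2) with hS
  have b1 : (∑ n ∈ Finset.range N, bern2 (x n + δ)) - ∑ n ∈ Finset.range N, bern2 (x n) ≤
      2 * δ * (S + N * (δ / 2)) := by
    rw [← Finset.sum_sub_distrib]
    calc _ ≤ ∑ n ∈ Finset.range N, 2 * δ * (Int.fract (x n) - 1 / 2 + δ / 2) :=
          Finset.sum_le_sum fun n _ => bern2_forward (x n) hδ0.le (min_le_right _ _)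
      _ = _ := by
          rw [← Finset.mul_sum, Finset.sum_add_distrib]; simp [hS]
  have b2 : 2 * δ * (S - N * (δ / 2)) ≤
      (∑ n ∈ Finset.range N, bern2 (x n)) - ∑ n ∈ Finset.range N, bern2 (x n + -δ) := by
    rw [← Finset.sum_sub_distrib]
    calc _ = ∑ n ∈ Finset.range N, 2 * δ * (Int.fract (x n) - 1 / 2 - δ / 2) := by
          rw [← Finset.mul_sum, Finset.sum_sub_distrib]; simp [hS]
      _ ≤ _ := Finset.sum_le_sum fun n _ => bern2_backward (x n) hδ0.le (min_le_right _ _)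
  have hle : δ ≤ ε := min_le_left _ _
  have c1 : -(δ * N) ≤ S := by
    have : 2 * δ * (-(δ * N)) ≤ 2 * δ * S := by nlinarith
    exact le_of_mul_le_mul_left this (by positivity)
  have c2 : S ≤ δ * N := by
    have : 2 * δ * S ≤ 2 * δ * (δ * N) := by nlinarith
    exact le_of_mul_le_mul_left this (by positivity)
  rw [abs_le]
  constructor <;> nlinarith

/-- `{t n ^ γ}` has mean `1 / 2`, uniformly in `t`. -/
lemma fract_mean_rpow {γ : ℝ} (hγ : 0 < γ) (hn : ∀ j : ℕ, γ ≠ j) {t₀ : ℝ} (ht₀ : 0 < t₀)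
    (t₁ : ℝ) {ε : ℝ} (hε : 0 < ε) :
    ∃ N₀ : ℕ, ∀ N ≥ N₀, ∀ t ∈ Set.Icc t₀ t₁,
      |∑ n ∈ Finset.range N, (Int.fract (t * ((n : ℝ) + 1) ^ γ) - 1 / 2)| ≤ ε * N := by
  obtain ⟨N₀, h⟩ := fract_mean {x | ∃ t ∈ Set.Icc t₀ t₁, x = fun n : ℕ => t * ((n : ℝ) + 1) ^ γ}
    (fun h hh ε hε => by
      have hh' : (1 : ℝ) ≤ h := by exact_mod_cast hh
      obtain ⟨N₀, hN₀⟩ := weyl_sum_rpow hγ hn (t₀ := t₀ * h) (by positivity) (t₁ * h) hε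
      refine ⟨N₀, fun N hN x ⟨t, ht, hx⟩ => ?_⟩
      have := hN₀ N hN (t * h) ⟨by gcongr; exact ht.1, by gcongr; exact ht.2⟩
      convert this using 4 with n
      rw [hx]; ring_nf) hε
  exact ⟨N₀, fun N hN t ht => h N hN _ ⟨t, ht, rfl⟩⟩

/-- `{-n ^ γ}` has mean `1 / 2`. -/
lemma fract_mean_neg_rpow {γ : ℝ} (hγ : 0 < γ) (hn : ∀ j : ℕ, γ ≠ j) {ε : ℝ} (hε : 0 < ε) :
    ∃ N₀ : ℕ, ∀ N ≥ N₀,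
      |∑ n ∈ Finset.range N, (Int.fract (-((n : ℝ) + 1) ^ γ) - 1 / 2)| ≤ ε * N := by
  obtain ⟨N₀, h⟩ := fract_mean {fun n : ℕ => -((n : ℝ) + 1) ^ γ}
    (fun h hh ε hε => by
      have hh' : (1 : ℝ) ≤ h := by exact_mod_cast hh
      obtain ⟨N₀, hN₀⟩ := weyl_sum_rpow hγ hn (t₀ := h) (by positivity) h hε
      refine ⟨N₀, fun N hN x hx => ?_⟩
      have := hN₀ N hN h ⟨le_rfl, le_rfl⟩
      have e : ∑ n ∈ Finset.range N, ee (h * x n) =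
          (starRingEnd ℂ) (∑ n ∈ Finset.range N, ee (h * ((n : ℝ) + 1) ^ γ)) := by
        rw [Set.mem_singleton_iff] at hx
        rw [map_sum]
        refine Finset.sum_congr rfl fun n _ => ?_
        have e := ee_sub_mul 0 (h * ((n : ℝ) + 1) ^ γ)
        rw [ee_zero, one_mul] at e
        rw [hx, e]; congr 1; ring
      rw [e, RCLike.norm_conj]; exact this) hε
  exact ⟨N₀, fun N hN => h N hN _ rfl⟩

/-- Distance to the nearest integer. -/
noncomputable def dist1 (x : ℝ) : ℝ := |x - round x|

lemma dist1_nonneg (x : ℝ) : 0 ≤ dist1 x := abs_nonneg _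

lemma dist1_le (x : ℝ) (k : ℤ) : dist1 x ≤ |x - k| := round_le x k

lemma dist1_add_le (x y : ℝ) : dist1 (x + y) ≤ dist1 x + dist1 y := by
  have h := dist1_le (x + y) (round x + round y)
  refine h.trans ?_
  have : x + y - ((round x + round y : ℤ) : ℝ) = (x - round x) + (y - round y) := by
    push_cast; ring
  rw [this]; exact abs_add_le _ _

lemma dist1_int_mul_le (j : ℤ) (x : ℝ) : dist1 (j * x) ≤ |(j : ℝ)| * dist1 x := by
  refine (dist1_le _ (j * round x)).trans ?_
  rw [dist1, ← abs_mul]; push_cast; rw [mul_sub]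

lemma dist1_sum_le {ι : Type*} (s : Finset ι) (f : ι → ℝ) :
    dist1 (∑ i ∈ s, f i) ≤ ∑ i ∈ s, dist1 (f i) := by
  induction s using Finset.induction_on with
  | empty => simp [dist1]
  | insert a s ha ih =>
    rw [Finset.sum_insert ha, Finset.sum_insert ha]
    exact (dist1_add_le _ _).trans (by linarith)

lemma le_dist1 {x : ℝ} (h1 : x ≤ 1 / 2) : x ≤ dist1 x := by
  unfold dist1
  rcases le_or_gt (round x) 0 with h | h
  · have h' : ((round x : ℤ) : ℝ) ≤ 0 := by exact_mod_cast h
    exact le_abs.2 (Or.inl (by linarith))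
  · have h' : (1 : ℝ) ≤ ((round x : ℤ) : ℝ) := by exact_mod_cast h
    exact le_abs.2 (Or.inr (by linarith))

lemma one_sub_cos_ge (x : ℝ) : 8 * dist1 x ^ 2 ≤ 1 - Real.cos (2 * π * x) := by
  set d := x - round x with hd
  have e : Real.cos (2 * π * x) = Real.cos (2 * (π * d)) := by
    rw [hd]
    have := Real.cos_sub_int_mul_two_pi (2 * π * x) (round x)
    rw [← this]; congr 1; ring
  have hdd : |d| ≤ 1 / 2 := abs_sub_round x
  have h1 : 2 * |d| ≤ |Real.sin (π * d)| := by
    have key := Real.mul_abs_le_abs_sin (x := π * d) (by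
      rw [abs_mul, abs_of_pos pi_pos]; nlinarith [pi_pos])
    rw [abs_mul, abs_of_pos pi_pos] at key
    have : 2 / π * (π * |d|) = 2 * |d| := by field_simp
    linarith
  have h2 : (2 * |d|) ^ 2 ≤ Real.sin (π * d) ^ 2 := by
    rw [← sq_abs (Real.sin _)]; gcongr
  have h3 : Real.cos (2 * (π * d)) = 1 - 2 * Real.sin (π * d) ^ 2 := by
    rw [Real.cos_two_mul, Real.cos_sq']; ring
  rw [e, h3]; unfold dist1; nlinarith [h2]

/-- The sum controlling the decay of the generating function on the minor arcs. -/
noncomputable def minorSum (κ : ℝ) (N : ℕ) (t : ℝ) : ℝ :=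
  ∑ n ∈ Finset.range N, dist1 (t * psPart κ (n + 1)) ^ 2

lemma minorSum_mono (κ : ℝ) (t : ℝ) {N M : ℕ} (h : N ≤ M) : minorSum κ N t ≤ minorSum κ M t :=
  Finset.sum_le_sum_of_subset_of_nonneg (Finset.range_mono h) fun _ _ _ => sq_nonneg _

lemma minorSum_int_mul_le (κ : ℝ) (t : ℝ) (N : ℕ) (j : ℤ) :
    minorSum κ N (j * t) ≤ (j : ℝ) ^ 2 * minorSum κ N t := by
  unfold minorSum
  rw [Finset.mul_sum]
  refine Finset.sum_le_sum fun n _ => ?_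
  rw [← sq_abs (j : ℝ), ← mul_pow, mul_assoc]
  exact pow_le_pow_left₀ (dist1_nonneg _) (dist1_int_mul_le _ _) 2

lemma psPart_le (κ : ℝ) (ℓ : ℕ) : (psPart κ ℓ : ℝ) ≤ (ℓ : ℝ) ^ κ :=
  Nat.floor_le (by positivity)

lemma lt_psPart (κ : ℝ) (ℓ : ℕ) : (ℓ : ℝ) ^ κ < psPart κ ℓ + 1 := Nat.lt_floor_add_one _

lemma psPart_le_of_lt {κ : ℝ} (hκ : 0 < κ) {y : ℝ} (hy : 0 ≤ y) {n : ℕ}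
    (hn : n < ⌊y ^ (1 / κ)⌋₊) : (psPart κ (n + 1) : ℝ) ≤ y := by
  refine (psPart_le _ _).trans ?_
  have h1 : ((n + 1 : ℕ) : ℝ) ≤ y ^ (1 / κ) :=
    (Nat.cast_le.2 hn).trans (Nat.floor_le (by positivity))
  calc ((n + 1 : ℕ) : ℝ) ^ κ ≤ (y ^ (1 / κ)) ^ κ := by gcongr
    _ = y := by rw [← Real.rpow_mul hy, one_div_mul_cancel hκ.ne', Real.rpow_one]

lemma minorSum_major {κ : ℝ} (hκ : 0 < κ) : ∃ c > 0, ∃ Y ≥ (1 : ℝ), ∀ y ≥ Y, ∀ t ≥ (0 : ℝ),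
    t * y ≤ 1 / 2 → c * y ^ (1 / κ) * (t * y) ^ 2 ≤ minorSum κ ⌊y ^ (1 / κ)⌋₊ t := by
  set α := 1 / κ with hα
  have hα0 : 0 < α := by positivity
  set r : ℝ := (2 / 3 : ℝ) ^ α with hr
  have hr1 : r < 1 := Real.rpow_lt_one (by norm_num) (by norm_num) hα0
  have hr0 : 0 < r := by positivity
  set c := (1 - r) / 2 with hc
  have hc0 : 0 < c := by rw [hc]; linarith
  obtain ⟨Y, hY⟩ := (eventually_atTop.1 ((tendsto_rpow_atTop hα0).eventually_ge_atTop (1 / c)))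
  refine ⟨c / 4, by positivity, max Y 6, le_trans (by norm_num) (le_max_right _ _),
    fun y hy t ht hty => ?_⟩
  have hy6 : 6 ≤ y := (le_max_right _ _).trans hy
  have hyY := hY y ((le_max_left _ _).trans hy)
  have hy0 : 0 < y := by linarith
  set N := ⌊y ^ α⌋₊ with hN
  set s := (Finset.range N).filter fun n => y / 2 ≤ (psPart κ (n + 1) : ℝ) with hs
  have hcard : c * y ^ α ≤ (s.card : ℝ) := by
    have h1 := Finset.card_filter_add_card_filter_not (s := Finset.range N)
      (fun n => y / 2 ≤ (psPart κ (n + 1) : ℝ))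
    rw [Finset.card_range] at h1
    have h2 : ((Finset.range N).filter fun n => ¬ y / 2 ≤ (psPart κ (n + 1) : ℝ)) ⊆
        Finset.range ⌊r * y ^ α⌋₊ := by
      intro n hn
      rw [Finset.mem_filter] at hn
      rw [Finset.mem_range, Nat.lt_iff_add_one_le, Nat.le_floor_iff (by positivity)]
      have h3 := lt_psPart κ (n + 1)
      have h4 : ((n + 1 : ℕ) : ℝ) ^ κ ≤ 2 / 3 * y := by
        have := not_le.1 hn.2; linarith
      calc ((n + 1 : ℕ) : ℝ) = (((n + 1 : ℕ) : ℝ) ^ κ) ^ α := by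
            rw [← Real.rpow_mul (by positivity), hα, mul_one_div_cancel hκ.ne', Real.rpow_one]
        _ ≤ (2 / 3 * y) ^ α := by gcongr
        _ = r * y ^ α := by rw [Real.mul_rpow (by norm_num) hy0.le]
    have h3 := Finset.card_le_card h2
    rw [Finset.card_range] at h3
    have h1 : s.card + ((Finset.range N).filter fun n =>
        ¬ y / 2 ≤ (psPart κ (n + 1) : ℝ)).card = N := by convert h1
    have h4 : ((⌊r * y ^ α⌋₊ : ℕ) : ℝ) ≤ r * y ^ α := Nat.floor_le (by positivity)
    have h5 : y ^ α < N + 1 := Nat.lt_floor_add_one _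
    have h6 : (N : ℝ) ≤ s.card + ⌊r * y ^ α⌋₊ := by
      exact_mod_cast (by omega : N ≤ s.card + ⌊r * y ^ α⌋₊)
    have h7 : 1 ≤ c * y ^ α := by
      rw [div_le_iff₀ hc0] at hyY; linarith
    have : y ^ α = r * y ^ α + 2 * c * y ^ α := by rw [hc]; ring
    linarith
  calc c / 4 * y ^ α * (t * y) ^ 2 = (c * y ^ α) * (t * (y / 2)) ^ 2 := by ring
    _ ≤ s.card * (t * (y / 2)) ^ 2 := by gcongr
    _ = ∑ n ∈ s, (t * (y / 2)) ^ 2 := by simp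
    _ ≤ ∑ n ∈ s, dist1 (t * psPart κ (n + 1)) ^ 2 := by
        refine Finset.sum_le_sum fun n hn => ?_
        rw [hs, Finset.mem_filter, Finset.mem_range] at hn
        have h1 := psPart_le_of_lt hκ hy0.le hn.1
        have h2 : t * psPart κ (n + 1) ≤ 1 / 2 := le_trans (by gcongr) hty
        refine pow_le_pow_left₀ (by positivity) ?_ 2
        exact le_trans (by gcongr; exact hn.2) (le_dist1 h2)
    _ ≤ minorSum κ N t :=
        Finset.sum_le_sum_of_subset_of_nonneg (Finset.filter_subset _ _) fun _ _ _ => sq_nonneg _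

lemma fract_mean_sub_rpow {γ : ℝ} (hγ : 0 < γ) (hn : ∀ j : ℕ, γ ≠ j) (c : ℝ) {ε : ℝ}
    (hε : 0 < ε) : ∃ N₀ : ℕ, ∀ N ≥ N₀,
      |∑ n ∈ Finset.range N, (Int.fract (((n : ℝ) + 1) ^ γ - c) - 1 / 2)| ≤ ε * N := by
  obtain ⟨N₀, h⟩ := fract_mean {fun n : ℕ => ((n : ℝ) + 1) ^ γ - c}
    (fun h hh ε hε => by
      have hh' : (1 : ℝ) ≤ h := by exact_mod_cast hh
      obtain ⟨N₀, hN₀⟩ := weyl_sum_rpow hγ hn (t₀ := h) (by positivity) h hε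
      refine ⟨N₀, fun N hN x hx => ?_⟩
      have := hN₀ N hN h ⟨le_rfl, le_rfl⟩
      have e : ∑ n ∈ Finset.range N, ee (h * x n) =
          ee (-(h * c)) * ∑ n ∈ Finset.range N, ee (h * ((n : ℝ) + 1) ^ γ) := by
        rw [Set.mem_singleton_iff] at hx
        rw [Finset.mul_sum]
        refine Finset.sum_congr rfl fun n _ => ?_
        rw [hx, ← ee_add]; congr 1; ring
      rw [e, norm_mul, norm_ee, one_mul]; exact this) hε
  exact ⟨N₀, fun N hN => h N hN _ rfl⟩

lemma fract_sub_eq {c : ℝ} (hc0 : 0 ≤ c) (hc1 : c < 1) (y : ℝ) :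
    Int.fract (y - c) = Int.fract y - c + if Int.fract y < c then 1 else 0 := by
  have h0 := Int.fract_nonneg y
  have h1 := Int.fract_lt_one y
  split_ifs with h
  · rw [Int.fract_eq_iff]
    refine ⟨by linarith, by linarith, ⌊y⌋ - 1, ?_⟩
    push_cast; rw [Int.fract]; ring
  · rw [Int.fract_eq_iff]
    refine ⟨by linarith, by linarith, ⌊y⌋, ?_⟩
    rw [Int.fract]; ring

lemma fract_mul_le {ε t y : ℝ} (hε : 0 < ε) (ht : t ∈ Set.Icc (1 / 4 : ℝ) (1 / 2)) :
    Int.fract (t * y) ≤ 1 / 2 * Int.fract y + (1 + 1 / ε) * dist1 (t * ⌊y⌋) +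
      if Int.fract y < 4 * ε then 1 else 0 := by
  set f := Int.fract y with hf
  have h0 : 0 ≤ f := Int.fract_nonneg y
  have h1 : f < 1 := Int.fract_lt_one y
  set r := round (t * ⌊y⌋) with hr
  set d := t * ⌊y⌋ - r with hd
  have hD : dist1 (t * ⌊y⌋) = |d| := rfl
  have hdh : |d| ≤ 1 / 2 := abs_sub_round _
  have hy : t * y = d + t * f + r := by
    rw [hd, hf, Int.fract]; ring
  have hdn := abs_nonneg d
  have hdl := le_abs_self d
  have hdl' := neg_abs_le d
  have htf : t * f ≤ 1 / 2 * f := by gcongr; exact ht.2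
  have htf0 : 0 ≤ t * f := mul_nonneg (by linarith [ht.1]) h0
  have hq : 0 ≤ 1 / ε * |d| := by positivity
  rw [hy, Int.fract_add_intCast, hD]
  by_cases hs : 0 ≤ d + t * f
  · have : Int.fract (d + t * f) = d + t * f :=
      Int.fract_eq_self.2 ⟨hs, by linarith⟩
    rw [this]
    split_ifs <;> nlinarith
  · have hlt := (Int.fract_lt_one (d + t * f)).le
    by_cases hde : |d| < ε
    · have : f < 4 * ε := by
        have : 1 / 4 * f ≤ t * f := by gcongr; exact ht.1
        linarith [not_le.1 hs]
      rw [if_pos this]; nlinarith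
    · have : 1 ≤ 1 / ε * |d| := by
        rw [div_mul_eq_mul_div, one_mul, le_div_iff₀ hε]; linarith [not_lt.1 hde]
      split_ifs <;> nlinarith

lemma minorSum_of_sum_dist {κ t c : ℝ} {N : ℕ} (hc : 0 ≤ c)
    (h : c * N ≤ ∑ n ∈ Finset.range N, dist1 (t * psPart κ (n + 1))) :
    c ^ 2 * N ≤ minorSum κ N t := by
  rcases Nat.eq_zero_or_pos N with rfl | hN
  · simp [minorSum]
  have h1 := sq_sum_le_card_mul_sum_sq (s := Finset.range N)
    (f := fun n => dist1 (t * psPart κ (n + 1)))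
  have h2 : (c * N) ^ 2 ≤ N * minorSum κ N t := by
    rw [Finset.card_range] at h1
    exact (pow_le_pow_left₀ (by positivity) h 2).trans h1
  have hN' : (0 : ℝ) < N := by exact_mod_cast hN
  refine le_of_mul_le_mul_left ?_ hN'
  calc (N : ℝ) * (c ^ 2 * N) = (c * N) ^ 2 := by ring
    _ ≤ _ := h2

lemma minorSum_middle_of_not_nat {κ : ℝ} (hκ : 0 < κ) (hn : ∀ j : ℕ, κ ≠ j) :
    ∃ c > (0 : ℝ), ∃ N₀ : ℕ, ∀ N ≥ N₀, ∀ t ∈ Set.Icc (1 / 4 : ℝ) (1 / 2),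
      c * N ≤ minorSum κ N t := by
  set ε : ℝ := 1 / 32 with hε
  obtain ⟨N₁, h₁⟩ := fract_mean_rpow hκ hn (t₀ := 1 / 4) (by norm_num) (1 / 2)
    (ε := 1 / 100) (by norm_num)
  obtain ⟨N₂, h₂⟩ := fract_mean_sub_rpow hκ hn 0 (ε := 1 / 100) (by norm_num)
  obtain ⟨N₃, h₃⟩ := fract_mean_sub_rpow hκ hn (4 * ε) (ε := 1 / 100) (by norm_num)
  refine ⟨(1 / 500) ^ 2, by norm_num, max N₁ (max N₂ N₃), fun N hN t ht => ?_⟩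
  have a1 := (abs_le.1 (h₁ N ((le_max_left _ _).trans hN) t ht)).1
  have a2 := abs_le.1 (h₂ N (((le_max_left _ _).trans (le_max_right _ _)).trans hN))
  have a3 := abs_le.1 (h₃ N (((le_max_right _ _).trans (le_max_right _ _)).trans hN))
  refine minorSum_of_sum_dist (by norm_num) ?_
  set X := ∑ n ∈ Finset.range N, dist1 (t * psPart κ (n + 1)) with hX
  set B : ℝ := ∑ n ∈ Finset.range N,
    if Int.fract (((n : ℝ) + 1) ^ κ) < 4 * ε then (1 : ℝ) else 0 with hB
  set Y := ∑ n ∈ Finset.range N, Int.fract (((n : ℝ) + 1) ^ κ) with hY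
  simp only [sub_zero, Finset.sum_sub_distrib, Finset.sum_const, Finset.card_range,
    nsmul_eq_mul, ← hY] at a1 a2
  have e3 : ∑ n ∈ Finset.range N, (Int.fract (((n : ℝ) + 1) ^ κ - 4 * ε) - 1 / 2) =
      Y - N * (4 * ε) + B - N * (1 / 2) := by
    rw [Finset.sum_sub_distrib]
    simp only [fract_sub_eq (c := 4 * ε) (by norm_num [hε]) (by norm_num [hε]),
      Finset.sum_add_distrib, Finset.sum_sub_distrib, Finset.sum_const, Finset.card_range,
      nsmul_eq_mul, ← hB, ← hY]
  rw [e3] at a3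
  have key : ∑ n ∈ Finset.range N, Int.fract (t * ((n : ℝ) + 1) ^ κ) ≤
      1 / 2 * Y + (1 + 1 / ε) * X + B := by
    rw [hX, hY, hB, Finset.mul_sum, Finset.mul_sum, ← Finset.sum_add_distrib,
      ← Finset.sum_add_distrib]
    refine Finset.sum_le_sum fun n _ => ?_
    have := fract_mul_le (ε := ε) (t := t) (y := ((n : ℝ) + 1) ^ κ) (by norm_num [hε]) ht
    have e : (psPart κ (n + 1) : ℝ) = ((⌊((n : ℝ) + 1) ^ κ⌋ : ℤ) : ℝ) := by
      rw [psPart, natCast_floor_eq_intCast_floor (by positivity)]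
      push_cast; rfl
    rw [e]; convert this
  norm_num [hε] at key a3 ⊢
  linarith [a1, a2.1, a2.2, a3.1, a3.2]

lemma psPart_natCast (k ℓ : ℕ) : psPart (k : ℝ) ℓ = ℓ ^ k := by
  unfold psPart
  rw [Real.rpow_natCast]; exact_mod_cast Nat.floor_natCast (R := ℝ) (ℓ ^ k)

lemma dist1_factorial_le (k : ℕ) (t x : ℝ) :
    dist1 (k.factorial * t) ≤
      ∑ i ∈ Finset.range (k + 1), (k.choose i : ℝ) * dist1 (t * (x + i) ^ k) := by
  have h := fwdDiff_iter_eq_sum_shift (1 : ℝ) (fun r : ℝ => r ^ k) k x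
  rw [fwdDiff_iter_eq_factorial] at h
  have e : (k.factorial : ℝ) * t = ∑ i ∈ Finset.range (k + 1),
      (((-1 : ℤ) ^ (k - i) * k.choose i : ℤ) : ℝ) * (t * (x + i) ^ k) := by
    have h' : (k.factorial : ℝ) = _ := h
    rw [h', Finset.sum_mul]
    refine Finset.sum_congr rfl fun i _ => ?_
    rw [zsmul_eq_mul]; simp only [nsmul_eq_mul, mul_one]; ring
  rw [e]
  refine (dist1_sum_le _ _).trans (Finset.sum_le_sum fun i _ => ?_)
  refine (dist1_int_mul_le _ _).trans (le_of_eq ?_)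
  congr 1; push_cast; rw [abs_mul, abs_pow]; simp

lemma sum_dist1_pow_ge (k N : ℕ) (hN : 2 * k ≤ N) (t : ℝ) :
    dist1 (k.factorial * t) / 2 ^ (k + 1) * N ≤
      ∑ n ∈ Finset.range N, dist1 (t * psPart (k : ℝ) (n + 1)) := by
  set X := ∑ n ∈ Finset.range N, dist1 (t * psPart (k : ℝ) (n + 1)) with hX
  set η := dist1 (k.factorial * t) with hη
  have hη0 : 0 ≤ η := dist1_nonneg _
  have h1 : ∑ n ∈ Finset.range (N - k), η ≤ 2 ^ k * X := by
    calc ∑ n ∈ Finset.range (N - k), η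
        ≤ ∑ n ∈ Finset.range (N - k), ∑ i ∈ Finset.range (k + 1),
            (k.choose i : ℝ) * dist1 (t * ((n : ℝ) + 1 + i) ^ k) :=
          Finset.sum_le_sum fun n _ => dist1_factorial_le k t _
      _ = ∑ i ∈ Finset.range (k + 1), (k.choose i : ℝ) *
            ∑ n ∈ Finset.range (N - k), dist1 (t * ((n : ℝ) + 1 + i) ^ k) := by
          rw [Finset.sum_comm]; simp_rw [Finset.mul_sum]
      _ ≤ ∑ i ∈ Finset.range (k + 1), (k.choose i : ℝ) * X := by
          refine Finset.sum_le_sum fun i hi => ?_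
          gcongr
          rw [Finset.mem_range] at hi
          calc ∑ n ∈ Finset.range (N - k), dist1 (t * ((n : ℝ) + 1 + i) ^ k)
              = ∑ n ∈ Finset.range (N - k), dist1 (t * psPart (k : ℝ) (n + i + 1)) := by
                refine Finset.sum_congr rfl fun n _ => ?_
                rw [psPart_natCast]; push_cast; ring_nf
            _ = ∑ n ∈ (Finset.range (N - k)).image (· + i),
                  dist1 (t * psPart (k : ℝ) (n + 1)) := by
                rw [Finset.sum_image fun _ _ _ _ h => Nat.add_right_cancel h]
            _ ≤ X := by
                refine Finset.sum_le_sum_of_subset_of_nonneg ?_ fun _ _ _ => dist1_nonneg _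
                intro n hn
                rw [Finset.mem_image] at hn
                obtain ⟨a, ha, rfl⟩ := hn
                rw [Finset.mem_range] at ha ⊢; omega
      _ = 2 ^ k * X := by
          rw [← Finset.sum_mul]; congr 1; exact_mod_cast Nat.sum_range_choose k
  rw [Finset.sum_const, Finset.card_range, nsmul_eq_mul, Nat.cast_sub (by omega)] at h1
  have h2 : (2 * k : ℝ) ≤ N := by exact_mod_cast hN
  have h3 : (N : ℝ) / 2 * η ≤ 2 ^ k * X := le_trans (by gcongr; linarith) h1
  have h4 : (0 : ℝ) < 2 ^ k := by positivity
  calc η / 2 ^ (k + 1) * N = (N / 2 * η) / 2 ^ k := by rw [pow_succ]; field_simp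
    _ ≤ X := by rw [div_le_iff₀ h4]; linarith

lemma minorSum_of_dist1_factorial_small {k N Q : ℕ} {t : ℝ}
    (ht : t ∈ Set.Icc (1 / 4 : ℝ) (1 / 2)) (hQN : k.factorial * Q ≤ N)
    (hQ : ((k.factorial * Q : ℕ) : ℝ) ^ k * dist1 (k.factorial * t) ≤ 1 / 8) :
    (1 / 64 : ℝ) * Q ≤ minorSum k N t := by
  set K := k.factorial with hK
  have hK1 : 1 ≤ K := Nat.factorial_pos k
  have hterm : ∀ q < Q, (1 / 8 : ℝ) ≤ dist1 (t * psPart (k : ℝ) (K * q + 1)) := by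
    intro q hq
    rw [psPart_natCast]
    obtain ⟨w, hw⟩ : ∃ w : ℕ, (K * q + 1) ^ k = 1 + K * w := by
      have : (K * q + 1) ^ k ≡ 1 [MOD K] := by
        have : K * q + 1 ≡ 1 [MOD K] := by simp [Nat.ModEq]
        simpa using this.pow k
      have h1 : 1 ≤ (K * q + 1) ^ k := Nat.one_le_pow _ _ (Nat.succ_pos _)
      obtain ⟨w, hw⟩ := (Nat.modEq_iff_dvd' h1).1 this.symm
      exact ⟨w, by omega⟩
    have hwle : (w : ℝ) ≤ ((K * Q : ℕ) : ℝ) ^ k := by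
      have h1 : w ≤ (K * Q) ^ k := by
        calc w ≤ 1 + K * w := by nlinarith
          _ = (K * q + 1) ^ k := hw.symm
          _ ≤ (K * Q) ^ k := Nat.pow_le_pow_left (by nlinarith) k
      exact_mod_cast h1
    have h2 : dist1 t ≤ dist1 (t * ((K * q + 1) ^ k : ℕ)) + w * dist1 (K * t) := by
      have e : t = t * ((K * q + 1) ^ k : ℕ) + ((-(w : ℤ) : ℤ) : ℝ) * (K * t) := by
        rw [hw]; push_cast; ring
      have h3 := dist1_add_le (t * ((K * q + 1) ^ k : ℕ)) (((-(w : ℤ) : ℤ) : ℝ) * (K * t))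
      rw [← e] at h3
      have h4 := dist1_int_mul_le (-(w : ℤ)) (K * t)
      have h5 : |((-(w : ℤ) : ℤ) : ℝ)| = w := by push_cast; simp
      rw [h5] at h4; linarith
    have h6 := le_dist1 ht.2
    have h7 : w * dist1 (K * t) ≤ 1 / 8 :=
      le_trans (by gcongr; exact dist1_nonneg _) hQ
    linarith [ht.1]
  calc (1 / 64 : ℝ) * Q = ∑ q ∈ Finset.range Q, (1 / 8 : ℝ) ^ 2 := by
        rw [Finset.sum_const, Finset.card_range, nsmul_eq_mul]; ring
    _ ≤ ∑ q ∈ Finset.range Q, dist1 (t * psPart (k : ℝ) (K * q + 1)) ^ 2 :=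
        Finset.sum_le_sum fun q hq =>
          pow_le_pow_left₀ (by norm_num) (hterm q (Finset.mem_range.1 hq)) 2
    _ = ∑ n ∈ (Finset.range Q).image (K * ·), dist1 (t * psPart (k : ℝ) (n + 1)) ^ 2 := by
        rw [Finset.sum_image fun _ _ _ _ h => Nat.eq_of_mul_eq_mul_left hK1 h]
    _ ≤ minorSum k N t := by
        refine Finset.sum_le_sum_of_subset_of_nonneg ?_ fun _ _ _ => sq_nonneg _
        intro n hn
        rw [Finset.mem_image] at hn
        obtain ⟨a, ha, rfl⟩ := hn
        rw [Finset.mem_range] at ha ⊢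
        nlinarith

lemma minorSum_middle_nat {k : ℕ} (hk : 1 ≤ k) :
    ∃ c > (0 : ℝ), ∃ p > (0 : ℝ), ∃ N₀ : ℕ, ∀ N ≥ N₀, ∀ t ∈ Set.Icc (1 / 4 : ℝ) (1 / 2),
      c * (N : ℝ) ^ p ≤ minorSum k N t := by
  set K := k.factorial with hK
  have hK1 : 1 ≤ K := Nat.factorial_pos k
  have hKr : (1 : ℝ) ≤ K := by exact_mod_cast hK1
  have hkr : (1 : ℝ) ≤ k := by exact_mod_cast hk
  set p : ℝ := 1 / (4 * k) with hp
  have hp0 : 0 < p := by positivity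
  have hp4 : p ≤ 1 / 4 := by
    rw [hp]; exact one_div_le_one_div_of_le (by norm_num) (by linarith)
  set b : ℝ := 1 / (8 * K) with hb
  have hb0 : 0 < b := by positivity
  have hev := ((tendsto_rpow_atTop hp0).comp tendsto_natCast_atTop_atTop).eventually_ge_atTop
    (2 / b)
  obtain ⟨N₁, hN₁⟩ := eventually_atTop.1 hev
  set c : ℝ := min (1 / 64 * (b / 2)) ((1 / 2 ^ (k + 1)) ^ 2) with hc
  refine ⟨c, by positivity, p, hp0, max N₁ (max (2 * k) 1), fun N hN t ht => ?_⟩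
  have hN1 : 1 ≤ N := ((le_max_right _ _).trans (le_max_right _ _)).trans hN
  have hN1r : (1 : ℝ) ≤ N := by exact_mod_cast hN1
  have hN2 : 2 * k ≤ N := ((le_max_left _ _).trans (le_max_right _ _)).trans hN
  have hNp : 2 / b ≤ (N : ℝ) ^ p := hN₁ N ((le_max_left _ _).trans hN)
  set η := dist1 (K * t) with hη
  have hη0 : 0 ≤ η := dist1_nonneg _
  rcases le_or_gt ((N : ℝ) ^ (-(1 / 4) : ℝ)) η with h | h
  · have h1 := minorSum_of_sum_dist (by positivity) (sum_dist1_pow_ge k N hN2 t)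
    refine le_trans ?_ h1
    calc c * (N : ℝ) ^ p ≤ (1 / 2 ^ (k + 1)) ^ 2 * (N : ℝ) ^ (1 / 2 : ℝ) := by
          gcongr
          · exact min_le_right _ _
          linarith
      _ = ((N : ℝ) ^ (-(1 / 4) : ℝ) / 2 ^ (k + 1)) ^ 2 * N := by
          have e : (N : ℝ) ^ (1 / 2 : ℝ) = ((N : ℝ) ^ (-(1 / 4) : ℝ)) ^ 2 * N := by
            rw [← Real.rpow_natCast, ← Real.rpow_mul (by positivity)]
            nth_rewrite 3 [← Real.rpow_one (N : ℝ)]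
            rw [← Real.rpow_add (by positivity)]; norm_num
          rw [e]; ring
      _ ≤ _ := by gcongr
  · set Q := ⌊b * (N : ℝ) ^ p⌋₊ with hQ
    have hQle : (Q : ℝ) ≤ b * (N : ℝ) ^ p := Nat.floor_le (by positivity)
    have hQlt : b * (N : ℝ) ^ p < Q + 1 := Nat.lt_floor_add_one _
    have hKQ : ((K * Q : ℕ) : ℝ) ≤ 1 / 8 * (N : ℝ) ^ p := by
      push_cast
      calc (K : ℝ) * Q ≤ K * (b * (N : ℝ) ^ p) := by gcongr
        _ = _ := by rw [hb]; field_simp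
    have hNp1 : (N : ℝ) ^ p ≤ N := by
      calc (N : ℝ) ^ p ≤ (N : ℝ) ^ (1 : ℝ) := by
            gcongr
            all_goals linarith
        _ = N := Real.rpow_one _
    have hB : (1 / 64 : ℝ) * Q ≤ minorSum k N t := by
      refine minorSum_of_dist1_factorial_small ht ?_ ?_
      · have : ((K * Q : ℕ) : ℝ) ≤ N := by linarith
        exact_mod_cast this
      · calc ((K * Q : ℕ) : ℝ) ^ k * η
            ≤ (1 / 8 * (N : ℝ) ^ p) ^ k * (N : ℝ) ^ (-(1 / 4) : ℝ) := by gcongr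
          _ = (1 / 8) ^ k * ((N : ℝ) ^ (p * k) * (N : ℝ) ^ (-(1 / 4) : ℝ)) := by
              rw [mul_pow, ← Real.rpow_mul_natCast (by positivity)]; ring
          _ = (1 / 8) ^ k := by
              rw [← Real.rpow_add (by positivity), hp]
              have : 1 / (4 * (k : ℝ)) * k + -(1 / 4) = 0 := by field_simp; ring
              rw [this, Real.rpow_zero, mul_one]
          _ ≤ (1 / 8) ^ 1 := pow_le_pow_of_le_one (by norm_num) (by norm_num) hk
          _ = 1 / 8 := pow_one _
    refine le_trans ?_ hB
    have h2 : b / 2 * (N : ℝ) ^ p ≤ Q := by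
      rw [div_le_iff₀ hb0] at hNp; linarith
    calc c * (N : ℝ) ^ p ≤ 1 / 64 * (b / 2) * (N : ℝ) ^ p := by gcongr; exact min_le_left _ _
      _ = 1 / 64 * (b / 2 * (N : ℝ) ^ p) := by ring
      _ ≤ _ := by gcongr

lemma minorSum_middle {κ : ℝ} (hκ : 0 < κ) :
    ∃ c > (0 : ℝ), ∃ p > (0 : ℝ), ∃ N₀ : ℕ, ∀ N ≥ N₀, ∀ t ∈ Set.Icc (1 / 4 : ℝ) (1 / 2),
      c * (N : ℝ) ^ p ≤ minorSum κ N t := by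
  by_cases hn : ∃ j : ℕ, κ = j
  · obtain ⟨k, rfl⟩ := hn
    exact minorSum_middle_nat (by exact_mod_cast hκ)
  · push Not at hn
    obtain ⟨c, hc, N₀, h⟩ := minorSum_middle_of_not_nat hκ hn
    exact ⟨c, hc, 1, one_pos, N₀, fun N hN t ht => by simpa using h N hN t ht⟩

/-- On the minor arcs the controlling sum exceeds any multiple of `log y`. -/
lemma minorSum_ge_log {κ : ℝ} (hκ : 0 < κ) {K : ℝ} (hK : 0 < K) :
    ∃ Y ≥ (1 : ℝ), ∀ y ≥ Y, ∀ t : ℝ, 1 / (2 * y) ≤ t → t ≤ 1 / 2 →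
      K * Real.log y ≤ minorSum κ ⌊y ^ (1 / κ)⌋₊ t := by
  obtain ⟨c₁, hc₁, Y₁, hY₁, h₁⟩ := minorSum_major hκ
  obtain ⟨c₂, hc₂, p, hp, N₀, h₂⟩ := minorSum_middle hκ
  set α := 1 / κ with hα
  have hα0 : 0 < α := by positivity
  have hακ : κ * α = 1 := mul_one_div_cancel hκ.ne'
  have l1 : ∀ᶠ y : ℝ in atTop, max 1 (max Y₁ (K * 4 / c₁)) ≤ Real.log y :=
    tendsto_log_atTop.eventually_ge_atTop _
  have l2 : ∀ᶠ y : ℝ in atTop, (N₀ + 2 : ℝ) ≤ y ^ α :=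
    (tendsto_rpow_atTop hα0).eventually_ge_atTop _
  have l3 : ∀ᶠ y : ℝ in atTop,
      Real.log y ^ (1 + 4 * κ + 2 * Y₁) ≤ c₂ * (1 / 2) ^ p / K * y ^ (α * p) := by
    have := (isLittleO_log_rpow_rpow_atTop (1 + 4 * κ + 2 * Y₁) (s := α * p) (by positivity)).bound
      (c := c₂ * (1 / 2) ^ p / K) (by positivity)
    filter_upwards [this, eventually_ge_atTop 1] with y hy hy1
    have := Real.log_nonneg hy1
    rwa [Real.norm_of_nonneg (by positivity), Real.norm_of_nonneg (by positivity)] at hy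
  obtain ⟨Y, hY⟩ := eventually_atTop.1 (l1.and (l2.and l3))
  refine ⟨max Y 1, le_max_right _ _, fun y hy t ht0 ht1 => ?_⟩
  obtain ⟨b1, b2, b3⟩ := hY y ((le_max_left _ _).trans hy)
  have hy1 : 1 ≤ y := (le_max_right _ _).trans hy
  have hy0 : 0 < y := by linarith
  have hL1 : 1 ≤ Real.log y := (le_max_left _ _).trans b1
  have hL2 : Y₁ ≤ Real.log y := ((le_max_left _ _).trans (le_max_right _ _)).trans b1
  have hL3 : K * 4 / c₁ ≤ Real.log y := ((le_max_right _ _).trans (le_max_right _ _)).trans b1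
  set L := Real.log y with hL
  have hL0 : 0 < L := by linarith
  have htpos : 0 < t := lt_of_lt_of_le (by positivity) ht0
  set w := 1 / (2 * t) with hw
  have hw0 : 0 < w := by positivity
  have htw : t * w = 1 / 2 := by rw [hw]; field_simp
  have hwy : w ≤ y := by
    rw [hw, div_le_iff₀ (by positivity)]
    rw [div_le_iff₀ (by positivity)] at ht0; linarith
  rcases le_or_gt (max Y₁ (L ^ (2 * κ))) w with h | h
  · have hwY : Y₁ ≤ w := (le_max_left _ _).trans h
    have hwL : L ^ (2 * κ) ≤ w := (le_max_right _ _).trans h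
    have k1 := h₁ w hwY t htpos.le htw.le
    have k2 : minorSum κ ⌊w ^ α⌋₊ t ≤ minorSum κ ⌊y ^ α⌋₊ t :=
      minorSum_mono _ _ (Nat.floor_le_floor (by gcongr))
    have k3 : L ^ 2 ≤ w ^ α := by
      calc L ^ 2 = (L ^ (2 * κ)) ^ α := by
            rw [← Real.rpow_mul hL0.le, mul_assoc, hακ, mul_one]; exact_mod_cast rfl
        _ ≤ w ^ α := by gcongr
    refine le_trans ?_ (k1.trans k2)
    rw [htw]
    rw [div_le_iff₀ hc₁] at hL3
    calc K * L = (K * 4) * L / 4 := by ring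
      _ ≤ (L * c₁) * L / 4 := by gcongr
      _ = c₁ * L ^ 2 * (1 / 2) ^ 2 := by ring
      _ ≤ _ := by gcongr
  · set j := ⌊w⌋₊ with hj
    have hw1 : 1 ≤ w := by
      rw [hw, le_div_iff₀ (by positivity)]; linarith
    have hj1 : 1 ≤ j := Nat.one_le_floor_iff _ |>.2 hw1
    have hjr : (1 : ℝ) ≤ j := by exact_mod_cast hj1
    have hjw : (j : ℝ) ≤ w := Nat.floor_le hw0.le
    have hwj : w < j + 1 := Nat.lt_floor_add_one _
    have hjt : (j : ℝ) * t ∈ Set.Icc (1 / 4 : ℝ) (1 / 2) := by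
      constructor
      · have : w ≤ 2 * j := by linarith
        nlinarith
      · nlinarith
    set N := ⌊y ^ α⌋₊ with hN
    have hNlt : y ^ α < N + 1 := Nat.lt_floor_add_one _
    have hNN : N₀ ≤ N := by
      have : (N₀ : ℝ) ≤ N := by linarith
      exact_mod_cast this
    have k1 := h₂ N hNN _ hjt
    have k2 := minorSum_int_mul_le κ t N j
    have hN2 : 1 / 2 * y ^ α ≤ N := by
      have : (0 : ℝ) ≤ N₀ := Nat.cast_nonneg _
      linarith
    have hjL : (j : ℝ) ≤ L ^ (2 * κ + Y₁) := by
      refine hjw.trans (h.le.trans (max_le ?_ ?_)) 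
      · calc Y₁ ≤ L := hL2
          _ = L ^ (1 : ℝ) := (Real.rpow_one _).symm
          _ ≤ _ := by
            refine Real.rpow_le_rpow_of_exponent_le hL1 ?_
            linarith
      · refine Real.rpow_le_rpow_of_exponent_le hL1 ?_
        linarith
    have k3 : L * (j : ℝ) ^ 2 ≤ L ^ (1 + 4 * κ + 2 * Y₁) := by
      calc L * (j : ℝ) ^ 2 ≤ L * (L ^ (2 * κ + Y₁)) ^ 2 := by gcongr
        _ = L ^ (1 : ℝ) * L ^ (4 * κ + 2 * Y₁) := by
            rw [← Real.rpow_mul_natCast hL0.le, Real.rpow_one]; congr 2; push_cast; ring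
        _ = _ := by rw [← Real.rpow_add hL0]; congr 1; ring
    have k4 : K * (L * (j : ℝ) ^ 2) ≤ c₂ * (N : ℝ) ^ p := by
      calc K * (L * (j : ℝ) ^ 2) ≤ K * (c₂ * (1 / 2) ^ p / K * y ^ (α * p)) := by
            exact mul_le_mul_of_nonneg_left (k3.trans b3) hK.le
        _ = c₂ * (1 / 2 * y ^ α) ^ p := by
            rw [Real.mul_rpow (by norm_num) (by positivity), ← Real.rpow_mul hy0.le]
            field_simp
        _ ≤ _ := by gcongr
    have k5 : (j : ℝ) ^ 2 * (K * L) ≤ (j : ℝ) ^ 2 * minorSum κ N t := by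
      have : ((j : ℤ) : ℝ) = j := by norm_cast
      rw [this] at k2
      calc (j : ℝ) ^ 2 * (K * L) = K * (L * (j : ℝ) ^ 2) := by ring
        _ ≤ _ := k4.trans (k1.trans k2)
    exact le_of_mul_le_mul_left k5 (by positivity)

/-- The polynomial `1 + X + ⋯ + X ^ m`. -/
noncomputable def gpoly (m : ℕ) : Polynomial ℝ := ∑ j ∈ Finset.range (m + 1), Polynomial.X ^ j

/-- Numerators of the derivatives of `x ↦ log (gpoly m (exp (-x)))`. -/
noncomputable def gnum (m : ℕ) : ℕ → Polynomial ℝ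
  | 0 => -(gpoly m).derivative
  | i + 1 => -(gnum m i + Polynomial.X * (gnum m i).derivative) * gpoly m +
      Polynomial.C ((i : ℝ) + 1) * Polynomial.X * gnum m i * (gpoly m).derivative

/-- The `i`-th derivative of `x ↦ log (gpoly m (exp (-x)))`. -/
noncomputable def gd (m : ℕ) : ℕ → ℝ → ℝ
  | 0 => fun x => Real.log ((gpoly m).eval (rexp (-x)))
  | i + 1 => fun x => rexp (-x) * (gnum m i).eval (rexp (-x)) /
      (gpoly m).eval (rexp (-x)) ^ (i + 1)

lemma gpoly_eval (m : ℕ) (y : ℝ) : (gpoly m).eval y = ∑ j ∈ Finset.range (m + 1), y ^ j := by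
  simp [gpoly, Polynomial.eval_finsetSum]

lemma one_le_gpoly (m : ℕ) {y : ℝ} (hy : 0 ≤ y) : 1 ≤ (gpoly m).eval y := by
  rw [gpoly_eval, Finset.sum_range_succ']
  have : 0 ≤ ∑ j ∈ Finset.range m, y ^ (j + 1) := Finset.sum_nonneg fun _ _ => by positivity
  simpa using this

lemma gpoly_le (m : ℕ) {y : ℝ} (hy : 0 ≤ y) (hy1 : y ≤ 1) : (gpoly m).eval y ≤ 1 + m * y := by
  rw [gpoly_eval, Finset.sum_range_succ']
  have : ∑ j ∈ Finset.range m, y ^ (j + 1) ≤ ∑ j ∈ Finset.range m, y :=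
    Finset.sum_le_sum fun j _ => by
      rw [pow_succ]; exact mul_le_of_le_one_left hy (pow_le_one₀ hy hy1)
  simp at this ⊢; linarith

lemma gd_zero_zero (m : ℕ) : gd m 0 0 = Real.log ((m : ℝ) + 1) := by
  simp [gd, gpoly_eval]

lemma hasDerivAt_gd (m i : ℕ) (x : ℝ) : HasDerivAt (gd m i) (gd m (i + 1) x) x := by
  have he : HasDerivAt (fun x : ℝ => rexp (-x)) (-rexp (-x)) x := by
    simpa using (hasDerivAt_neg x).exp
  have hpos : 0 < (gpoly m).eval (rexp (-x)) :=
    lt_of_lt_of_le one_pos (one_le_gpoly m (Real.exp_pos _).le)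
  have hD := ((gpoly m).hasDerivAt (rexp (-x))).comp x he
  cases i with
  | zero =>
    refine (hD.log hpos.ne').congr_deriv ?_
    simp only [gd, gnum, Function.comp, Polynomial.eval_neg, zero_add, pow_one]
    ring
  | succ i =>
    have hp := ((gnum m i).hasDerivAt (rexp (-x))).comp x he
    have h := (he.mul hp).div (hD.pow (i + 1)) (pow_ne_zero _ hpos.ne')
    refine h.congr_deriv ?_
    simp only [gd, gnum, Function.comp, Pi.mul_apply, Pi.pow_apply, Polynomial.eval_add,
      Polynomial.eval_mul, Polynomial.eval_neg, Polynomial.eval_X, Polynomial.eval_C]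
    field_simp
    push_cast
    ring

lemma differentiable_gd (m i : ℕ) : Differentiable ℝ (gd m i) := fun x =>
  (hasDerivAt_gd m i x).differentiableAt

lemma continuous_gd (m i : ℕ) : Continuous (gd m i) := (differentiable_gd m i).continuous

lemma gd_zero_nonneg (m : ℕ) (x : ℝ) : 0 ≤ gd m 0 x :=
  Real.log_nonneg (one_le_gpoly m (Real.exp_pos _).le)

lemma gd_zero_le (m : ℕ) {x : ℝ} (hx : 0 ≤ x) : gd m 0 x ≤ m * rexp (-x) := by
  have h1 := one_le_gpoly m (Real.exp_pos (-x)).le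
  have h2 := Real.log_le_sub_one_of_pos (lt_of_lt_of_le one_pos h1)
  have h3 := gpoly_le m (Real.exp_pos (-x)).le (Real.exp_le_one_iff.2 (by linarith))
  show Real.log _ ≤ _
  linarith

lemma gd_zero_antitone (m : ℕ) : Antitone (gd m 0) := by
  intro x y hxy
  refine Real.log_le_log (lt_of_lt_of_le one_pos (one_le_gpoly m (Real.exp_pos _).le)) ?_
  rw [gpoly_eval, gpoly_eval]
  gcongr

lemma gd_bound (m i : ℕ) : ∃ C > 0, ∀ x : ℝ, 0 ≤ x → |gd m i x| ≤ C * rexp (-x) := by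
  cases i with
  | zero =>
    refine ⟨m + 1, by positivity, fun x hx => ?_⟩
    rw [abs_of_nonneg (gd_zero_nonneg m x)]
    have := gd_zero_le m hx
    have := Real.exp_pos (-x)
    linarith
  | succ i =>
    obtain ⟨C, hC⟩ := isCompact_Icc.exists_bound_of_continuousOn
      (f := fun y => (gnum m i).eval y) (s := Set.Icc (0 : ℝ) 1)
      (Polynomial.continuous _).continuousOn
    refine ⟨max C 1, by positivity, fun x hx => ?_⟩
    have h1 := one_le_gpoly m (Real.exp_pos (-x)).le
    have h2 := hC (rexp (-x)) ⟨(Real.exp_pos _).le, Real.exp_le_one_iff.2 (by linarith)⟩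
    rw [Real.norm_eq_abs] at h2
    show |rexp (-x) * (gnum m i).eval (rexp (-x)) / (gpoly m).eval (rexp (-x)) ^ (i + 1)| ≤ _
    have h3 : 1 ≤ (gpoly m).eval (rexp (-x)) ^ (i + 1) := one_le_pow₀ h1
    rw [abs_div, abs_mul, abs_of_pos (Real.exp_pos _), abs_of_pos (lt_of_lt_of_le one_pos h3)]
    refine (div_le_self (by positivity) h3).trans ?_
    rw [mul_comm]
    gcongr
    exact h2.trans (le_max_left _ _)

/-- Taylor expansion of the derivatives of `gd m 0`, to the left of `x`. -/
lemma gd_taylor (m R : ℕ) : ∀ i, ∃ C > 0, ∀ x h : ℝ, 0 ≤ h → h ≤ x →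
    |gd m i (x - h) - ∑ j ∈ Finset.range R, (-h) ^ j / j.factorial * gd m (i + j) x| ≤
      C * h ^ R * rexp (-(x - h)) := by
  induction R with
  | zero =>
    intro i
    obtain ⟨C, hC, h⟩ := gd_bound m i
    exact ⟨C, hC, fun x h' h0 h1 => by simpa using h (x - h') (by linarith)⟩
  | succ R ih =>
    intro i
    obtain ⟨C, hC, H⟩ := ih (i + 1)
    refine ⟨C, hC, fun x h h0 hx => ?_⟩
    set f : ℝ → ℝ := fun s => gd m i (x - s) -
      ∑ j ∈ Finset.range (R + 1), (-s) ^ j / j.factorial * gd m (i + j) x with hf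
    have hd : ∀ s : ℝ, HasDerivAt f (-(gd m (i + 1) (x - s) -
        ∑ j ∈ Finset.range R, (-s) ^ j / j.factorial * gd m (i + 1 + j) x)) s := by
      intro s
      have h1 : HasDerivAt (fun s => gd m i (x - s)) (-gd m (i + 1) (x - s)) s := by
        have := (hasDerivAt_gd m i (x - s)).comp s ((hasDerivAt_id s).const_sub x)
        exact this.congr_deriv (by ring)
      have h2 : HasDerivAt (fun s : ℝ => ∑ j ∈ Finset.range (R + 1),
          (-s) ^ j / j.factorial * gd m (i + j) x)
          (∑ j ∈ Finset.range (R + 1),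
            (j * (-s) ^ (j - 1) * (-1)) / j.factorial * gd m (i + j) x) s := by
        refine HasDerivAt.fun_sum fun j _ => ?_
        have h3 := ((hasDerivAt_neg s).pow j).div_const (j.factorial : ℝ)
        exact h3.mul_const _
      refine (h1.sub h2).congr_deriv ?_
      rw [Finset.sum_range_succ']
      simp only [Nat.cast_zero, zero_mul, zero_div, add_zero, Nat.add_sub_cancel]
      rw [neg_sub, sub_eq_add_neg, add_comm, sub_eq_add_neg, ← Finset.sum_neg_distrib]
      congr 1
      refine Finset.sum_congr rfl fun j _ => ?_
      have e : i + (j + 1) = i + 1 + j := by ring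
      rw [e, Nat.factorial_succ]; push_cast
      have : (j.factorial : ℝ) ≠ 0 := by positivity
      field_simp
    have hb := norm_image_sub_le_of_norm_deriv_le_segment' (f := f) (a := 0) (b := h)
      (C := C * h ^ R * rexp (-(x - h))) (fun s _ => (hd s).hasDerivWithinAt)
      (fun s hs => by
        rw [norm_neg]
        refine (H x s hs.1 (hs.2.le.trans hx)).trans ?_
        have := hs.1
        gcongr
        · exact hs.2.le
        · exact hs.2.le) h ⟨h0, le_rfl⟩
    have hf0 : f 0 = 0 := by
      simp only [hf, sub_zero, neg_zero]
      rw [Finset.sum_range_succ']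
      simp
    rw [hf0, sub_zero, sub_zero, Real.norm_eq_abs] at hb
    refine hb.trans (le_of_eq ?_)
    ring

/-- The summand `t ^ a z ^ i g⁽ⁱ⁾(t z)` of the Euler–Maclaurin expansion. -/
noncomputable def eu (m : ℕ) (a : ℝ) (i : ℕ) (z t : ℝ) : ℝ := t ^ a * (z ^ i * gd m i (t * z))

lemma hasDerivAt_eu (m : ℕ) (a : ℝ) (i : ℕ) (z : ℝ) {t : ℝ} (ht : 0 < t) :
    HasDerivAt (eu m a i z) (a * eu m (a - 1) i z t + eu m a (i + 1) z t) t := by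
  have h1 := Real.hasDerivAt_rpow_const (x := t) (p := a) (Or.inl ht.ne')
  have h2 := (hasDerivAt_gd m i (t * z)).comp t ((hasDerivAt_id t).mul_const z)
  refine (h1.mul (h2.const_mul (z ^ i))).congr_deriv ?_
  simp only [eu, Function.comp, id]; ring

lemma continuousOn_eu (m : ℕ) (a : ℝ) (i : ℕ) (z : ℝ) :
    ContinuousOn (eu m a i z) (Set.Ioi 0) := fun _ ht =>
  (hasDerivAt_eu m a i z ht).continuousAt.continuousWithinAt

lemma pow_mul_exp_neg_le (n : ℕ) {x : ℝ} (hx : 0 ≤ x) : x ^ n * rexp (-x) ≤ n.factorial := by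
  have h := Real.pow_div_factorial_le_exp x hx n
  rw [div_le_iff₀ (by positivity)] at h
  rw [Real.exp_neg, ← div_eq_mul_inv, div_le_iff₀ (Real.exp_pos _)]; linarith

lemma eu_bound (m : ℕ) (a : ℝ) {i : ℕ} (hi : 1 ≤ i) : ∃ C > 0, ∀ z : ℝ, 0 < z → ∀ t : ℝ, 1 ≤ t →
    |eu m a i z t| ≤ C * z * t ^ (a - i + 1) := by
  obtain ⟨C, hC, h⟩ := gd_bound m i
  refine ⟨C * (i - 1).factorial, by positivity, fun z hz t ht => ?_⟩
  have ht0 : 0 < t := by linarith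
  have h1 := h (t * z) (by positivity)
  have h2 := pow_mul_exp_neg_le (i - 1) (x := t * z) (by positivity)
  have e1 : z ^ i = z * z ^ (i - 1) := by
    rw [← pow_succ', Nat.sub_add_cancel hi]
  have e2 : t ^ (a - i + 1) * t ^ (i - 1) = t ^ a := by
    rw [← Real.rpow_add_natCast ht0.ne']; congr 1
    rw [Nat.cast_sub hi]; push_cast; ring
  rw [eu, abs_mul, abs_mul, abs_of_pos (by positivity : 0 < t ^ a),
    abs_of_pos (by positivity : 0 < z ^ i)]
  calc t ^ a * (z ^ i * |gd m i (t * z)|) ≤ t ^ a * (z ^ i * (C * rexp (-(t * z)))) := by gcongr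
    _ = C * z * t ^ (a - i + 1) * ((t * z) ^ (i - 1) * rexp (-(t * z))) := by
        rw [e1, ← e2, mul_pow]; ring
    _ ≤ C * z * t ^ (a - i + 1) * (i - 1).factorial := by gcongr
    _ = _ := by ring

lemma eu_exp_bound (m : ℕ) (a : ℝ) (i : ℕ) : ∃ C > 0, ∀ z : ℝ, 0 < z → ∀ t : ℝ, 0 < t →
    |eu m a i z t| ≤ C * z ^ i * (t ^ a * rexp (-z * t)) := by
  obtain ⟨C, hC, h⟩ := gd_bound m i
  refine ⟨C, hC, fun z hz t ht => ?_⟩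
  have h1 := h (t * z) (by positivity)
  rw [eu, abs_mul, abs_mul, abs_of_pos (by positivity : 0 < t ^ a),
    abs_of_pos (by positivity : 0 < z ^ i)]
  calc t ^ a * (z ^ i * |gd m i (t * z)|) ≤ t ^ a * (z ^ i * (C * rexp (-(t * z)))) := by gcongr
    _ = _ := by rw [show -(t * z) = -z * t by ring]; ring

lemma tendsto_eu (m : ℕ) (a : ℝ) (i : ℕ) {z : ℝ} (hz : 0 < z) :
    Tendsto (eu m a i z) atTop (𝓝 0) := by
  obtain ⟨C, hC, h⟩ := eu_exp_bound m a i
  have h1 := (tendsto_rpow_mul_exp_neg_mul_atTop_nhds_zero a z hz).const_mul (C * z ^ i)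
  rw [mul_zero] at h1
  refine squeeze_zero_norm' ?_ h1
  filter_upwards [eventually_gt_atTop 0] with t ht using h z hz t ht

/-- Sum over unit intervals of the integral against a fixed kernel. -/
noncomputable def kerSum (m : ℕ) (p : ℝ → ℝ) (a : ℝ) (i : ℕ) (z : ℝ) (N : ℕ) : ℝ :=
  ∑ k ∈ Finset.range N, ∫ s in (0 : ℝ)..1, p s * eu m a i z ((k : ℝ) + 1 + s)

lemma continuousOn_eu_add (m : ℕ) (a : ℝ) (i : ℕ) (z : ℝ) (k : ℕ) :
    ContinuousOn (fun s : ℝ => eu m a i z ((k : ℝ) + 1 + s)) (Set.uIcc 0 1) := by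
  rw [Set.uIcc_of_le zero_le_one]
  refine (continuousOn_eu m a i z).comp (by fun_prop) fun s hs => ?_
  have : (0 : ℝ) ≤ k := Nat.cast_nonneg k
  have := hs.1
  show (0 : ℝ) < _
  linarith

lemma kernel_by_parts (m : ℕ) {q p : ℝ → ℝ} (hp : Continuous p)
    (hq : ∀ s, HasDerivAt q (p s) s) (a : ℝ) (i : ℕ) (z : ℝ) (k : ℕ) :
    ∫ s in (0 : ℝ)..1, p s * eu m a i z ((k : ℝ) + 1 + s) =
      q 1 * eu m a i z ((k : ℝ) + 1 + 1) - q 0 * eu m a i z ((k : ℝ) + 1) -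
      (a * (∫ s in (0 : ℝ)..1, q s * eu m (a - 1) i z ((k : ℝ) + 1 + s)) +
        ∫ s in (0 : ℝ)..1, q s * eu m a (i + 1) z ((k : ℝ) + 1 + s)) := by
  have hqc : Continuous q := continuous_iff_continuousAt.2 fun s => (hq s).continuousAt
  have hc1 := continuousOn_eu_add m (a - 1) i z k
  have hc2 := continuousOn_eu_add m a (i + 1) z k
  have h := intervalIntegral.integral_mul_deriv_eq_deriv_mul (a := 0) (b := 1) (u := q) (u' := p)
    (v := fun s => eu m a i z ((k : ℝ) + 1 + s))
    (v' := fun s => a * eu m (a - 1) i z ((k : ℝ) + 1 + s) + eu m a (i + 1) z ((k : ℝ) + 1 + s))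
    (fun s _ => hq s)
    (fun s hs => by
      rw [Set.uIcc_of_le zero_le_one] at hs
      have h0 : (0 : ℝ) ≤ k := Nat.cast_nonneg k
      have hpos : (0 : ℝ) < (k : ℝ) + 1 + s := by linarith [hs.1]
      have := (hasDerivAt_eu m a i z hpos).comp s ((hasDerivAt_id s).const_add ((k : ℝ) + 1))
      exact this.congr_deriv (by ring))
    (hp.intervalIntegrable _ _)
    (((continuousOn_const.mul hc1).add hc2).intervalIntegrable)
  have e : ∫ s in (0 : ℝ)..1, q s * (a * eu m (a - 1) i z ((k : ℝ) + 1 + s) +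
      eu m a (i + 1) z ((k : ℝ) + 1 + s)) =
      a * (∫ s in (0 : ℝ)..1, q s * eu m (a - 1) i z ((k : ℝ) + 1 + s)) +
        ∫ s in (0 : ℝ)..1, q s * eu m a (i + 1) z ((k : ℝ) + 1 + s) := by
    rw [← intervalIntegral.integral_const_mul, ← intervalIntegral.integral_add]
    · congr 1; ext s; ring
    · exact (continuousOn_const.mul (hqc.continuousOn.mul hc1)).intervalIntegrable
    · exact (hqc.continuousOn.mul hc2).intervalIntegrable
  rw [e] at h
  rw [h, add_zero]; ring

lemma kerSum_bound_of_order (m : ℕ) {p : ℝ → ℝ} (hp : Continuous p) {a : ℝ} {i : ℕ} (hi : 1 ≤ i)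
    (hai : a - i + 1 ≤ -2) :
    ∃ K, ∀ z : ℝ, 0 < z → ∀ N, |kerSum m p a i z N| ≤ K * z := by
  obtain ⟨C, hC, h⟩ := eu_bound m a hi
  obtain ⟨P, hP⟩ := isCompact_Icc.exists_bound_of_continuousOn (s := Set.Icc (0 : ℝ) 1)
    hp.continuousOn
  have hP0 : 0 ≤ P := (norm_nonneg _).trans (hP 0 ⟨le_rfl, zero_le_one⟩)
  have hs : Summable fun k : ℕ => 1 / ((k : ℝ) + 1) ^ 2 := by
    have := (summable_nat_add_iff 1).2 (Real.summable_one_div_nat_pow.2 (one_lt_two))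
    simpa using this
  refine ⟨P * C * ∑' k : ℕ, 1 / ((k : ℝ) + 1) ^ 2, fun z hz N => ?_⟩
  have hk : ∀ k : ℕ, |∫ s in (0 : ℝ)..1, p s * eu m a i z ((k : ℝ) + 1 + s)| ≤
      P * C * z * (1 / ((k : ℝ) + 1) ^ 2) := by
    intro k
    have := intervalIntegral.norm_integral_le_of_norm_le_const (a := (0 : ℝ)) (b := 1)
      (f := fun s => p s * eu m a i z ((k : ℝ) + 1 + s))
      (C := P * C * z * (1 / ((k : ℝ) + 1) ^ 2)) (fun s hs => by
        rw [Set.uIoc_of_le zero_le_one] at hs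
        have h0 : (0 : ℝ) ≤ k := Nat.cast_nonneg k
        have h1 := h z hz ((k : ℝ) + 1 + s) (by linarith [hs.1])
        have h2 := hP s ⟨hs.1.le, hs.2⟩
        rw [norm_mul]
        have h3 : ((k : ℝ) + 1 + s) ^ (a - i + 1) ≤ 1 / ((k : ℝ) + 1) ^ 2 := by
          calc ((k : ℝ) + 1 + s) ^ (a - i + 1) ≤ ((k : ℝ) + 1 + s) ^ (-2 : ℝ) :=
                Real.rpow_le_rpow_of_exponent_le (by linarith [hs.1]) hai
            _ ≤ ((k : ℝ) + 1) ^ (-2 : ℝ) :=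
                Real.rpow_le_rpow_of_nonpos (by linarith) (by linarith [hs.1]) (by norm_num)
            _ = _ := by
                rw [Real.rpow_neg (by linarith), one_div]
                norm_cast
        calc ‖p s‖ * ‖eu m a i z ((k : ℝ) + 1 + s)‖
            ≤ P * (C * z * (1 / ((k : ℝ) + 1) ^ 2)) := by
              refine mul_le_mul h2 (h1.trans ?_) (norm_nonneg _) hP0
              gcongr
          _ = _ := by ring)
    simpa using this
  calc |kerSum m p a i z N| ≤ ∑ k ∈ Finset.range N, P * C * z * (1 / ((k : ℝ) + 1) ^ 2) :=
        (Finset.abs_sum_le_sum_abs _ _).trans (Finset.sum_le_sum fun k _ => hk k)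
    _ = P * C * z * ∑ k ∈ Finset.range N, 1 / ((k : ℝ) + 1) ^ 2 := by rw [Finset.mul_sum]
    _ ≤ P * C * z * ∑' k : ℕ, 1 / ((k : ℝ) + 1) ^ 2 := by
        gcongr
        exact hs.sum_le_tsum _ fun k _ => by positivity
    _ = _ := by ring

lemma eventually_abs_eu_le (m : ℕ) (a : ℝ) (i : ℕ) {z : ℝ} (hz : 0 < z) :
    ∀ᶠ N : ℕ in atTop, |eu m a i z ((N : ℝ) + 1)| ≤ z := by
  have h := (tendsto_eu m a i hz).comp
    (tendsto_atTop_add_const_right _ (1 : ℝ) tendsto_natCast_atTop_atTop)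
  have := (h.norm).eventually (ge_mem_nhds (by simpa using hz : ‖(0 : ℝ)‖ < z))
  exact this

lemma kerSum_bound (m d : ℕ) : ∀ (p : ℝ → ℝ), Continuous p → ∫ s in (0 : ℝ)..1, p s = 0 →
    ∀ (a : ℝ) (i : ℕ), 1 ≤ i → a - i + 1 ≤ d - 2 →
    ∃ K, ∀ z : ℝ, 0 < z → ∀ᶠ N in atTop, |kerSum m p a i z N| ≤ K * z := by
  induction d with
  | zero =>
    intro p hp _ a i hi hai
    obtain ⟨K, hK⟩ := kerSum_bound_of_order m hp hi (a := a) (by simpa using hai)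
    exact ⟨K, fun z hz => Eventually.of_forall (hK z hz)⟩
  | succ d ih =>
    intro p hp hp0 a i hi hai
    set P : ℝ → ℝ := fun s => ∫ x in (0 : ℝ)..s, p x with hPd
    have hP : ∀ s, HasDerivAt P (p s) s := fun s =>
      intervalIntegral.integral_hasDerivAt_right (hp.intervalIntegrable _ _)
        hp.aestronglyMeasurable.stronglyMeasurableAtFilter hp.continuousAt
    have hPc : Continuous P := continuous_iff_continuousAt.2 fun s => (hP s).continuousAt
    set μ := ∫ s in (0 : ℝ)..1, P s with hμ
    set q : ℝ → ℝ := fun s => P s - μ with hqd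
    have hq : ∀ s, HasDerivAt q (p s) s := fun s => (hP s).sub_const μ
    have hqc : Continuous q := hPc.sub continuous_const
    have hq0 : ∫ s in (0 : ℝ)..1, q s = 0 := by
      rw [hqd, intervalIntegral.integral_sub (hPc.intervalIntegrable _ _)
        (continuous_const.intervalIntegrable _ _)]
      simp [hμ]
    have hq1 : q 1 = -μ ∧ q 0 = -μ := by
      constructor
      · simp only [hqd, hPd]; rw [hp0, zero_sub]
      · simp [hqd, hPd]
    push_cast at hai
    obtain ⟨K₁, h₁⟩ := ih q hqc hq0 (a - 1) i hi (by linarith)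
    obtain ⟨K₂, h₂⟩ := ih q hqc hq0 a (i + 1) (by omega) (by push_cast; linarith)
    obtain ⟨C, hC, hCb⟩ := eu_bound m a hi
    refine ⟨|μ| * (1 + C) + |a| * K₁ + K₂, fun z hz => ?_⟩
    filter_upwards [h₁ z hz, h₂ z hz, eventually_abs_eu_le m a i hz] with N b1 b2 b3
    have e : kerSum m p a i z N = -μ * (eu m a i z ((N : ℝ) + 1) - eu m a i z 1) -
        (a * kerSum m q (a - 1) i z N + kerSum m q a (i + 1) z N) := by
      unfold kerSum
      simp_rw [fun k => kernel_by_parts m hp hq a i z k, hq1.1, hq1.2]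
      rw [Finset.sum_sub_distrib, Finset.sum_add_distrib, ← Finset.mul_sum]
      congr 1
      have := Finset.sum_range_sub (fun k : ℕ => eu m a i z ((k : ℝ) + 1)) N
      simp only [Nat.cast_zero, zero_add] at this
      rw [← this, Finset.mul_sum]
      refine Finset.sum_congr rfl fun k _ => ?_
      push_cast; ring
    have b4 : |eu m a i z 1| ≤ C * z := by simpa using hCb z hz 1 le_rfl
    rw [e]
    calc _ ≤ |μ| * (|eu m a i z ((N : ℝ) + 1)| + |eu m a i z 1|) +
          (|a| * |kerSum m q (a - 1) i z N| + |kerSum m q a (i + 1) z N|) := by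
          refine (abs_sub _ _).trans (add_le_add ?_ ?_)
          · rw [abs_mul, abs_neg]; gcongr; exact abs_sub _ _
          · refine (abs_add_le _ _).trans ?_
            rw [abs_mul]
      _ ≤ |μ| * (z + C * z) + (|a| * (K₁ * z) + K₂ * z) := by gcongr
      _ = _ := by ring

open MeasureTheory

lemma integrableOn_rpow_mul_exp {a z : ℝ} (ha : -1 < a) (hz : 0 < z) :
    IntegrableOn (fun t : ℝ => t ^ a * rexp (-z * t)) (Set.Ioi 0) := by
  simpa using integrableOn_rpow_mul_exp_neg_mul_rpow (s := a) (p := 1) (b := z) ha one_pos hz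

lemma integrableOn_eu (m : ℕ) {a : ℝ} (ha : -1 < a) (i : ℕ) {z : ℝ} (hz : 0 < z) :
    IntegrableOn (eu m a i z) (Set.Ioi 0) := by
  obtain ⟨C, hC, h⟩ := eu_exp_bound m a i
  refine ((integrableOn_rpow_mul_exp ha hz).const_mul (C * z ^ i)).mono'
    ((continuousOn_eu m a i z).aestronglyMeasurable measurableSet_Ioi) ?_
  filter_upwards [ae_restrict_mem measurableSet_Ioi] with t ht using h z hz t ht

lemma summable_rpow_mul_exp (a : ℝ) {z : ℝ} (hz : 0 < z) :
    Summable fun k : ℕ => ((k : ℝ) + 1) ^ a * rexp (-z * ((k : ℝ) + 1)) := by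
  have h1 := Real.summable_pow_mul_exp_neg_nat_mul ⌈a⌉₊ hz
  have h2 := (summable_nat_add_iff 1).2 h1
  refine Summable.of_nonneg_of_le (fun k => by positivity) (fun k => ?_) h2
  push_cast
  rw [← Real.rpow_natCast]
  gcongr
  · linarith [(Nat.cast_nonneg k : (0 : ℝ) ≤ k)]
  · exact Nat.le_ceil a

lemma summable_eu (m : ℕ) (a : ℝ) (i : ℕ) {z : ℝ} (hz : 0 < z) :
    Summable fun k : ℕ => eu m a i z ((k : ℝ) + 1) := by
  obtain ⟨C, hC, h⟩ := eu_exp_bound m a i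
  exact Summable.of_norm_bounded ((summable_rpow_mul_exp a hz).mul_left (C * z ^ i)) fun k =>
    h z hz _ (by positivity)

/-- Euler–Maclaurin: the sum over `k ≥ 1` agrees with the integral up to `O(z)`. -/
lemma eu_sum_sub_integral (m : ℕ) {a : ℝ} (ha : -1 < a) {i : ℕ} (hi : 1 ≤ i) :
    ∃ K, ∀ z : ℝ, 0 < z →
      |∑' k : ℕ, eu m a i z ((k : ℝ) + 1) - ∫ t in Set.Ioi (1 : ℝ), eu m a i z t| ≤ K * z := by
  set q : ℝ → ℝ := fun s => s - 1 / 2 with hqd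
  have hq : ∀ s, HasDerivAt q 1 s := fun s => (hasDerivAt_id s).sub_const _
  have hqc : Continuous q := by fun_prop
  have hq0 : ∫ s in (0 : ℝ)..1, q s = 0 := by
    have : ∫ s in (0 : ℝ)..1, (s - 1 / 2 : ℝ) = 0 := by
      rw [intervalIntegral.integral_sub (continuous_id'.intervalIntegrable _ _)
        (continuous_const.intervalIntegrable _ _)]
      simp
    exact this
  obtain ⟨d, hd⟩ := exists_nat_ge (a + 4)
  obtain ⟨K₁, h₁⟩ := kerSum_bound m d q hqc hq0 (a - 1) i hi (by
    have : (0 : ℝ) ≤ i := Nat.cast_nonneg i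
    linarith)
  obtain ⟨K₂, h₂⟩ := kerSum_bound m d q hqc hq0 a (i + 1) (by omega) (by
    have : (0 : ℝ) ≤ i := Nat.cast_nonneg i
    push_cast; linarith)
  obtain ⟨C, hC, hCb⟩ := eu_bound m a hi
  refine ⟨1 / 2 * (C + 1) + |a| * K₁ + K₂, fun z hz => ?_⟩
  have hint := integrableOn_eu m ha i hz
  have t1 : Tendsto (fun N : ℕ => ∑ k ∈ Finset.range N, eu m a i z ((k : ℝ) + 1)) atTop
      (𝓝 (∑' k : ℕ, eu m a i z ((k : ℝ) + 1))) := (summable_eu m a i hz).hasSum.tendsto_sum_nat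
  have t2 : Tendsto (fun N : ℕ => ∫ t in (1 : ℝ)..(N : ℝ) + 1, eu m a i z t) atTop
      (𝓝 (∫ t in Set.Ioi (1 : ℝ), eu m a i z t)) :=
    intervalIntegral_tendsto_integral_Ioi 1 (hint.mono_set (Set.Ioi_subset_Ioi zero_le_one))
      (tendsto_atTop_add_const_right _ (1 : ℝ) tendsto_natCast_atTop_atTop)
  have t3 := (t1.sub t2).norm
  refine le_of_tendsto t3 ?_
  filter_upwards [h₁ z hz, h₂ z hz, eventually_abs_eu_le m a i hz] with N b1 b2 b3
  have e0 : ∫ t in (1 : ℝ)..(N : ℝ) + 1, eu m a i z t =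
      ∑ k ∈ Finset.range N, ∫ s in (0 : ℝ)..1, 1 * eu m a i z ((k : ℝ) + 1 + s) := by
    have hadj := intervalIntegral.sum_integral_adjacent_intervals (f := eu m a i z)
      (μ := volume) (a := fun k : ℕ => (k : ℝ) + 1) (n := N) (fun k _ => by
        refine ContinuousOn.intervalIntegrable ((continuousOn_eu m a i z).mono fun t ht => ?_)
        have h0 : (0 : ℝ) ≤ k := Nat.cast_nonneg k
        rw [Set.uIcc_of_le (by push_cast; linarith)] at ht
        show (0 : ℝ) < t
        linarith [ht.1])
    simp only [Nat.cast_zero, zero_add] at hadj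
    rw [← hadj]
    refine Finset.sum_congr rfl fun k _ => ?_
    simp only [one_mul]
    rw [intervalIntegral.integral_comp_add_left]
    push_cast; ring_nf
  have e : ∑ k ∈ Finset.range N, eu m a i z ((k : ℝ) + 1) -
      ∫ t in (1 : ℝ)..(N : ℝ) + 1, eu m a i z t =
      -(1 / 2) * (eu m a i z ((N : ℝ) + 1) - eu m a i z 1) +
        (a * kerSum m q (a - 1) i z N + kerSum m q a (i + 1) z N) := by
    rw [e0]
    unfold kerSum
    simp_rw [fun k => kernel_by_parts m (p := fun _ => 1) continuous_const hq a i z k]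
    rw [Finset.mul_sum, ← Finset.sum_add_distrib]
    have := Finset.sum_range_sub (fun k : ℕ => eu m a i z ((k : ℝ) + 1)) N
    simp only [Nat.cast_zero, zero_add] at this
    rw [← this, Finset.mul_sum, ← Finset.sum_add_distrib, ← Finset.sum_sub_distrib]
    refine Finset.sum_congr rfl fun k _ => ?_
    simp only [hqd]; push_cast; ring
  have b4 : |eu m a i z 1| ≤ C * z := by simpa using hCb z hz 1 le_rfl
  rw [Real.norm_eq_abs, e]
  calc _ ≤ 1 / 2 * (|eu m a i z ((N : ℝ) + 1)| + |eu m a i z 1|) +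
        (|a| * |kerSum m q (a - 1) i z N| + |kerSum m q a (i + 1) z N|) := by
        refine (abs_add_le _ _).trans (add_le_add ?_ ?_)
        · rw [abs_mul]
          refine mul_le_mul (by norm_num) (abs_sub _ _) (abs_nonneg _) (by norm_num)
        · refine (abs_add_le _ _).trans ?_
          rw [abs_mul]
    _ ≤ 1 / 2 * (z + C * z) + (|a| * (K₁ * z) + K₂ * z) := by gcongr
    _ = _ := by ring

/-- The moments `∫ x ^ a g⁽ⁱ⁾(x) dx`. -/
noncomputable def gmom (m : ℕ) (a : ℝ) (i : ℕ) : ℝ := ∫ x in Set.Ioi (0 : ℝ), x ^ a * gd m i x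

lemma integral_eu (m : ℕ) (a : ℝ) (i : ℕ) {z : ℝ} (hz : 0 < z) :
    ∫ t in Set.Ioi (0 : ℝ), eu m a i z t = z ^ ((i : ℝ) - 1 - a) * gmom m a i := by
  have h := integral_comp_mul_right_Ioi (fun x => x ^ a * gd m i x) 0 hz
  rw [zero_mul, smul_eq_mul] at h
  have e : ∫ t in Set.Ioi (0 : ℝ), eu m a i z t =
      z ^ ((i : ℝ) - a) * ∫ t in Set.Ioi (0 : ℝ), (t * z) ^ a * gd m i (t * z) := by
    rw [← integral_const_mul]
    refine setIntegral_congr_fun measurableSet_Ioi fun t ht => ?_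
    have ht' : (0 : ℝ) < t := ht
    show t ^ a * (z ^ i * gd m i (t * z)) = _
    rw [Real.mul_rpow ht'.le hz.le, Real.rpow_sub hz, Real.rpow_natCast]
    have := Real.rpow_pos_of_pos hz a
    field_simp
  rw [e, h, gmom, ← mul_assoc]
  congr 1
  rw [← Real.rpow_neg_one, ← Real.rpow_add hz]; congr 1; ring

/-- The expansion of `∑ k ^ a z ^ i g⁽ⁱ⁾(k z)`. -/
lemma eu_sum_asymp (m : ℕ) {a : ℝ} (ha : 0 ≤ a) {i : ℕ} (hi : 1 ≤ i) :
    ∃ K, ∀ z : ℝ, 0 < z → z ≤ 1 →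
      |∑' k : ℕ, eu m a i z ((k : ℝ) + 1) - z ^ ((i : ℝ) - 1 - a) * gmom m a i| ≤ K * z := by
  obtain ⟨K, hK⟩ := eu_sum_sub_integral m (show -1 < a by linarith) hi
  obtain ⟨C, hC, h⟩ := gd_bound m i
  refine ⟨K + C, fun z hz hz1 => ?_⟩
  have hint := integrableOn_eu m (show -1 < a by linarith) i hz
  rw [← integral_eu m a i hz]
  have hsplit : ∫ t in Set.Ioi (0 : ℝ), eu m a i z t =
      (∫ t in Set.Ioc (0 : ℝ) 1, eu m a i z t) + ∫ t in Set.Ioi (1 : ℝ), eu m a i z t := by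
    rw [← setIntegral_union (Set.Ioc_disjoint_Ioi le_rfl) measurableSet_Ioi
      (hint.mono_set Set.Ioc_subset_Ioi_self)
      (hint.mono_set (Set.Ioi_subset_Ioi zero_le_one)), Set.Ioc_union_Ioi_eq_Ioi zero_le_one]
  have hsmall : |∫ t in Set.Ioc (0 : ℝ) 1, eu m a i z t| ≤ C * z := by
    have := norm_setIntegral_le_of_norm_le_const (μ := volume) (s := Set.Ioc (0 : ℝ) 1)
      (f := eu m a i z) (C := C * z) (by simp) (fun t ht => by
        have h1 := h (t * z) (mul_nonneg ht.1.le hz.le)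
        have h2 : t ^ a ≤ 1 := Real.rpow_le_one ht.1.le ht.2 ha
        have h3 : z ^ i ≤ z := by
          calc z ^ i ≤ z ^ 1 := pow_le_pow_of_le_one hz.le hz1 hi
            _ = z := pow_one z
        have h4 : rexp (-(t * z)) ≤ 1 := Real.exp_le_one_iff.2 (by nlinarith [ht.1])
        rw [eu, norm_mul, norm_mul, Real.norm_of_nonneg (Real.rpow_nonneg ht.1.le _),
          Real.norm_of_nonneg (by positivity : 0 ≤ z ^ i)]
        calc t ^ a * (z ^ i * ‖gd m i (t * z)‖) ≤ 1 * (z * (C * 1)) := by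
              refine mul_le_mul h2 (mul_le_mul h3 (h1.trans ?_) (norm_nonneg _) hz.le)
                (by positivity) zero_le_one
              gcongr
          _ = C * z := by ring)
    simpa using this
  rw [hsplit]
  have := hK z hz
  rw [abs_le] at *
  constructor <;> linarith [this.1, this.2, hsmall.1, hsmall.2]

/-- Decrements of `k ↦ gd m 0 (k z)`. -/
noncomputable def gdec (m : ℕ) (z : ℝ) (k : ℕ) : ℝ := gd m 0 (k * z) - gd m 0 (((k : ℝ) + 1) * z)

lemma gdec_nonneg (m : ℕ) {z : ℝ} (hz : 0 < z) (k : ℕ) : 0 ≤ gdec m z k :=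
  sub_nonneg.2 (gd_zero_antitone m (by gcongr; linarith))

lemma gdec_le (m : ℕ) {z : ℝ} (hz : 0 < z) (k : ℕ) :
    gdec m z k ≤ m * rexp z * rexp (-z * ((k : ℝ) + 1)) := by
  have h1 := gd_zero_le m (x := k * z) (by positivity)
  have h2 := gd_zero_nonneg m (((k : ℝ) + 1) * z)
  rw [mul_assoc, ← Real.exp_add]
  have : z + -z * ((k : ℝ) + 1) = -(k * z) := by ring
  rw [this]; unfold gdec; linarith

lemma summable_mul_gdec (m : ℕ) (a : ℝ) {z : ℝ} (hz : 0 < z) :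
    Summable fun k : ℕ => ((k : ℝ) + 1) ^ a * gdec m z k := by
  refine Summable.of_nonneg_of_le (fun k => mul_nonneg (by positivity) (gdec_nonneg m hz k))
    (fun k => ?_) ((summable_rpow_mul_exp a hz).mul_left (m * rexp z))
  have := gdec_le m hz k
  calc ((k : ℝ) + 1) ^ a * gdec m z k
      ≤ ((k : ℝ) + 1) ^ a * (m * rexp z * rexp (-z * ((k : ℝ) + 1))) := by gcongr
    _ = _ := by ring

/-- Coefficients of the expansion in powers of `z`. -/
noncomputable def acoef (m : ℕ) (α : ℝ) (h : ℕ) : ℝ :=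
  (-1) ^ (h + 1) / ((h + 1).factorial : ℝ) * gmom m α (h + 1)

lemma tsum_mul_gdec_asymp (m : ℕ) {α : ℝ} (hα : 0 < α) {n : ℕ} (hn : α + 2 ≤ n) :
    ∃ K, ∀ z : ℝ, 0 < z → z ≤ 1 →
      |∑' k : ℕ, ((k : ℝ) + 1) ^ α * gdec m z k -
        ∑ h ∈ Finset.range n, acoef m α h * z ^ ((h : ℝ) - α)| ≤ K * z := by
  obtain ⟨C, hC, hT⟩ := gd_taylor m (n + 1) 0
  choose K hK using fun h : ℕ => eu_sum_asymp m hα.le (i := h + 1) (by omega)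
  have hs : Summable fun k : ℕ => 1 / ((k : ℝ) + 1) ^ 2 := by
    have := (summable_nat_add_iff 1).2 (Real.summable_one_div_nat_pow.2 (one_lt_two))
    simpa using this
  set c : ℕ → ℝ := fun h => (-1) ^ (h + 1) / ((h + 1).factorial : ℝ) with hc
  refine ⟨C * rexp 1 * n.factorial * (∑' k : ℕ, 1 / ((k : ℝ) + 1) ^ 2) +
    ∑ h ∈ Finset.range n, |c h| * K h, fun z hz hz1 => ?_⟩
  set E : ℕ → ℝ := fun k => ((k : ℝ) + 1) ^ α * gdec m z k -
    ∑ h ∈ Finset.range n, c h * eu m α (h + 1) z ((k : ℝ) + 1) with hE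
  have hEb : ∀ k, ‖E k‖ ≤ C * rexp 1 * n.factorial * z * (1 / ((k : ℝ) + 1) ^ 2) := by
    intro k
    have hk1 : (1 : ℝ) ≤ (k : ℝ) + 1 := by linarith [(Nat.cast_nonneg k : (0 : ℝ) ≤ k)]
    have hk0 : (0 : ℝ) < (k : ℝ) + 1 := by linarith
    have h1 := hT (((k : ℝ) + 1) * z) z hz.le (by nlinarith)
    have e1 : ((k : ℝ) + 1) * z - z = k * z := by ring
    rw [e1, Finset.sum_range_succ'] at h1
    simp only [pow_zero, Nat.factorial_zero, Nat.cast_one, div_one, one_mul, zero_add] at h1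
    have e2 : E k = ((k : ℝ) + 1) ^ α * (gd m 0 (k * z) -
        (∑ x ∈ Finset.range n, (-z) ^ (x + 1) / ((x + 1).factorial : ℝ) *
          gd m (x + 1) (((k : ℝ) + 1) * z) + gd m 0 (((k : ℝ) + 1) * z))) := by
      have : ∑ h ∈ Finset.range n, c h * eu m α (h + 1) z ((k : ℝ) + 1) = ((k : ℝ) + 1) ^ α *
          ∑ x ∈ Finset.range n, (-z) ^ (x + 1) / ((x + 1).factorial : ℝ) *
          gd m (x + 1) (((k : ℝ) + 1) * z) := by
        rw [Finset.mul_sum]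
        refine Finset.sum_congr rfl fun h _ => ?_
        rw [hc, eu, neg_pow z]; ring
      simp only [hE, gdec]; rw [this]; ring
    rw [e2, norm_mul, Real.norm_of_nonneg (by positivity : 0 ≤ ((k : ℝ) + 1) ^ α)]
    have e3 : rexp (-(k * z)) ≤ rexp 1 * rexp (-(((k : ℝ) + 1) * z)) := by
      rw [← Real.exp_add]; gcongr; nlinarith
    have h2 := pow_mul_exp_neg_le n (x := ((k : ℝ) + 1) * z) (by positivity)
    have h3 : ((k : ℝ) + 1) ^ α ≤ ((k : ℝ) + 1) ^ n * (1 / ((k : ℝ) + 1) ^ 2) := by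
      rw [← div_eq_mul_one_div, le_div_iff₀ (by positivity), ← Real.rpow_natCast _ 2,
        ← Real.rpow_add hk0, ← Real.rpow_natCast]
      exact Real.rpow_le_rpow_of_exponent_le hk1 (by push_cast; linarith)
    calc _ ≤ (((k : ℝ) + 1) ^ n * (1 / ((k : ℝ) + 1) ^ 2)) *
          (C * z ^ (n + 1) * (rexp 1 * rexp (-(((k : ℝ) + 1) * z)))) := by
          refine mul_le_mul h3 (h1.trans ?_) (norm_nonneg _) (by positivity)
          gcongr
      _ = C * rexp 1 * z * (1 / ((k : ℝ) + 1) ^ 2) *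
          ((((k : ℝ) + 1) * z) ^ n * rexp (-(((k : ℝ) + 1) * z))) := by rw [mul_pow]; ring
      _ ≤ C * rexp 1 * z * (1 / ((k : ℝ) + 1) ^ 2) * n.factorial := by gcongr
      _ = _ := by ring
  have hsE := hs.mul_left (C * rexp 1 * n.factorial * z)
  have b1 : |∑' k, E k| ≤ C * rexp 1 * n.factorial * z * ∑' k : ℕ, 1 / ((k : ℝ) + 1) ^ 2 := by
    rw [← tsum_mul_left]
    exact tsum_of_norm_bounded hsE.hasSum hEb
  have hsu : ∀ h ∈ Finset.range n, Summable fun k : ℕ => c h * eu m α (h + 1) z ((k : ℝ) + 1) :=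
    fun h _ => (summable_eu m α (h + 1) hz).mul_left _
  have e4 : ∑' k, E k = ∑' k : ℕ, ((k : ℝ) + 1) ^ α * gdec m z k -
      ∑ h ∈ Finset.range n, c h * ∑' k : ℕ, eu m α (h + 1) z ((k : ℝ) + 1) := by
    rw [(summable_mul_gdec m α hz).tsum_sub (summable_sum hsu), Summable.tsum_finsetSum hsu]
    simp_rw [tsum_mul_left]
  have b2 : |∑ h ∈ Finset.range n, c h * ∑' k : ℕ, eu m α (h + 1) z ((k : ℝ) + 1) -
      ∑ h ∈ Finset.range n, acoef m α h * z ^ ((h : ℝ) - α)| ≤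
      ∑ h ∈ Finset.range n, |c h| * (K h * z) := by
    rw [← Finset.sum_sub_distrib]
    refine (Finset.abs_sum_le_sum_abs _ _).trans (Finset.sum_le_sum fun h _ => ?_)
    have := hK h z hz hz1
    have e : c h * ∑' k : ℕ, eu m α (h + 1) z ((k : ℝ) + 1) - acoef m α h * z ^ ((h : ℝ) - α) =
        c h * (∑' k : ℕ, eu m α (h + 1) z ((k : ℝ) + 1) -
          z ^ (((h + 1 : ℕ) : ℝ) - 1 - α) * gmom m α (h + 1)) := by
      rw [acoef, show (((h + 1 : ℕ) : ℝ) - 1 - α) = (h : ℝ) - α by push_cast; ring, hc]; ring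
    rw [e, abs_mul]; gcongr
  have e5 : ∑ h ∈ Finset.range n, |c h| * (K h * z) =
      (∑ h ∈ Finset.range n, |c h| * K h) * z := by
    rw [Finset.sum_mul]; exact Finset.sum_congr rfl fun _ _ => by ring
  rw [e4] at b1
  rw [e5] at b2
  have := abs_add_le (∑' k : ℕ, ((k : ℝ) + 1) ^ α * gdec m z k -
      ∑ h ∈ Finset.range n, c h * ∑' k : ℕ, eu m α (h + 1) z ((k : ℝ) + 1))
    (∑ h ∈ Finset.range n, c h * ∑' k : ℕ, eu m α (h + 1) z ((k : ℝ) + 1) -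
      ∑ h ∈ Finset.range n, acoef m α h * z ^ ((h : ℝ) - α))
  rw [sub_add_sub_cancel] at this
  refine this.trans ((add_le_add b1 b2).trans (le_of_eq ?_))
  ring

lemma tendsto_gd_zero (m : ℕ) : Tendsto (gd m 0) atTop (𝓝 0) := by
  have h : Tendsto (fun x : ℝ => (m : ℝ) * rexp (-x)) atTop (𝓝 0) := by
    simpa using tendsto_exp_neg_atTop_nhds_zero.const_mul (m : ℝ)
  refine squeeze_zero' (Eventually.of_forall (gd_zero_nonneg m)) ?_ h
  filter_upwards [eventually_ge_atTop 0] with x hx using gd_zero_le m hx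

lemma hasSum_gdec_ge (m : ℕ) {z : ℝ} (hz : 0 < z) (A : ℕ) :
    HasSum (fun k => if A ≤ k then gdec m z k else 0) (gd m 0 (A * z)) := by
  rw [hasSum_iff_tendsto_nat_of_nonneg
    (fun k => by split_ifs; exacts [gdec_nonneg m hz k, le_rfl])]
  have hpart : ∀ N, ∑ k ∈ Finset.range N, (if A ≤ k then gdec m z k else 0) =
      if A ≤ N then gd m 0 (A * z) - gd m 0 (N * z) else 0 := by
    intro N
    induction N with
    | zero =>
      simp only [Finset.range_zero, Finset.sum_empty]
      split_ifs with h
      · rw [Nat.le_zero.1 h]; simp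
      · rfl
    | succ N ih =>
      rw [Finset.sum_range_succ, ih]
      by_cases h : A ≤ N
      · rw [if_pos h, if_pos h, if_pos (by omega), gdec]; push_cast; ring
      · rw [if_neg h, if_neg h]
        split_ifs with h'
        · have : A = N + 1 := by omega
          rw [this]; simp
        · simp
  have h1 : Tendsto (fun N : ℕ => gd m 0 (A * z) - gd m 0 (N * z)) atTop
      (𝓝 (gd m 0 (A * z) - 0)) :=
    tendsto_const_nhds.sub ((tendsto_gd_zero m).comp
      (tendsto_natCast_atTop_atTop.atTop_mul_const hz))
  rw [sub_zero] at h1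
  refine h1.congr' ?_
  filter_upwards [eventually_ge_atTop A] with N hN
  rw [hpart, if_pos hN]

lemma psPart_le_iff {κ : ℝ} (hκ : 0 < κ) (ℓ k : ℕ) :
    psPart κ (ℓ + 1) ≤ k ↔ ℓ < ⌈((k : ℝ) + 1) ^ (1 / κ)⌉₊ - 1 := by
  have h1 : psPart κ (ℓ + 1) ≤ k ↔ ((ℓ + 1 : ℕ) : ℝ) ^ κ < (k : ℝ) + 1 := by
    rw [← Nat.lt_add_one_iff, psPart, Nat.floor_lt (by positivity)]; push_cast; rfl
  have h2 : ((ℓ + 1 : ℕ) : ℝ) ^ κ < (k : ℝ) + 1 ↔ ((ℓ + 1 : ℕ) : ℝ) < ((k : ℝ) + 1) ^ (1 / κ) := by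
    rw [one_div, Real.lt_rpow_inv_iff_of_pos (by positivity) (by positivity) hκ]
  rw [h1, h2, ← Nat.lt_ceil]; omega

/-- Logarithm of the generating function. -/
noncomputable def logGen (κ : ℝ) (m : ℕ) (z : ℝ) : ℝ := ∑' ℓ : ℕ, gd m 0 (psPart κ (ℓ + 1) * z)

lemma logGen_layer {κ : ℝ} (hκ : 0 < κ) (m : ℕ) {z : ℝ} (hz : 0 < z) :
    Summable (fun ℓ : ℕ => gd m 0 (psPart κ (ℓ + 1) * z)) ∧
    logGen κ m z = ∑' k : ℕ, ((⌈((k : ℝ) + 1) ^ (1 / κ)⌉₊ : ℝ) - 1) * gdec m z k := by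
  set f : ℕ × ℕ → ℝ := fun x => if psPart κ (x.2 + 1) ≤ x.1 then gdec m z x.1 else 0 with hf
  have hf0 : 0 ≤ f := fun x => by
    simp only [hf]; split_ifs; exacts [gdec_nonneg m hz _, le_rfl]
  have hrow : ∀ k, HasSum (fun ℓ => f (k, ℓ))
      (((⌈((k : ℝ) + 1) ^ (1 / κ)⌉₊ : ℝ) - 1) * gdec m z k) := by
    intro k
    set n := ⌈((k : ℝ) + 1) ^ (1 / κ)⌉₊ with hn
    have hn1 : 1 ≤ n := Nat.one_le_ceil_iff.2 (by positivity)
    have : HasSum (fun ℓ => f (k, ℓ)) (∑ ℓ ∈ Finset.range (n - 1), f (k, ℓ)) :=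
      hasSum_sum_of_ne_finset_zero (fun ℓ hl => by
        rw [Finset.mem_range] at hl
        simp only [hf]; rw [if_neg]
        rw [psPart_le_iff hκ]; exact hl)
    convert this using 1
    rw [Finset.sum_congr rfl (g := fun _ => gdec m z k) fun ℓ hl => by
      simp only [hf]; rw [if_pos]
      rw [psPart_le_iff hκ]; exact Finset.mem_range.1 hl]
    rw [Finset.sum_const, Finset.card_range, nsmul_eq_mul, Nat.cast_sub hn1]; simp
  have hcol : ∀ ℓ, HasSum (fun k => f (k, ℓ)) (gd m 0 (psPart κ (ℓ + 1) * z)) := fun ℓ =>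
    hasSum_gdec_ge m hz _
  have hsum : Summable f := by
    rw [summable_prod_of_nonneg hf0]
    refine ⟨fun k => (hrow k).summable, ?_⟩
    simp_rw [fun k => (hrow k).tsum_eq]
    refine Summable.of_nonneg_of_le (fun k => mul_nonneg ?_ (gdec_nonneg m hz k)) (fun k => ?_)
      (summable_mul_gdec m (1 / κ) hz)
    · have hn1 : 1 ≤ ⌈((k : ℝ) + 1) ^ (1 / κ)⌉₊ := Nat.one_le_ceil_iff.2 (by positivity)
      have : (1 : ℝ) ≤ (⌈((k : ℝ) + 1) ^ (1 / κ)⌉₊ : ℝ) := by exact_mod_cast hn1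
      linarith
    · have := gdec_nonneg m hz k
      have := Nat.ceil_lt_add_one (show 0 ≤ ((k : ℝ) + 1) ^ (1 / κ) by positivity)
      gcongr; linarith
  have hsw := hsum.prod_symm
  have h1 := (summable_prod_of_nonneg (f := fun p : ℕ × ℕ => f p.swap)
    (fun p => hf0 p.swap)).1 hsw
  constructor
  · have := h1.2
    simpa only [Prod.swap_prod_mk, fun ℓ => (hcol ℓ).tsum_eq] using this
  · have h2 := hsum.tsum_comm (f := fun k ℓ => f (k, ℓ))
    simp_rw [fun ℓ => (hcol ℓ).tsum_eq, fun k => (hrow k).tsum_eq] at h2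
    exact h2

lemma sum_mul_by_parts (b D : ℕ → ℝ) (N : ℕ) :
    ∑ k ∈ Finset.range N, b k * D k = (∑ k ∈ Finset.range N, b k) * D N +
      ∑ k ∈ Finset.range N, (∑ j ∈ Finset.range (k + 1), b j) * (D k - D (k + 1)) := by
  induction N with
  | zero => simp
  | succ N ih => 
    rw [Finset.sum_range_succ, ih, Finset.sum_range_succ (fun k => _ * (D k - D (k + 1))),
      Finset.sum_range_succ b]
    ring

lemma gdec_sub_bound (m : ℕ) : ∃ C > 0, ∀ z : ℝ, 0 < z → ∀ k : ℕ,
    |gdec m z k - gdec m z (k + 1)| ≤ C * z ^ 2 * rexp (-(k * z)) := by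
  obtain ⟨C, hC, h⟩ := gd_taylor m 2 0
  refine ⟨6 * C, by positivity, fun z hz k => ?_⟩
  have hk : (0 : ℝ) ≤ k * z := by positivity
  have h1 := h ((k + 2) * z) z hz.le (by linarith)
  have h2 := h ((k + 2) * z) (2 * z) (by linarith) (by linarith)
  have e1 : ((k : ℝ) + 2) * z - z = (k + 1) * z := by ring
  have e2 : ((k : ℝ) + 2) * z - 2 * z = k * z := by ring
  simp only [Finset.sum_range_succ, Finset.sum_range_zero, e1, e2] at h1 h2
  norm_num at h1 h2
  have h3 : rexp (-((k + 1) * z)) ≤ rexp (-(k * z)) := Real.exp_le_exp.2 (by linarith)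
  have h4 : C * z ^ 2 * rexp (-((k + 1) * z)) ≤ C * z ^ 2 * rexp (-(k * z)) := by gcongr
  rw [abs_le] at h1 h2 ⊢
  simp only [gdec]; push_cast
  have e3 : ((k : ℝ) + 1 + 1) = k + 2 := by ring
  rw [e3]
  constructor <;> nlinarith

lemma summable_exp_mul {z : ℝ} (hz : 0 < z) :
    HasSum (fun k : ℕ => rexp (-(k * z))) (1 - rexp (-z))⁻¹ := by
  have := hasSum_geometric_of_lt_one (Real.exp_pos (-z)).le (Real.exp_lt_one_iff.2 (by linarith))
  refine this.congr_fun fun k => ?_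
  rw [← Real.exp_nat_mul]; congr 1; ring

lemma hasSum_mul_exp_mul {z : ℝ} (hz : 0 < z) :
    HasSum (fun k : ℕ => ((k : ℝ) + 1) * rexp (-(k * z))) (1 / (1 - rexp (-z)) ^ 2) := by
  have h1 : ‖rexp (-z)‖ < 1 := by
    rw [Real.norm_of_nonneg (Real.exp_pos _).le]; exact Real.exp_lt_one_iff.2 (by linarith)
  have := hasSum_choose_mul_geometric_of_norm_lt_one 1 h1
  refine this.congr_fun fun k => ?_
  rw [← Real.exp_nat_mul, Nat.choose_one_right]; push_cast; congr 2; ring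

lemma half_le_one_sub_exp {z : ℝ} (hz : 0 ≤ z) (hz1 : z ≤ 1) : z / 2 ≤ 1 - rexp (-z) := by
  have := Real.quadratic_le_exp_of_nonneg hz
  have h1 : rexp (-z) ≤ 1 / (1 + z) := by
    rw [Real.exp_neg, ← one_div]
    apply one_div_le_one_div_of_le <;> nlinarith
  have h2 : 1 / (1 + z) ≤ 1 - z / 2 := by
    rw [div_le_iff₀ (by linarith)]; nlinarith
  linarith

lemma summable_gdec (m : ℕ) {z : ℝ} (hz : 0 < z) : Summable (gdec m z) := by
  simpa using summable_mul_gdec m 0 hz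

lemma tsum_gdec (m : ℕ) {z : ℝ} (hz : 0 < z) : ∑' k, gdec m z k = Real.log ((m : ℝ) + 1) := by
  have := hasSum_gdec_ge m hz 0
  simp only [Nat.zero_le, if_true, Nat.cast_zero, zero_mul, gd_zero_zero] at this
  exact this.tsum_eq

/-- Bounded weights of mean zero contribute nothing in the limit. -/
lemma tendsto_tsum_mul_gdec (m : ℕ) {b : ℕ → ℝ} (hb1 : ∀ k, |b k| ≤ 1)
    (hb : ∀ ε > 0, ∃ N₀ : ℕ, ∀ N ≥ N₀, |∑ k ∈ Finset.range N, b k| ≤ ε * N) :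
    Tendsto (fun z => ∑' k, b k * gdec m z k) (𝓝[>] 0) (𝓝 0) := by
  obtain ⟨C, hC, hD⟩ := gdec_sub_bound m
  have hsumb : ∀ z : ℝ, 0 < z → Summable fun k => b k * gdec m z k := fun z hz =>
    Summable.of_norm_bounded (summable_gdec m hz) fun k => by
      rw [Real.norm_eq_abs, abs_mul, abs_of_nonneg (gdec_nonneg m hz k)]
      exact mul_le_of_le_one_left (gdec_nonneg m hz k) (hb1 k)
  have hB1 : ∀ N, |∑ k ∈ Finset.range N, b k| ≤ N := fun N => by
    refine (Finset.abs_sum_le_sum_abs _ _).trans ?_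
    refine (Finset.sum_le_sum fun k _ => hb1 k).trans ?_
    simp
  have key : ∀ ε > 0, ∃ N₀ : ℕ, ∀ z : ℝ, 0 < z → z ≤ 1 →
      |∑' k, b k * gdec m z k| ≤ C * (4 * ε + 2 * N₀ * z) := by
    intro ε hε
    obtain ⟨N₀, hN₀⟩ := hb ε hε
    have hB : ∀ N, |∑ k ∈ Finset.range N, b k| ≤ ε * N + N₀ := fun N => by
      by_cases h : N₀ ≤ N
      · have := hN₀ N h
        have : (0 : ℝ) ≤ N₀ := by positivity
        linarith
      · have := hB1 N
        have h2 : (N : ℝ) ≤ N₀ := by exact_mod_cast (not_le.1 h).le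
        have : 0 ≤ ε * N := by positivity
        linarith
    refine ⟨N₀, fun z hz hz1 => ?_⟩
    have h1 := (hsumb z hz).hasSum.tendsto_sum_nat
    have h2 : Tendsto (fun N => (∑ k ∈ Finset.range N, b k) * gdec m z N) atTop (𝓝 0) := by
      have := (summable_mul_gdec m 1 hz).tendsto_atTop_zero
      refine squeeze_zero_norm (fun N => ?_) this
      rw [Real.norm_eq_abs, abs_mul, abs_of_nonneg (gdec_nonneg m hz N), Real.rpow_one]
      exact mul_le_mul_of_nonneg_right ((hB1 N).trans (by linarith)) (gdec_nonneg m hz N)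
    have h3 := h1.sub h2
    rw [sub_zero] at h3
    refine le_of_tendsto h3.abs (Eventually.of_forall fun N => ?_)
    rw [sum_mul_by_parts, add_sub_cancel_left]
    have hS := ((hasSum_mul_exp_mul hz).mul_left ε).add ((summable_exp_mul hz).mul_left (N₀ : ℝ))
    have hp := half_le_one_sub_exp hz.le hz1
    have hpz : 0 < z / 2 := by positivity
    calc _ ≤ ∑ k ∈ Finset.range N, (C * z ^ 2) *
            (ε * (((k : ℝ) + 1) * rexp (-(k * z))) + N₀ * rexp (-(k * z))) := by
          refine (Finset.abs_sum_le_sum_abs _ _).trans (Finset.sum_le_sum fun k _ => ?_)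
          rw [abs_mul]
          calc _ ≤ (ε * ((k + 1 : ℕ) : ℝ) + N₀) * (C * z ^ 2 * rexp (-(k * z))) :=
                mul_le_mul (hB _) (hD z hz k) (abs_nonneg _) (by positivity)
            _ = _ := by push_cast; ring
      _ ≤ (C * z ^ 2) * (ε * (1 / (1 - rexp (-z)) ^ 2) + N₀ * (1 - rexp (-z))⁻¹) := by
          rw [← Finset.mul_sum]
          have := sum_le_hasSum (Finset.range N) (fun k _ => by positivity) hS
          gcongr
      _ ≤ (C * z ^ 2) * (ε * (1 / (z / 2) ^ 2) + N₀ * (z / 2)⁻¹) := by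
          gcongr
      _ = _ := by field_simp; ring
  rw [Metric.tendsto_nhdsWithin_nhds]
  intro η hη
  obtain ⟨N₀, h⟩ := key (η / (8 * C)) (by positivity)
  refine ⟨min 1 (η / (4 * C * (N₀ + 1))), by positivity, fun z hz hzd => ?_⟩
  have hz0 : (0 : ℝ) < z := hz
  rw [Real.dist_eq, sub_zero, abs_of_pos hz0, lt_min_iff, lt_div_iff₀ (by positivity)] at hzd
  rw [Real.dist_eq, sub_zero]
  refine (h z hz0 hzd.1.le).trans_lt ?_
  have : C * (4 * (η / (8 * C)) + 2 * N₀ * z) = η / 2 + 2 * (C * N₀ * z) := by field_simp; ring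
  rw [this]
  have : 0 < C * z := by positivity
  nlinarith

lemma tendsto_rpow_nhdsGT {p : ℝ} (hp : 0 < p) :
    Tendsto (fun z : ℝ => z ^ p) (𝓝[>] 0) (𝓝 0) := by
  have := (Real.continuousAt_rpow_const 0 p (Or.inr hp.le)).tendsto
  rw [Real.zero_rpow hp.ne'] at this
  exact this.mono_left nhdsWithin_le_nhds

lemma tendsto_tsum_mul_gdec_sub (m : ℕ) {α : ℝ} (hα : 0 < α) :
    Tendsto (fun z => ∑' k : ℕ, ((k : ℝ) + 1) ^ α * gdec m z k -
      ∑ h ∈ Finset.range (⌊α⌋₊ + 1), acoef m α h * z ^ ((h : ℝ) - α)) (𝓝[>] 0) (𝓝 0) := by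
  have hfl := Nat.lt_floor_add_one α
  obtain ⟨K, hK⟩ := tsum_mul_gdec_asymp m hα (n := ⌊α⌋₊ + 1 + 2) (by push_cast; linarith)
  have h1 : Tendsto (fun z : ℝ => K * z) (𝓝[>] 0) (𝓝 0) := by
    have : Tendsto (fun z : ℝ => K * z) (𝓝 0) (𝓝 (K * 0)) := tendsto_id.const_mul K
    rw [mul_zero] at this; exact this.mono_left nhdsWithin_le_nhds
  have h2 : Tendsto (fun z => ∑' k : ℕ, ((k : ℝ) + 1) ^ α * gdec m z k -
      ∑ h ∈ Finset.range (⌊α⌋₊ + 1 + 2), acoef m α h * z ^ ((h : ℝ) - α)) (𝓝[>] 0) (𝓝 0) := by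
    refine squeeze_zero_norm' ?_ h1
    filter_upwards [Ioo_mem_nhdsGT (zero_lt_one (α := ℝ))] with z hz using hK z hz.1 hz.2.le
  have h3 := ((tendsto_rpow_nhdsGT (p := ((⌊α⌋₊ + 1 : ℕ) : ℝ) - α)
    (by push_cast; linarith)).const_mul (acoef m α (⌊α⌋₊ + 1))).add
    ((tendsto_rpow_nhdsGT (p := ((⌊α⌋₊ + 2 : ℕ) : ℝ) - α)
    (by push_cast; linarith)).const_mul (acoef m α (⌊α⌋₊ + 2)))
  have h4 := h2.add h3
  simp only [mul_zero, add_zero] at h4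
  refine h4.congr fun z => ?_
  rw [Finset.sum_range_succ _ (⌊α⌋₊ + 1 + 1), Finset.sum_range_succ _ (⌊α⌋₊ + 1)]
  ring

lemma ceil_sub_one_eq (y : ℝ) (hy : 0 ≤ y) :
    (⌈y⌉₊ : ℝ) - 1 = y - 1 / 2 + (Int.fract (-y) - 1 / 2) := by
  rw [Int.fract, Int.floor_neg, natCast_ceil_eq_intCast_ceil hy]; push_cast; ring

lemma logGen_asymp {κ : ℝ} (hκ : 0 < κ) (m : ℕ) (hn : ∀ j : ℕ, 1 / κ ≠ j) :
    Tendsto (fun z => logGen κ m z -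
      ∑ h ∈ Finset.range (⌊1 / κ⌋₊ + 1), acoef m (1 / κ) h * z ^ ((h : ℝ) - 1 / κ)) (𝓝[>] 0)
      (𝓝 (-(1 / 2) * Real.log ((m : ℝ) + 1))) := by
  have hα : 0 < 1 / κ := by positivity
  set b : ℕ → ℝ := fun k => Int.fract (-((k : ℝ) + 1) ^ (1 / κ)) - 1 / 2 with hbd
  have hb1 : ∀ k, |b k| ≤ 1 := fun k => by
    have h1 := Int.fract_nonneg (-((k : ℝ) + 1) ^ (1 / κ))
    have h2 := Int.fract_lt_one (-((k : ℝ) + 1) ^ (1 / κ))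
    rw [abs_le]; constructor <;> simp only [hbd] <;> linarith
  have h1 := (tendsto_tsum_mul_gdec m hb1
    (fun ε hε => fract_mean_neg_rpow hα hn hε)).add (tendsto_tsum_mul_gdec_sub m hα)
  have h2 := h1.add_const (-(1 / 2) * Real.log ((m : ℝ) + 1))
  simp only [add_zero, zero_add] at h2
  refine h2.congr' ?_
  filter_upwards [self_mem_nhdsWithin] with z hz
  have hz0 : (0 : ℝ) < z := hz
  have hsb : Summable fun k => b k * gdec m z k :=
    Summable.of_norm_bounded (summable_gdec m hz0) fun k => by
      rw [Real.norm_eq_abs, abs_mul, abs_of_nonneg (gdec_nonneg m hz0 k)]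
      exact mul_le_of_le_one_left (gdec_nonneg m hz0 k) (hb1 k)
  have hs1 := summable_mul_gdec m (1 / κ) hz0
  have hs2 := (summable_gdec m hz0).mul_left (1 / 2)
  rw [(logGen_layer hκ m hz0).2]
  have e : ∀ k : ℕ, ((⌈((k : ℝ) + 1) ^ (1 / κ)⌉₊ : ℝ) - 1) * gdec m z k =
      ((k : ℝ) + 1) ^ (1 / κ) * gdec m z k - 1 / 2 * gdec m z k + b k * gdec m z k := fun k => by
    rw [ceil_sub_one_eq _ (by positivity)]; ring
  simp_rw [e]
  rw [(hs1.sub hs2).tsum_add hsb, hs1.tsum_sub hs2, tsum_mul_left, tsum_gdec m hz0]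
  ring

lemma logGen_asymp_nat {κ : ℝ} (hκ : 0 < κ) (m : ℕ) {j : ℕ} (hj : 1 / κ = j) :
    Tendsto (fun z => logGen κ m z -
      ∑ h ∈ Finset.range (⌊1 / κ⌋₊ + 1), acoef m (1 / κ) h * z ^ ((h : ℝ) - 1 / κ)) (𝓝[>] 0)
      (𝓝 (-Real.log ((m : ℝ) + 1))) := by
  have hα : 0 < 1 / κ := by positivity
  have h2 := (tendsto_tsum_mul_gdec_sub m hα).add_const (-Real.log ((m : ℝ) + 1))
  simp only [zero_add] at h2
  refine h2.congr' ?_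
  filter_upwards [self_mem_nhdsWithin] with z hz
  have hz0 : (0 : ℝ) < z := hz
  have hs1 := summable_mul_gdec m (1 / κ) hz0
  rw [(logGen_layer hκ m hz0).2]
  have e : ∀ k : ℕ, ((⌈((k : ℝ) + 1) ^ (1 / κ)⌉₊ : ℝ) - 1) * gdec m z k =
      ((k : ℝ) + 1) ^ (1 / κ) * gdec m z k - gdec m z k := fun k => by
    have : ((k : ℝ) + 1) ^ (1 / κ) = ((k + 1) ^ j : ℕ) := by
      rw [hj, Real.rpow_natCast]; push_cast; rfl
    rw [this, Nat.ceil_natCast]; ring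
  simp_rw [e]
  rw [hs1.tsum_sub (summable_gdec m hz0), tsum_gdec m hz0]
  ring

lemma gmom_succ (m : ℕ) {a : ℝ} (ha : 0 < a) (i : ℕ) :
    gmom m a (i + 1) = -a * gmom m (a - 1) i := by
  have e : ∀ b i x, eu m b i 1 x = x ^ b * gd m i x := fun b i x => by simp [eu]
  have i1 := integrableOn_eu m (show -1 < a by linarith) (i + 1) one_pos
  have i2 := (integrableOn_eu m (show -1 < a - 1 by linarith) i one_pos).const_mul a
  have hd := fun x (hx : x ∈ Set.Ioi (0 : ℝ)) => hasDerivAt_eu m a i 1 (t := x) hx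
  have hc : ContinuousAt (eu m a i 1) 0 := by
    rw [funext (e a i)]
    exact (Real.continuousAt_rpow_const 0 a (Or.inr ha.le)).mul (continuous_gd m i).continuousAt
  have h := integral_Ioi_of_hasDerivAt_of_tendsto hc.continuousWithinAt hd (i2.add i1)
    (tendsto_eu m a i one_pos)
  have h' : ∫ x in Set.Ioi (0 : ℝ), (a * eu m (a - 1) i 1 x + eu m a (i + 1) 1 x) = 0 := by
    rw [h, e, Real.zero_rpow ha.ne']; simp
  rw [integral_add i2 i1, integral_const_mul] at h'
  simp_rw [e] at h'
  rw [gmom, gmom]; linarith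

lemma gmom_zero_one (m : ℕ) : gmom m 0 1 = -Real.log ((m : ℝ) + 1) := by
  have e : ∀ i x, eu m 0 i 1 x = gd m i x := fun i x => by simp [eu]
  have h1 := integrableOn_eu m (show (-1 : ℝ) < 0 by norm_num) 1 one_pos
  have h2 := tendsto_eu m 0 0 one_pos
  rw [funext (e 1)] at h1
  rw [funext (e 0)] at h2
  have := integral_Ioi_of_hasDerivAt_of_tendsto' (a := 0) (fun x _ => hasDerivAt_gd m 0 x) h1 h2
  rw [gmom]; simp only [Real.rpow_zero, one_mul]
  rw [this, gd_zero_zero]; ring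

lemma acoef_one_one (m : ℕ) : acoef m 1 1 = 1 / 2 * Real.log ((m : ℝ) + 1) := by
  rw [acoef, gmom_succ m one_pos, sub_self, gmom_zero_one]; norm_num

lemma acoef_zero (m : ℕ) {a : ℝ} (ha : 0 < a) : acoef m a 0 = a * gmom m (a - 1) 0 := by
  rw [acoef, gmom_succ m ha]; norm_num

lemma acoef_one (m : ℕ) {a : ℝ} (ha : 1 < a) :
    acoef m a 1 = 1 / 2 * (a * (a - 1)) * gmom m (a - 1 - 1) 0 := by
  rw [acoef, gmom_succ m (by linarith), gmom_succ m (by linarith)]; norm_num; ring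

lemma realZeta_eq_tsum {x : ℝ} (hx : 1 < x) :
    realZeta x = ∑' k : ℕ, 1 / ((k : ℝ) + 1) ^ x := by
  rw [realZeta, zeta_eq_tsum_one_div_nat_add_one_cpow (by simpa using hx)]
  have : ∀ k : ℕ, 1 / ((k : ℂ) + 1) ^ (x : ℂ) = ((1 / ((k : ℝ) + 1) ^ x : ℝ) : ℂ) := fun k => by
    push_cast [Complex.ofReal_cpow (show (0 : ℝ) ≤ (k : ℝ) + 1 by positivity)]
    rfl
  simp_rw [this]
  rw [← Complex.ofReal_tsum, Complex.ofReal_re]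

lemma summable_one_div_add_one_rpow {x : ℝ} (hx : 1 < x) :
    Summable fun k : ℕ => 1 / ((k : ℝ) + 1) ^ x := by
  have := (summable_nat_add_iff 1).2 (Real.summable_one_div_nat_rpow.2 hx)
  simpa using this

lemma realZeta_pos {x : ℝ} (hx : 1 < x) : 0 < realZeta x := by
  rw [realZeta_eq_tsum hx]
  exact (summable_one_div_add_one_rpow hx).tsum_pos (fun k => by positivity) 0 (by positivity)

lemma hasSum_gd_zero (m : ℕ) {t : ℝ} (ht : 0 < t) :
    HasSum (fun k : ℕ => 1 / ((k : ℝ) + 1) *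
      (rexp (-(((k : ℝ) + 1) * t)) - rexp (-(((m : ℝ) + 1) * ((k : ℝ) + 1) * t)))) (gd m 0 t) := by
  have h0 := Real.exp_pos (-t)
  have h1 : rexp (-t) < 1 := Real.exp_lt_one_iff.2 (by linarith)
  have h2 : rexp (-t) ^ (m + 1) < 1 := pow_lt_one₀ h0.le h1 (by omega)
  have s1 := Real.hasSum_pow_div_log_of_abs_lt_one (x := rexp (-t)) (by rwa [abs_of_pos h0])
  have s2 := Real.hasSum_pow_div_log_of_abs_lt_one (x := rexp (-t) ^ (m + 1))
    (by rwa [abs_of_pos (by positivity)])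
  have e : gd m 0 t = -Real.log (1 - rexp (-t)) - -Real.log (1 - rexp (-t) ^ (m + 1)) := by
    have h3 := geom_sum_mul_neg (rexp (-t)) (m + 1)
    rw [← gpoly_eval] at h3
    rw [← h3, Real.log_mul (by have := one_le_gpoly m h0.le; positivity) (by linarith)]
    simp only [gd]; ring
  rw [e]
  refine (s1.sub s2).congr_fun fun k => ?_
  rw [← pow_mul, ← Real.exp_nat_mul, ← Real.exp_nat_mul]
  push_cast
  have e1 : ((k : ℝ) + 1) * -t = -((k + 1) * t) := by ring
  have e2 : ((m : ℝ) + 1) * (k + 1) * -t = -((m + 1) * (k + 1) * t) := by ring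
  rw [e1, e2]; ring

/-- Mellin transform of `gd m 0`. -/
lemma gmom_zero (m : ℕ) {s : ℝ} (hs : 0 < s) :
    gmom m (s - 1) 0 = Real.Gamma s * (1 - ((m : ℝ) + 1) ^ (-s)) * realZeta (s + 1) := by
  set F : ℕ → ℝ → ℝ := fun k t => t ^ (s - 1) * (1 / ((k : ℝ) + 1) *
      (rexp (-(((k : ℝ) + 1) * t)) - rexp (-(((m : ℝ) + 1) * ((k : ℝ) + 1) * t)))) with hF
  have hI : ∀ r : ℝ, 0 < r → IntegrableOn (fun t : ℝ => t ^ (s - 1) * rexp (-(r * t))) (Set.Ioi 0) :=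
    fun r hr => by simpa using integrableOn_rpow_mul_exp (a := s - 1) (by linarith) hr
  have eF : ∀ k, F k = fun t => 1 / ((k : ℝ) + 1) * (t ^ (s - 1) * rexp (-(((k : ℝ) + 1) * t)) -
      t ^ (s - 1) * rexp (-(((m : ℝ) + 1) * ((k : ℝ) + 1) * t))) := fun k => by
    funext t; simp only [hF]; ring
  have hint : ∀ k, IntegrableOn (F k) (Set.Ioi 0) := fun k => by
    rw [eF]
    exact ((hI _ (by positivity)).sub (hI _ (by positivity))).const_mul _
  have hval : ∀ k, ∫ t in Set.Ioi (0 : ℝ), F k t =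
      Real.Gamma s * (1 - ((m : ℝ) + 1) ^ (-s)) * (1 / ((k : ℝ) + 1) ^ (s + 1)) := fun k => by
    have hk : (0 : ℝ) < (k : ℝ) + 1 := by positivity
    have hm : (0 : ℝ) < (m : ℝ) + 1 := by positivity
    rw [eF, integral_const_mul, integral_sub (hI _ (by positivity)) (hI _ (by positivity)),
      Real.integral_rpow_mul_exp_neg_mul_Ioi hs hk,
      Real.integral_rpow_mul_exp_neg_mul_Ioi hs (by positivity), one_div, one_div, one_div,
      Real.inv_rpow hk.le, Real.inv_rpow (by positivity), Real.mul_rpow hm.le hk.le,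
      Real.rpow_add hk, Real.rpow_one, Real.rpow_neg hm.le]
    have := Real.rpow_pos_of_pos hk s
    have := Real.rpow_pos_of_pos hm s
    field_simp
  have hnn : ∀ k, ∀ t ∈ Set.Ioi (0 : ℝ), 0 ≤ F k t := fun k t ht => by
    have ht' : (0 : ℝ) < t := ht
    have hk : (0 : ℝ) < (k : ℝ) + 1 := by positivity
    refine mul_nonneg (by positivity) (mul_nonneg (by positivity) (sub_nonneg.2 ?_))
    apply Real.exp_le_exp.2
    have : 0 ≤ (m : ℝ) * (((k : ℝ) + 1) * t) := by positivity
    linarith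
  have hsum : Summable fun k => ∫ t in Set.Ioi (0 : ℝ), ‖F k t‖ := by
    have : ∀ k, ∫ t in Set.Ioi (0 : ℝ), ‖F k t‖ = ∫ t in Set.Ioi (0 : ℝ), F k t := fun k =>
      setIntegral_congr_fun measurableSet_Ioi fun t ht => Real.norm_of_nonneg (hnn k t ht)
    simp_rw [this, hval]
    exact (summable_one_div_add_one_rpow (by linarith)).mul_left _
  have h := hasSum_integral_of_summable_integral_norm hint hsum
  simp_rw [hval] at h
  have h2 : ∫ t in Set.Ioi (0 : ℝ), ∑' k, F k t = gmom m (s - 1) 0 :=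
    setIntegral_congr_fun measurableSet_Ioi fun t ht =>
      ((hasSum_gd_zero m ht).mul_left (t ^ (s - 1))).tsum_eq
  rw [h2] at h
  rw [← h.tsum_eq, tsum_mul_left, realZeta_eq_tsum (by linarith)]

lemma acoef_zero_eq (m : ℕ) {a : ℝ} (ha : 0 < a) :
    acoef m a 0 = Real.Gamma (a + 1) * (1 - ((m : ℝ) + 1) ^ (-a)) * realZeta (a + 1) := by
  rw [acoef_zero m ha, gmom_zero m ha, Real.Gamma_add_one ha.ne']; ring

lemma acoef_one_eq (m : ℕ) {a : ℝ} (ha : 1 < a) :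
    acoef m a 1 = (1 - ((m : ℝ) + 1) ^ (1 - a)) * realZeta a * Real.Gamma (1 + a) / 2 := by
  rw [acoef_one m ha, gmom_zero m (s := a - 1) (by linarith), add_comm 1 a,
    Real.Gamma_add_one (by linarith)]
  have : Real.Gamma a = (a - 1) * Real.Gamma (a - 1) := by
    rw [← Real.Gamma_add_one (by linarith)]; congr 1; ring
  rw [this]
  have e1 : -(a - 1) = 1 - a := by ring
  have e2 : a - 1 + 1 = a := by ring
  rw [e1, e2]; ring

section

/-- The phase function of the saddle-point problem in scaled coordinates. -/
noncomputable def ph (A : ℕ → ℝ) (H : ℕ) (α β ε y : ℝ) : ℝ :=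
  β * y + ∑ h ∈ Finset.range (H + 1), A h * (ε ^ h * y ^ ((h : ℝ) - α))

/-- First derivative of `ph` in `y`. -/
noncomputable def ph1 (A : ℕ → ℝ) (H : ℕ) (α β ε y : ℝ) : ℝ :=
  β + ∑ h ∈ Finset.range (H + 1), A h * (ε ^ h * (((h : ℝ) - α) * y ^ ((h : ℝ) - α - 1)))

/-- Second derivative of `ph` in `y`. -/
noncomputable def ph2 (A : ℕ → ℝ) (H : ℕ) (α ε y : ℝ) : ℝ :=
  ∑ h ∈ Finset.range (H + 1), A h * (ε ^ h * (((h : ℝ) - α) *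
    (((h : ℝ) - α - 1) * y ^ ((h : ℝ) - α - 1 - 1))))

variable (A : ℕ → ℝ) (H : ℕ) (α β : ℝ)

lemma hasDerivAt_ph (ε : ℝ) {y : ℝ} (hy : 0 < y) :
    HasDerivAt (ph A H α β ε) (ph1 A H α β ε y) y := by
  have h1 : HasDerivAt (fun y => β * y) β y := by simpa using (hasDerivAt_id y).const_mul β
  refine h1.add (HasDerivAt.fun_sum fun h _ => ?_)
  exact ((Real.hasDerivAt_rpow_const (Or.inl hy.ne')).const_mul _).const_mul _

lemma hasDerivAt_ph1 (ε : ℝ) {y : ℝ} (hy : 0 < y) :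
    HasDerivAt (ph1 A H α β ε) (ph2 A H α ε y) y := by
  refine (HasDerivAt.fun_sum fun h _ => ?_).const_add β
  exact (((Real.hasDerivAt_rpow_const (Or.inl hy.ne')).const_mul _).const_mul _).const_mul _

lemma contDiffAt_ph {n : ℕ∞} : ContDiffAt ℝ n (fun p : ℝ × ℝ => ph A H α β p.1 p.2) (0, 1) := by
  refine ((contDiffAt_const.mul contDiffAt_snd).add (ContDiffAt.sum fun h _ => ?_))
  exact contDiffAt_const.mul ((contDiffAt_fst.pow h).mul
    (contDiffAt_snd.rpow_const_of_ne one_ne_zero))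

lemma contDiffAt_ph1 {n : ℕ∞} : ContDiffAt ℝ n (fun p : ℝ × ℝ => ph1 A H α β p.1 p.2) (0, 1) := by
  refine (contDiffAt_const.add (ContDiffAt.sum fun h _ => ?_))
  exact contDiffAt_const.mul ((contDiffAt_fst.pow h).mul
    (contDiffAt_const.mul (contDiffAt_snd.rpow_const_of_ne one_ne_zero)))

lemma continuousAt_ph2 : ContinuousAt (fun p : ℝ × ℝ => ph2 A H α p.1 p.2) (0, 1) := by
  refine tendsto_finsetSum _ fun h _ => ?_
  refine ContinuousAt.mul continuousAt_const (ContinuousAt.mul (continuousAt_fst.pow h)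
    (ContinuousAt.mul continuousAt_const (ContinuousAt.mul continuousAt_const
      (ContinuousAt.rpow_const continuousAt_snd (Or.inl one_ne_zero)))))

variable {A H α β}

lemma ph_zero_one : ph A H α β 0 1 = β + A 0 := by
  rw [ph, Finset.sum_range_succ']; simp

lemma ph1_zero_one (hα : α ≠ 0) (hA : A 0 = β / α) : ph1 A H α β 0 1 = 0 := by
  rw [ph1, Finset.sum_range_succ', hA]; simp; field_simp; ring

lemma ph2_zero_one (hα : α ≠ 0) (hA : A 0 = β / α) : ph2 A H α 0 1 = β * (α + 1) := by
  rw [ph2, Finset.sum_range_succ', hA]; simp; field_simp; ring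

lemma exists_saddle (hα : 0 < α) (hβ : 0 < β) (hA : A 0 = β / α) :
    ∃ (y : ℝ → ℝ) (lam : ℕ → ℝ), Tendsto y (𝓝[>] 0) (𝓝 1) ∧
      (∀ᶠ ε in 𝓝[>] 0, ph1 A H α β ε (y ε) = 0) ∧ lam 0 = β + A 0 ∧ (1 ≤ H → lam 1 = A 1) ∧
      ∃ C, ∀ᶠ ε in 𝓝[>] 0, |ph A H α β ε (y ε) - ∑ h ∈ Finset.range (H + 1), lam h * ε ^ h| ≤
        C * ε ^ (H + 1) := by
  have hn : (((H + 1 : ℕ) : ℕ∞) : WithTop ℕ∞) ≠ 0 := by simp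
  have cdf := contDiffAt_ph1 A H α β (n := ((H + 1 : ℕ) : ℕ∞))
  have hd : HasDerivAt (fun y => ph1 A H α β 0 y) (β * (α + 1)) 1 := by
    rw [← ph2_zero_one hα.ne' hA (H := H)]; exact hasDerivAt_ph1 A H α β 0 one_pos
  have hinv : (fderiv ℝ (fun p : ℝ × ℝ => ph1 A H α β p.1 p.2) (0, 1) ∘L
      ContinuousLinearMap.inr ℝ ℝ ℝ).IsInvertible := by
    refine ⟨ContinuousLinearEquiv.unitsEquivAut ℝ (Units.mk0 (β * (α + 1)) (by positivity)), ?_⟩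
    ext
    have h1 := (cdf.differentiableAt hn).hasFDerivAt
    have h2 : HasDerivAt (fun y : ℝ => ((0 : ℝ), y)) ((0 : ℝ), (1 : ℝ)) 1 :=
      (hasDerivAt_const _ _).prodMk (hasDerivAt_id _)
    have h3 := h1.comp_hasDerivAt (1 : ℝ) h2
    have h4 := h3.unique hd
    simpa using h4.symm
  set y := cdf.implicitFunction hn hinv with hy
  have hy0 : y 0 = 1 := cdf.implicitFunction_apply_self hn hinv
  have hyc : ContDiffAt ℝ ((H + 1 : ℕ) : ℕ∞) y 0 := cdf.contDiffAt_implicitFunction hn hinv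
  have hye : ∀ᶠ ε in 𝓝 0, ph1 A H α β ε (y ε) = 0 := by
    have := cdf.eventually_apply_implicitFunction hn hinv
    simpa only [ph1_zero_one hα.ne' hA] using this
  set V : ℝ → ℝ := fun ε => ph A H α β ε (y ε) with hV
  have hVc : ContDiffAt ℝ ((H + 1 : ℕ) : ℕ∞) V 0 := by
    have h1 := contDiffAt_ph A H α β (n := ((H + 1 : ℕ) : ℕ∞))
    rw [← hy0] at h1
    exact h1.comp (0 : ℝ) (contDiffAt_id.prodMk hyc)
  obtain ⟨u, hu, hVu⟩ := hVc.contDiffOn le_rfl (by simp)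
  obtain ⟨b, hb, hbu⟩ := Metric.mem_nhds_iff.1 hu
  have hsub : Set.Icc 0 (b / 2) ⊆ u := fun x hx => hbu (by
    rw [Metric.mem_ball, Real.dist_eq, sub_zero, abs_of_nonneg hx.1]; linarith [hx.2])
  have hb2 : 0 < b / 2 := by positivity
  obtain ⟨C, hC⟩ := exists_taylor_mean_remainder_bound (f := V) (n := H) hb2.le
    (by have := hVu.mono hsub; exact_mod_cast this)
  have hud := uniqueDiffOn_Icc hb2
  have h0mem : (0 : ℝ) ∈ Set.Icc 0 (b / 2) := ⟨le_rfl, hb2.le⟩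
  refine ⟨y, fun h => iteratedDerivWithin h V (Set.Icc 0 (b / 2)) 0 / h.factorial, ?_, ?_, ?_, ?_,
    C, ?_⟩
  · have := hyc.continuousAt.tendsto
    rw [hy0] at this
    exact this.mono_left nhdsWithin_le_nhds
  · exact hye.filter_mono nhdsWithin_le_nhds
  · simp [hV, hy0, ph_zero_one]
  · intro hH
    obtain ⟨y', hy'⟩ : ∃ y', HasDerivAt y y' 0 := ⟨_, (hyc.differentiableAt hn).hasDerivAt⟩
    have hVd : HasDerivAt V (A 1) 0 := by
      have hs : HasDerivAt (fun ε => ∑ h ∈ Finset.range (H + 1), A h * (ε ^ h * y ε ^ ((h : ℝ) - α)))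
          (∑ h ∈ Finset.range (H + 1), A h * ((h * 0 ^ (h - 1)) * y 0 ^ ((h : ℝ) - α) +
            0 ^ h * (y' * ((h : ℝ) - α) * y 0 ^ ((h : ℝ) - α - 1)))) 0 := by
        refine HasDerivAt.fun_sum fun h _ => ?_
        exact ((hasDerivAt_pow h (0 : ℝ)).mul (hy'.rpow_const (Or.inl (by rw [hy0]; simp)))).const_mul _
      refine ((hy'.const_mul β).add hs).congr_deriv ?_
      obtain ⟨H', rfl⟩ : ∃ H', H = H' + 1 := ⟨H - 1, by omega⟩
      rw [Finset.sum_range_succ', Finset.sum_range_succ', hy0, hA]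
      simp
      field_simp; ring
    beta_reduce
    rw [iteratedDerivWithin_one, hVd.hasDerivWithinAt.derivWithin (hud 0 h0mem)]
    simp
  · filter_upwards [Ioo_mem_nhdsGT hb2] with ε hε
    have := hC ε ⟨hε.1.le, hε.2.le⟩
    rw [taylor_within_apply, Real.norm_eq_abs, sub_zero] at this
    convert this using 3
    refine Finset.sum_congr rfl fun h _ => ?_
    rw [smul_eq_mul]; field_simp

/-- Second order expansion of the phase at a critical point. -/
lemma ph_second_order (hα : 0 < α) (hA : A 0 = β / α) {η : ℝ} (hη : 0 < η) :
    ∃ r > 0, ∀ ε y τ : ℝ, |ε| < r → |y - 1| < r → |τ| < r → ph1 A H α β ε y = 0 →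
      |ph A H α β ε (y - τ) - ph A H α β ε y - β * (α + 1) / 2 * τ ^ 2| ≤ η * τ ^ 2 := by
  have hc := continuousAt_ph2 A H α
  rw [Metric.continuousAt_iff] at hc
  obtain ⟨d, hd, hc⟩ := hc η hη
  simp only [ph2_zero_one hα.ne' hA] at hc
  refine ⟨min (d / 2) (1 / 4), by positivity, fun ε y τ hε hy hτ h0 => ?_⟩
  rw [lt_min_iff] at hε hy hτ
  set c := β * (α + 1) with hcd
  have hpos : ∀ t ∈ Set.uIcc 0 τ, 0 < y - t ∧ |y - t - 1| < d ∧ |t| ≤ |τ| := fun t ht => by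
    have h1 : |t| ≤ |τ| := by simpa using Set.abs_sub_left_of_mem_uIcc ht
    have h2 := abs_lt.1 hy.2
    have h3 := abs_le.1 (h1.trans hτ.2.le)
    refine ⟨by linarith, ?_, h1⟩
    have h4 := abs_le.1 (h1.trans hτ.1.le)
    have h5 := abs_lt.1 hy.1
    rw [abs_lt]; constructor <;> linarith
  have hsub : ∀ t : ℝ, HasDerivAt (fun t => y - t) (-1) t := fun t =>
    (hasDerivAt_id t).const_sub y
  set g1 : ℝ → ℝ := fun t => -ph1 A H α β ε (y - t) - c * t with hg1
  have hg1d : ∀ t ∈ Set.uIcc 0 τ, HasDerivWithinAt g1 (ph2 A H α ε (y - t) - c) (Set.uIcc 0 τ) t :=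
    fun t ht => by
    have h1 := ((hasDerivAt_ph1 A H α β ε (hpos t ht).1).comp t (hsub t)).neg.sub
      ((hasDerivAt_id t).const_mul c)
    refine HasDerivAt.hasDerivWithinAt (h1.congr_deriv ?_)
    ring
  have hb1 : ∀ t ∈ Set.uIcc 0 τ, |g1 t| ≤ η * |t| := fun t ht => by
    have := (convex_uIcc 0 τ).norm_image_sub_le_of_norm_hasDerivWithin_le (C := η) hg1d
      (fun t ht => by
        have := hc (x := (ε, y - t)) (by
          rw [Prod.dist_eq, max_lt_iff, Real.dist_eq, Real.dist_eq]
          exact ⟨by simpa using (by linarith [hε.1] : |ε| < d), (hpos t ht).2.1⟩)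
        exact this.le) Set.left_mem_uIcc ht
    simpa [hg1, h0] using this
  set g0 : ℝ → ℝ := fun t => ph A H α β ε (y - t) - c / 2 * t ^ 2 with hg0
  have hg0d : ∀ t ∈ Set.uIcc 0 τ, HasDerivWithinAt g0 (g1 t) (Set.uIcc 0 τ) t := fun t ht => by
    have h1 := ((hasDerivAt_ph A H α β ε (hpos t ht).1).comp t (hsub t)).sub
      ((hasDerivAt_pow 2 t).const_mul (c / 2))
    refine HasDerivAt.hasDerivWithinAt (h1.congr_deriv ?_)
    simp only [hg1]; push_cast; ring
  have := (convex_uIcc 0 τ).norm_image_sub_le_of_norm_hasDerivWithin_le (C := η * |τ|) hg0d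
    (fun t ht => (hb1 t ht).trans (mul_le_mul_of_nonneg_left (hpos t ht).2.2 hη.le)) Set.left_mem_uIcc
    Set.right_mem_uIcc
  simp only [hg0, Real.norm_eq_abs, sub_zero] at this
  rw [mul_assoc, ← abs_mul, ← sq, abs_of_nonneg (sq_nonneg τ)] at this
  convert this using 2
  ring

end

section

variable {A : ℕ → ℝ} {H : ℕ} {α β : ℝ}

lemma phase_eq {ε y : ℝ} (hε : 0 < ε) (hy : 0 < y) :
    β * ε ^ (-(α + 1)) * (ε * y) + ∑ h ∈ Finset.range (H + 1), A h * (ε * y) ^ ((h : ℝ) - α) =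
      ε ^ (-α) * ph A H α β ε y := by
  rw [ph, mul_add, Finset.mul_sum]
  congr 1
  · have : ε ^ (-α) = ε ^ (-(α + 1)) * ε := by
      rw [← Real.rpow_add_one hε.ne']; congr 1; ring
    rw [this]; ring
  · refine Finset.sum_congr rfl fun h _ => ?_
    rw [Real.mul_rpow hε.le hy.le, sub_eq_add_neg, Real.rpow_add hε, Real.rpow_natCast]; ring

/-- Standard deviation at the saddle point. -/
noncomputable def sdev (α β ε : ℝ) : ℝ := Real.sqrt (β * (α + 1)) * ε ^ (-((α + 2) / 2))

lemma sdev_pos (hα : 0 < α) (hβ : 0 < β) {ε : ℝ} (hε : 0 < ε) : 0 < sdev α β ε := by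
  unfold sdev; positivity

lemma tendsto_mul_nhdsGT {y : ℝ → ℝ} (hy : Tendsto y (𝓝[>] 0) (𝓝 1)) :
    Tendsto (fun ε => ε * y ε) (𝓝[>] 0) (𝓝[>] 0) := by
  refine tendsto_nhdsWithin_iff.2 ⟨?_, ?_⟩
  · have h1 : Tendsto (fun ε : ℝ => ε) (𝓝[>] 0) (𝓝 0) := tendsto_id.mono_left nhdsWithin_le_nhds
    simpa using h1.mul hy
  · filter_upwards [self_mem_nhdsWithin, hy.eventually (lt_mem_nhds zero_lt_one)] with ε h1 h2
    exact mul_pos h1 h2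

lemma exists_saddle_log (hα : 0 < α) (hβ : 0 < β) (hA : A 0 = β / α) (hH : α < H + 1)
    {Φ : ℝ → ℝ} {c : ℝ}
    (hΦ : Tendsto (fun z => Φ z - ∑ h ∈ Finset.range (H + 1), A h * z ^ ((h : ℝ) - α)) (𝓝[>] 0)
      (𝓝 c)) :
    ∃ (y : ℝ → ℝ) (lam : ℕ → ℝ), Tendsto y (𝓝[>] 0) (𝓝 1) ∧ lam 0 = β + A 0 ∧
      (1 ≤ H → lam 1 = A 1) ∧
      Tendsto (fun ε => β * ε ^ (-(α + 1)) * (ε * y ε) + Φ (ε * y ε) -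
        ∑ h ∈ Finset.range (H + 1), lam h * ε ^ ((h : ℝ) - α)) (𝓝[>] 0) (𝓝 c) ∧
      ∀ s : ℝ, Tendsto (fun ε => Φ (ε * y ε - s / sdev α β ε) - Φ (ε * y ε) -
        β * ε ^ (-(α + 1)) * (s / sdev α β ε)) (𝓝[>] 0) (𝓝 (s ^ 2 / 2)) := by
  obtain ⟨y, lam, hy1, hcrit, hl0, hl1, C, hC⟩ := exists_saddle (H := H) hα hβ hA
  have hypos : ∀ᶠ ε in 𝓝[>] 0, 0 < y ε := hy1.eventually (lt_mem_nhds zero_lt_one)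
  refine ⟨y, lam, hy1, hl0, hl1, ?_, fun s => ?_⟩
  · have h1 := hΦ.comp (tendsto_mul_nhdsGT hy1)
    have h2 : Tendsto (fun ε => ε ^ (-α) * (ph A H α β ε (y ε) -
        ∑ h ∈ Finset.range (H + 1), lam h * ε ^ h)) (𝓝[>] 0) (𝓝 0) := by
      have h3 := (tendsto_rpow_nhdsGT (p := (H : ℝ) + 1 - α) (by linarith)).const_mul C
      rw [mul_zero] at h3
      refine squeeze_zero_norm' ?_ h3
      filter_upwards [hC, self_mem_nhdsWithin] with ε h4 hε
      have hε0 : (0 : ℝ) < ε := hε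
      have hp := Real.rpow_pos_of_pos hε0 (-α)
      rw [Real.norm_eq_abs, abs_mul, abs_of_pos hp]
      calc _ ≤ ε ^ (-α) * (C * ε ^ (H + 1)) := by gcongr
        _ = _ := by
          have : (H : ℝ) + 1 - α = -α + ((H + 1 : ℕ) : ℝ) := by push_cast; ring
          rw [this, Real.rpow_add hε0, Real.rpow_natCast]; ring
    have h3 := h2.add h1
    rw [zero_add] at h3
    refine h3.congr' ?_
    filter_upwards [hypos, self_mem_nhdsWithin] with ε hyε hε
    have hε0 : (0 : ℝ) < ε := hε
    have e := phase_eq (A := A) (H := H) (α := α) (β := β) hε0 hyε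
    have e2 : ε ^ (-α) * ∑ h ∈ Finset.range (H + 1), lam h * ε ^ h =
        ∑ h ∈ Finset.range (H + 1), lam h * ε ^ ((h : ℝ) - α) := by
      rw [Finset.mul_sum]
      refine Finset.sum_congr rfl fun h _ => ?_
      rw [sub_eq_add_neg, Real.rpow_add hε0, Real.rpow_natCast]; ring
    simp only [Function.comp, mul_sub, e2, ← e]; ring
  · set k := Real.sqrt (β * (α + 1)) with hk
    have hβα : 0 < β * (α + 1) := by positivity
    have hk0 : 0 < k := Real.sqrt_pos.2 hβα
    have hk2 : k ^ 2 = β * (α + 1) := Real.sq_sqrt hβα.le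
    set τ : ℝ → ℝ := fun ε => s / k * ε ^ (α / 2) with hτ
    have hτ0 : Tendsto τ (𝓝[>] 0) (𝓝 0) := by
      simpa using (tendsto_rpow_nhdsGT (p := α / 2) (by positivity)).const_mul (s / k)
    have hτe : ∀ ε : ℝ, 0 < ε → s / sdev α β ε = ε * τ ε := fun ε hε => by
      have h1 : ε ^ ((α + 2) / 2) = ε * ε ^ (α / 2) := by
        rw [mul_comm, ← Real.rpow_add_one hε.ne']; congr 1; ring
      rw [sdev, ← hk, Real.rpow_neg hε.le, h1, hτ]
      have := Real.rpow_pos_of_pos hε (α / 2)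
      field_simp
    have hyτ : Tendsto (fun ε => y ε - τ ε) (𝓝[>] 0) (𝓝 1) := by simpa using hy1.sub hτ0
    have hR := (hΦ.comp (tendsto_mul_nhdsGT hyτ)).sub (hΦ.comp (tendsto_mul_nhdsGT hy1))
    rw [sub_self] at hR
    have hM : Tendsto (fun ε => ε ^ (-α) * (ph A H α β ε (y ε - τ ε) - ph A H α β ε (y ε)))
        (𝓝[>] 0) (𝓝 (s ^ 2 / 2)) := by
      rw [Metric.tendsto_nhds]
      intro η hη
      obtain ⟨r, hr, hr'⟩ := ph_second_order (H := H) hα hA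
        (show 0 < η * (β * (α + 1)) / (s ^ 2 + 1) by positivity)
      have ev1 := hy1.eventually (Metric.ball_mem_nhds 1 hr)
      have ev2 := hτ0.eventually (Metric.ball_mem_nhds 0 hr)
      filter_upwards [ev1, ev2, hcrit, Ioo_mem_nhdsGT hr] with ε a1 a2 a3 a4
      have hε0 := a4.1
      have h5 := hr' ε (y ε) (τ ε) (by rw [abs_of_pos hε0]; exact a4.2) a1
        (by simpa [Real.dist_eq] using a2) a3
      have hp := Real.rpow_pos_of_pos hε0 (-α)
      have hτ2 : ε ^ (-α) * τ ε ^ 2 = s ^ 2 / (β * (α + 1)) := by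
        have : (ε ^ (α / 2)) ^ 2 = ε ^ α := by
          rw [← Real.rpow_natCast, ← Real.rpow_mul hε0.le]; congr 1; push_cast; ring
        simp only [hτ]
        rw [mul_pow, this, div_pow, hk2, Real.rpow_neg hε0.le]
        have := Real.rpow_pos_of_pos hε0 α
        field_simp
      rw [Real.dist_eq]
      have e1 : ε ^ (-α) * (ph A H α β ε (y ε - τ ε) - ph A H α β ε (y ε)) - s ^ 2 / 2 =
          ε ^ (-α) * (ph A H α β ε (y ε - τ ε) - ph A H α β ε (y ε) -
            β * (α + 1) / 2 * τ ε ^ 2) := by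
        have : s ^ 2 / 2 = β * (α + 1) / 2 * (ε ^ (-α) * τ ε ^ 2) := by
          rw [hτ2]; field_simp
        rw [this]; ring
      rw [e1, abs_mul, abs_of_pos hp]
      calc _ ≤ ε ^ (-α) * (η * (β * (α + 1)) / (s ^ 2 + 1) * τ ε ^ 2) := by gcongr
        _ = η * (β * (α + 1)) / (s ^ 2 + 1) * (ε ^ (-α) * τ ε ^ 2) := by ring
        _ = η * (s ^ 2 / (s ^ 2 + 1)) := by rw [hτ2]; field_simp
        _ < η * 1 := by
          gcongr
          rw [div_lt_one (by positivity)]; linarith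
        _ = η := mul_one η
    have h3 := hM.add hR
    rw [add_zero] at h3
    refine h3.congr' ?_
    filter_upwards [hypos, hyτ.eventually (lt_mem_nhds zero_lt_one), self_mem_nhdsWithin]
      with ε hyε hyτε hε
    have hε0 : (0 : ℝ) < ε := hε
    have e := phase_eq (A := A) (H := H) (α := α) (β := β) hε0 hyε
    have e' := phase_eq (A := A) (H := H) (α := α) (β := β) hε0 hyτε
    have e3 : ε * y ε - ε * τ ε = ε * (y ε - τ ε) := by ring
    rw [hτe ε hε0, e3]
    simp only [Function.comp, mul_sub (ε ^ (-α)), ← e, ← e']; ring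

end

lemma summable_of_bounded_pow {e : ℕ → ℝ} {R B t : ℝ} (ht : 0 ≤ t) (htR : t < R)
    (hB : ∀ i, |e i| * R ^ i ≤ B) :
    (∀ i, |e i| * t ^ i ≤ B * (t / R) ^ i) ∧ Summable fun i => B * (t / R) ^ i := by
  have hR : 0 < R := by linarith
  refine ⟨fun i => ?_, (summable_geometric_of_lt_one (by positivity)
    ((div_lt_one hR).2 htR)).mul_left B⟩
  rw [div_pow, mul_div_assoc', le_div_iff₀ (by positivity)]
  have := mul_le_mul_of_nonneg_right (hB i) (pow_nonneg ht i)
  linarith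

/-- A locally bounded sequence of power series tending to zero on the reals tends to zero
everywhere. -/
lemma tendsto_tsum_pow_zero {e : ℕ → ℕ → ℝ}
    (hB : ∀ R : ℝ, 0 < R → ∃ B, ∀ᶠ j in atTop, ∀ i, |e j i| * R ^ i ≤ B)
    (h0 : ∀ s : ℝ, Tendsto (fun j => ∑' i, e j i * s ^ i) atTop (𝓝 0)) (w : ℂ) :
    Tendsto (fun j => ∑' i, (e j i : ℂ) * w ^ i) atTop (𝓝 0) := by
  have hco : ∀ r, Tendsto (fun j => e j r) atTop (𝓝 0) := by
    intro r
    induction r using Nat.strong_induction_on with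
    | _ r ih =>
      obtain ⟨B, hB1⟩ := hB 1 one_pos
      have hB0 : 0 ≤ B := by
        obtain ⟨j, hj⟩ := hB1.exists
        exact (by positivity : 0 ≤ |e j 0| * 1 ^ 0).trans (hj 0)
      rw [Metric.tendsto_nhds]
      intro η hη
      obtain ⟨s, hs0, hs1, hs2⟩ : ∃ s : ℝ, 0 < s ∧ s ≤ 1 / 2 ∧ 2 * B * s < η / 2 := by
        refine ⟨min (1 / 2) (η / (8 * (B + 1))), by positivity, min_le_left _ _, ?_⟩
        calc 2 * B * min (1 / 2) (η / (8 * (B + 1))) ≤ 2 * B * (η / (8 * (B + 1))) := by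
              gcongr; exact min_le_right _ _
          _ = η / 4 * (B / (B + 1)) := by field_simp; ring
          _ ≤ η / 4 * 1 := by
              gcongr; rw [div_le_one (by positivity)]; linarith
          _ < η / 2 := by linarith
      have hlim : Tendsto (fun j => |∑' i, e j i * s ^ i| + ∑ i ∈ Finset.range r, |e j i| * s ^ i)
          atTop (𝓝 0) := by
        have h2 : Tendsto (fun j => ∑ i ∈ Finset.range r, |e j i| * s ^ i) atTop (𝓝 0) := by
          have := tendsto_finsetSum (f := fun i j => |e j i| * s ^ i) (a := fun _ => (0 : ℝ))
            (Finset.range r) fun i hi => by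
              simpa using ((ih i (Finset.mem_range.1 hi)).abs).mul_const (s ^ i)
          simpa using this
        simpa using (h0 s).abs.add h2
      have hsr : 0 < s ^ r * (η / 2) := by positivity
      filter_upwards [hB1, hlim.eventually (gt_mem_nhds hsr)] with j hj hl
      rw [Real.dist_eq, sub_zero]
      obtain ⟨hb, hsm⟩ := summable_of_bounded_pow hs0.le (by linarith) hj
      have hbn : ∀ i, ‖e j i * s ^ i‖ ≤ B * (s / 1) ^ i := fun i => by
        rw [norm_mul, norm_pow, Real.norm_of_nonneg hs0.le]; exact hb i
      have hse : Summable fun i => e j i * s ^ i := Summable.of_norm_bounded hsm hbn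
      have hsplit := hse.sum_add_tsum_nat_add (r + 1)
      rw [Finset.sum_range_succ] at hsplit
      have htail : |∑' i, e j (i + (r + 1)) * s ^ (i + (r + 1))| ≤ 2 * B * s * s ^ r := by
        have h1 := tsum_of_norm_bounded ((hasSum_geometric_of_lt_one hs0.le
          (by linarith : s < 1)).mul_left (B * s ^ (r + 1)))
          (f := fun i => e j (i + (r + 1)) * s ^ (i + (r + 1))) (fun i => by
            refine (hbn _).trans (le_of_eq ?_)
            rw [div_one, pow_add]; ring)
        refine h1.trans ?_
        have h2 : (1 - s)⁻¹ ≤ 2 := by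
          rw [inv_le_comm₀ (by linarith) two_pos]; linarith
        calc B * s ^ (r + 1) * (1 - s)⁻¹ ≤ B * s ^ (r + 1) * 2 := by gcongr
          _ = _ := by ring
      have hsum : |∑ i ∈ Finset.range r, e j i * s ^ i| ≤
          ∑ i ∈ Finset.range r, |e j i| * s ^ i := by
        refine (Finset.abs_sum_le_sum_abs _ _).trans (le_of_eq ?_)
        simp_rw [abs_mul, abs_pow, abs_of_pos hs0]
      have hmain : |e j r| * s ^ r ≤ |∑' i, e j i * s ^ i| +
          ∑ i ∈ Finset.range r, |e j i| * s ^ i + 2 * B * s * s ^ r := by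
        have : |e j r| * s ^ r = |∑' i, e j i * s ^ i - ∑ i ∈ Finset.range r, e j i * s ^ i -
            ∑' i, e j (i + (r + 1)) * s ^ (i + (r + 1))| := by
          rw [← hsplit, ← abs_of_pos (pow_pos hs0 r), ← abs_mul]; congr 1; 
          rw [abs_of_pos (pow_pos hs0 r)]; ring
        rw [this]
        refine (abs_sub _ _).trans ?_
        have := abs_sub (∑' i, e j i * s ^ i) (∑ i ∈ Finset.range r, e j i * s ^ i)
        linarith
      have h5 : 2 * B * s * s ^ r < η / 2 * s ^ r := by
        have := pow_pos hs0 r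
        gcongr
      have h6 : |e j r| * s ^ r < η * s ^ r := by linarith
      exact lt_of_mul_lt_mul_right h6 (pow_pos hs0 r).le
  obtain ⟨B, hB'⟩ := hB (‖w‖ + 1) (by positivity)
  have hsm : Summable fun i => B * (‖w‖ / (‖w‖ + 1)) ^ i :=
    (summable_geometric_of_lt_one (by positivity)
      ((div_lt_one (by positivity)).2 (by linarith))).mul_left B
  have := tendsto_tsum_of_dominated_convergence (𝓕 := atTop) (g := fun _ : ℕ => (0 : ℂ))
    (f := fun j i => (e j i : ℂ) * w ^ i) hsm (fun i => by
      have h1 := (Complex.continuous_ofReal.tendsto 0).comp (hco i)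
      simpa using h1.mul_const (w ^ i)) (by
      filter_upwards [hB'] with j hj i
      have := (summable_of_bounded_pow (norm_nonneg w) (by linarith) hj).1 i
      rw [norm_mul, norm_pow, Complex.norm_real]
      exact this)
  simpa using this

/-- Taylor coefficients of a finite exponential sum. -/
noncomputable def expCoef (S : Finset ℕ) (w x : ℕ → ℝ) (i : ℕ) : ℝ :=
  ∑ k ∈ S, w k * (x k ^ i / i.factorial)

lemma hasSum_expCoef (S : Finset ℕ) (w x : ℕ → ℝ) (s : ℂ) :
    HasSum (fun i => (expCoef S w x i : ℂ) * s ^ i) (∑ k ∈ S, (w k : ℂ) * Complex.exp (s * x k)) := by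
  have h : ∀ k ∈ S, HasSum (fun i : ℕ => (w k : ℂ) * ((s * x k) ^ i / i.factorial))
      ((w k : ℂ) * Complex.exp (s * x k)) := fun k _ => by
    have := NormedSpace.expSeries_div_hasSum_exp (s * (x k : ℂ))
    rw [← Complex.exp_eq_exp_ℂ] at this
    exact this.mul_left _
  refine (hasSum_sum h).congr_fun fun i => ?_
  rw [expCoef]; push_cast
  rw [Finset.sum_mul]
  refine Finset.sum_congr rfl fun k _ => ?_
  rw [mul_pow]; ring

lemma expCoef_bound (S : Finset ℕ) {w : ℕ → ℝ} (hw : ∀ k, 0 ≤ w k) (x : ℕ → ℝ) {R : ℝ} (hR : 0 < R)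
    (i : ℕ) : |expCoef S w x i| * R ^ i ≤
      ∑ k ∈ S, w k * rexp (R * x k) + ∑ k ∈ S, w k * rexp (-R * x k) := by
  rw [← Finset.sum_add_distrib]
  calc |expCoef S w x i| * R ^ i ≤ (∑ k ∈ S, w k * (|x k| ^ i / i.factorial)) * R ^ i := by
        gcongr
        refine (Finset.abs_sum_le_sum_abs _ _).trans (le_of_eq ?_)
        refine Finset.sum_congr rfl fun k _ => ?_
        rw [abs_mul, abs_of_nonneg (hw k), abs_div, abs_pow, Nat.abs_cast]
    _ = ∑ k ∈ S, w k * ((R * |x k|) ^ i / i.factorial) := by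
        rw [Finset.sum_mul]
        refine Finset.sum_congr rfl fun k _ => ?_
        rw [mul_pow]; ring
    _ ≤ _ := by
        refine Finset.sum_le_sum fun k _ => ?_
        rw [← mul_add]
        refine mul_le_mul_of_nonneg_left ?_ (hw k)
        refine (Real.pow_div_factorial_le_exp _ (by positivity) i).trans ?_
        rcases abs_cases (x k) with ⟨h, _⟩ | ⟨h, _⟩
        · rw [h]; linarith [Real.exp_pos (-R * x k)]
        · rw [h, mul_neg, ← neg_mul]; linarith [Real.exp_pos (R * x k)]

/-- Taylor coefficients of `exp (s ^ 2 / 2)`. -/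
noncomputable def gaussCoef (i : ℕ) : ℝ :=
  if Even i then (1 / 2) ^ (i / 2) / ((i / 2).factorial : ℝ) else 0

lemma hasSum_gaussCoef (s : ℂ) : HasSum (fun i => (gaussCoef i : ℂ) * s ^ i)
    (Complex.exp (s ^ 2 / 2)) := by
  have h := NormedSpace.expSeries_div_hasSum_exp (s ^ 2 / 2)
  rw [← Complex.exp_eq_exp_ℂ] at h
  have hinj : Function.Injective fun k : ℕ => 2 * k := fun a b hab => by simpa using hab
  rw [← hinj.hasSum_iff]
  · refine h.congr_fun fun k => ?_
    simp only [Function.comp, gaussCoef]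
    rw [if_pos (even_two_mul k), Nat.mul_div_cancel_left k two_pos]
    push_cast
    rw [pow_mul, div_pow, div_pow]; ring
  · intro i hi
    rw [gaussCoef, if_neg]
    · simp
    · rintro ⟨k, rfl⟩
      exact hi ⟨k, by simp only; ring⟩

lemma gaussCoef_bound (R : ℝ) (hR : 0 < R) : ∃ B, ∀ i, |gaussCoef i| * R ^ i ≤ B := by
  have h := (hasSum_gaussCoef (R : ℂ)).summable.norm
  refine ⟨∑' i, ‖(gaussCoef i : ℂ) * (R : ℂ) ^ i‖, fun i => ?_⟩
  have := h.le_tsum i fun j _ => norm_nonneg _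
  rw [norm_mul, norm_pow, Complex.norm_real, Complex.norm_real, Real.norm_of_nonneg hR.le] at this
  exact this

/-- Convergence of Laplace transforms to the Gaussian one implies that of Fourier transforms. -/
lemma tendsto_charFun {S : ℕ → Finset ℕ} {w x : ℕ → ℕ → ℝ} (hw : ∀ j k, 0 ≤ w j k)
    (hm : ∀ s : ℝ, Tendsto (fun j => ∑ k ∈ S j, w j k * rexp (s * x j k)) atTop
      (𝓝 (rexp (s ^ 2 / 2)))) (z : ℂ) :
    Tendsto (fun j => ∑ k ∈ S j, (w j k : ℂ) * Complex.exp (z * x j k)) atTop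
      (𝓝 (Complex.exp (z ^ 2 / 2))) := by
  have hsub : ∀ (j : ℕ) (s : ℂ), HasSum
      (fun i => ((expCoef (S j) (w j) (x j) i - gaussCoef i : ℝ) : ℂ) * s ^ i)
      (∑ k ∈ S j, (w j k : ℂ) * Complex.exp (s * x j k) - Complex.exp (s ^ 2 / 2)) := fun j s => by
    refine ((hasSum_expCoef (S j) (w j) (x j) s).sub (hasSum_gaussCoef s)).congr_fun fun i => ?_
    push_cast; ring
  have h := tendsto_tsum_pow_zero
    (e := fun j i => expCoef (S j) (w j) (x j) i - gaussCoef i) (fun R hR => ?_) (fun s => ?_) z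
  · simp_rw [(hsub _ z).tsum_eq] at h
    exact tendsto_sub_nhds_zero_iff.1 h
  · obtain ⟨B, hB⟩ := gaussCoef_bound R hR
    refine ⟨(rexp (R ^ 2 / 2) + 1) + (rexp ((-R) ^ 2 / 2) + 1) + B, ?_⟩
    filter_upwards [(hm R).eventually (gt_mem_nhds (lt_add_one _)),
      (hm (-R)).eventually (gt_mem_nhds (lt_add_one _))] with j h1 h2 i
    have h3 := expCoef_bound (S j) (hw j) (x j) hR i
    have h4 := hB i
    have h5 := mul_le_mul_of_nonneg_right (abs_sub (expCoef (S j) (w j) (x j) i) (gaussCoef i))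
      (pow_pos hR i).le
    linarith
  · have h1 := tendsto_sub_nhds_zero_iff.2 (hm s)
    refine h1.congr fun j => ?_
    have h2 := (hsub j (s : ℂ)).tsum_eq
    rw [← Complex.ofReal_inj, Complex.ofReal_tsum]
    push_cast at h2 ⊢
    exact h2.symm

lemma integral_exp_int_mul {σ : ℝ} (hσ : 0 < σ) (d : ℤ) :
    ∫ u in (-(π * σ))..(π * σ), Complex.exp (Complex.I * u * (d / σ : ℝ)) =
      if d = 0 then ((2 * π * σ : ℝ) : ℂ) else 0 := by
  split_ifs with h
  · simp [h]; ring
  · have hc : (Complex.I * (d / σ : ℝ) : ℂ) ≠ 0 := by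
      have : ((d / σ : ℝ) : ℂ) ≠ 0 := by
        rw [Complex.ofReal_ne_zero]; have : (d : ℝ) ≠ 0 := by exact_mod_cast h
        positivity
      exact mul_ne_zero Complex.I_ne_zero this
    have := integral_exp_mul_complex (a := -(π * σ)) (b := π * σ) hc
    have e : ∀ u : ℝ, Complex.I * u * (d / σ : ℝ) = Complex.I * (d / σ : ℝ) * u := fun u => by ring
    simp_rw [e]
    rw [this]
    have hσ' : (σ : ℂ) ≠ 0 := by exact_mod_cast hσ.ne'
    have e1 : Complex.I * ((d / σ : ℝ) : ℂ) * ((π * σ : ℝ) : ℂ) = d * (π * Complex.I) := by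
      push_cast; field_simp
    have e2 : Complex.I * ((d / σ : ℝ) : ℂ) * ((-(π * σ) : ℝ) : ℂ) =
        d * (π * Complex.I) - d * (2 * π * Complex.I) := by
      push_cast; field_simp; ring
    rw [e1, e2, Complex.exp_sub, Complex.exp_int_mul_two_pi_mul_I]
    simp

/-- A local limit theorem. -/
lemma local_limit {N n : ℕ → ℕ} {w : ℕ → ℕ → ℝ} {σ : ℕ → ℝ} (hw : ∀ j k, 0 ≤ w j k)
    (hσ0 : ∀ j, 0 < σ j) (hσ : Tendsto σ atTop atTop) (hn : ∀ j, n j < N j)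
    (hm : ∀ s : ℝ, Tendsto (fun j => ∑ k ∈ Finset.range (N j),
      w j k * rexp (s * (((k : ℝ) - n j) / σ j))) atTop (𝓝 (rexp (s ^ 2 / 2))))
    {D : ℝ → ℝ} (hD : Integrable D)
    (hb : ∀ᶠ j in atTop, ∀ u : ℝ, |u| ≤ π * σ j → ‖∑ k ∈ Finset.range (N j),
      (w j k : ℂ) * Complex.exp (Complex.I * u * (((k : ℝ) - n j) / σ j : ℝ))‖ ≤ D u) :
    Tendsto (fun j => σ j * w j (n j)) atTop (𝓝 (1 / Real.sqrt (2 * π))) := by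
  set φ : ℕ → ℝ → ℂ := fun j u => ∑ k ∈ Finset.range (N j),
      (w j k : ℂ) * Complex.exp (Complex.I * u * (((k : ℝ) - n j) / σ j : ℝ)) with hφ
  have hφc : ∀ j, Continuous (φ j) := fun j => by
    simp only [hφ]; fun_prop
  have hval : ∀ j, ∫ u, (Set.Ioc (-(π * σ j)) (π * σ j)).indicator (φ j) u =
      ((2 * π * σ j * w j (n j) : ℝ) : ℂ) := fun j => by
    have hp : 0 < π * σ j := mul_pos Real.pi_pos (hσ0 j)
    rw [integral_indicator measurableSet_Ioc, ← intervalIntegral.integral_of_le (by linarith)]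
    simp only [hφ]
    rw [intervalIntegral.integral_finsetSum fun k _ => Continuous.intervalIntegrable (by fun_prop) _ _]
    have : ∀ k ∈ Finset.range (N j), ∫ u in (-(π * σ j))..(π * σ j),
        (w j k : ℂ) * Complex.exp (Complex.I * u * (((k : ℝ) - n j) / σ j : ℝ)) =
        if k = n j then ((2 * π * σ j * w j (n j) : ℝ) : ℂ) else 0 := fun k _ => by
      rw [intervalIntegral.integral_const_mul]
      have h1 := integral_exp_int_mul (hσ0 j) ((k : ℤ) - n j)
      have e : (((k : ℤ) - (n j : ℤ) : ℤ) : ℝ) = (k : ℝ) - n j := by push_cast; ring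
      rw [e] at h1
      rw [h1]
      by_cases hk : k = n j
      · rw [if_pos (by rw [hk]; simp), if_pos hk, hk]; push_cast; ring
      · rw [if_neg (by omega), if_neg hk, mul_zero]
    rw [Finset.sum_congr rfl this, Finset.sum_ite_eq', if_pos (Finset.mem_range.2 (hn j))]
  have hlim : Tendsto (fun j => ∫ u, (Set.Ioc (-(π * σ j)) (π * σ j)).indicator (φ j) u) atTop
      (𝓝 (∫ u : ℝ, ((rexp (-(1 / 2) * u ^ 2) : ℝ) : ℂ))) := by
    refine tendsto_integral_filter_of_dominated_convergence (fun u => |D u|) ?_ ?_ hD.abs ?_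
    · exact Eventually.of_forall fun j =>
        ((hφc j).aestronglyMeasurable).indicator measurableSet_Ioc
    · filter_upwards [hb] with j hj
      refine Eventually.of_forall fun u => ?_
      by_cases hu : u ∈ Set.Ioc (-(π * σ j)) (π * σ j)
      · rw [Set.indicator_of_mem hu]
        exact (hj u (abs_le.2 ⟨hu.1.le, hu.2⟩)).trans (le_abs_self _)
      · rw [Set.indicator_of_notMem hu, norm_zero]; exact abs_nonneg _
    · refine Eventually.of_forall fun u => ?_
      have h1 := tendsto_charFun (S := fun j => Finset.range (N j))
        (x := fun j k => ((k : ℝ) - n j) / σ j) hw hm (Complex.I * u)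
      have e : Complex.exp ((Complex.I * u) ^ 2 / 2) = ((rexp (-(1 / 2) * u ^ 2) : ℝ) : ℂ) := by
        rw [mul_pow, Complex.I_sq]; push_cast; congr 1; ring
      rw [e] at h1
      refine h1.congr' ?_
      filter_upwards [hσ.eventually_gt_atTop |u|] with j hj
      have h2 : |u| < π * σ j := by
        have := Real.pi_gt_three
        nlinarith [abs_nonneg u]
      rw [abs_lt] at h2
      have hu : u ∈ Set.Ioc (-(π * σ j)) (π * σ j) := ⟨h2.1, h2.2.le⟩
      rw [Set.indicator_of_mem hu]
  simp_rw [hval] at hlim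
  rw [integral_complex_ofReal, integral_gaussian] at hlim
  have hlim' := (Complex.continuous_re.tendsto _).comp hlim
  simp only [Function.comp_def, Complex.ofReal_re] at hlim'
  have h := hlim'.const_mul (1 / (2 * π))
  have e : 1 / (2 * π) * Real.sqrt (π / (1 / 2)) = 1 / Real.sqrt (2 * π) := by
    have e1 : π / (1 / 2) = 2 * π := by ring
    have e2 : Real.sqrt (2 * π) ^ 2 = 2 * π := Real.sq_sqrt (by positivity)
    have : 0 < Real.sqrt (2 * π) := Real.sqrt_pos.2 (by positivity)
    rw [e1]; field_simp; rw [e2]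
  rw [e] at h
  refine h.congr fun j => ?_
  field_simp

/-- The truncated generating polynomial of `pkm κ m`. -/
noncomputable def pgen (κ : ℝ) (m M : ℕ) : Polynomial ℝ :=
  ∏ ℓ ∈ Finset.range M, ∑ j ∈ Finset.range (m + 1), Polynomial.X ^ (j * psPart κ (ℓ + 1))

lemma pgen_coeff_eq_card (κ : ℝ) (m M n : ℕ) : (pgen κ m M).coeff n =
    (((Fintype.piFinset fun _ : Fin M => Finset.range (m + 1)).filter
      fun p => n = ∑ i : Fin M, p i * psPart κ (i + 1)).card : ℝ) := by
  have h : pgen κ m M = ∑ p ∈ Fintype.piFinset fun _ : Fin M => Finset.range (m + 1),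
      (Polynomial.X : Polynomial ℝ) ^ ∑ i, p i * psPart κ (i + 1) := by
    rw [pgen, Finset.prod_range, Finset.prod_univ_sum]
    exact Finset.sum_congr rfl fun p _ => Finset.prod_pow_eq_pow_sum _ _ _
  rw [h, Polynomial.finsetSum_coeff]
  simp only [Polynomial.coeff_X_pow]
  rw [Finset.sum_boole]

lemma pgen_coeff_nonneg (κ : ℝ) (m M n : ℕ) : 0 ≤ (pgen κ m M).coeff n := by
  rw [pgen_coeff_eq_card]; positivity

lemma pgen_coeff_eq_pkm {κ : ℝ} {m M n : ℕ} (hM : ∀ ℓ, M ≤ ℓ → n < psPart κ (ℓ + 1)) :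
    (pgen κ m M).coeff n = pkm κ m n := by
  rw [pgen_coeff_eq_card, pkm, ← Fintype.card_coe, ← Nat.card_eq_fintype_card]
  congr 1
  symm
  have hz : ∀ r : ℕ →₀ ℕ, (r.sum fun ℓ j => j * psPart κ (ℓ + 1)) = n →
      ∀ ℓ, M ≤ ℓ → r ℓ = 0 := by
    intro r hr ℓ hℓ
    by_contra h0
    have h1 : r ℓ * psPart κ (ℓ + 1) ≤ n := by
      rw [← hr]
      exact Finset.single_le_sum (f := fun i => r i * psPart κ (i + 1)) (fun _ _ => Nat.zero_le _)
        (Finsupp.mem_support_iff.2 h0)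
    have h2 := hM ℓ hℓ
    have h3 : 1 * psPart κ (ℓ + 1) ≤ r ℓ * psPart κ (ℓ + 1) :=
      Nat.mul_le_mul_right _ (Nat.one_le_iff_ne_zero.2 h0)
    omega
  have hs : ∀ r : ℕ →₀ ℕ, (∀ ℓ, M ≤ ℓ → r ℓ = 0) →
      (r.sum fun ℓ j => j * psPart κ (ℓ + 1)) = ∑ i : Fin M, r i * psPart κ (i + 1) := by
    intro r hr
    rw [Finsupp.sum_of_support_subset r (s := Finset.range M) _ _ (by simp),
      Finset.sum_range]
    intro ℓ hℓ
    rw [Finset.mem_range]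
    by_contra h
    exact Finsupp.mem_support_iff.1 hℓ (hr ℓ (not_lt.1 h))
  refine Nat.card_eq_of_bijective (fun r => ⟨fun i : Fin M => r.1 i, ?_⟩) ⟨?_, ?_⟩
  · rw [Finset.mem_filter, Fintype.mem_piFinset]
    refine ⟨fun i => Finset.mem_range.2 (Nat.lt_succ_of_le (r.2.1 i)), ?_⟩
    rw [← hs r.1 (hz r.1 r.2.2), r.2.2]
  · intro r r' h
    ext ℓ
    by_cases hℓ : ℓ < M
    · exact congrFun (congrArg Subtype.val h) ⟨ℓ, hℓ⟩
    · rw [hz r.1 r.2.2 ℓ (not_lt.1 hℓ), hz r'.1 r'.2.2 ℓ (not_lt.1 hℓ)]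
  · rintro ⟨p, hp⟩
    rw [Finset.mem_filter, Fintype.mem_piFinset] at hp
    let r : ℕ →₀ ℕ := Finsupp.onFinset (Finset.range M)
      (fun ℓ => if h : ℓ < M then p ⟨ℓ, h⟩ else 0) (fun ℓ h => by
        by_contra h'
        rw [Finset.mem_range] at h'
        simp [h'] at h)
    have hr : ∀ i : Fin M, r i = p i := fun i => by simp [r]
    have hr0 : ∀ ℓ, M ≤ ℓ → r ℓ = 0 := fun ℓ hℓ => by simp [r, not_lt.2 hℓ]
    refine ⟨⟨r, fun ℓ => ?_, ?_⟩, ?_⟩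
    · by_cases hℓ : ℓ < M
      · have := hp.1 ⟨ℓ, hℓ⟩
        rw [Finset.mem_range] at this
        have h2 := hr ⟨ℓ, hℓ⟩
        simp only at h2
        omega
      · rw [hr0 ℓ (not_lt.1 hℓ)]; exact Nat.zero_le _
    · rw [hs r hr0, hp.2]
      exact Finset.sum_congr rfl fun i _ => by rw [hr]
    · exact Subtype.ext (funext hr)

lemma pgen_eval (κ : ℝ) (m M : ℕ) (z : ℝ) : (pgen κ m M).eval (rexp (-z)) =
    ∏ ℓ ∈ Finset.range M, (gpoly m).eval (rexp (-(psPart κ (ℓ + 1) * z))) := by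
  simp only [pgen, Polynomial.eval_prod, Polynomial.eval_finsetSum, Polynomial.eval_pow,
    Polynomial.eval_X, gpoly_eval]
  refine Finset.prod_congr rfl fun ℓ _ => Finset.sum_congr rfl fun j _ => ?_
  rw [← Real.exp_nat_mul, ← Real.exp_nat_mul]; congr 1; push_cast; ring

lemma pgen_eval_eq_exp (κ : ℝ) (m M : ℕ) (z : ℝ) : (pgen κ m M).eval (rexp (-z)) =
    rexp (∑ ℓ ∈ Finset.range M, gd m 0 (psPart κ (ℓ + 1) * z)) := by
  rw [pgen_eval, Real.exp_sum]
  refine Finset.prod_congr rfl fun ℓ _ => ?_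
  rw [gd, Real.exp_log]
  exact zero_lt_one.trans_le (one_le_gpoly m (Real.exp_pos _).le)

lemma norm_one_add_le {q : ℝ} (hq : 0 < q) (τ : ℝ) :
    ‖1 + (q : ℂ) * Complex.exp (τ * Complex.I)‖ ≤ 1 + q - q * (1 - Real.cos τ) / (1 + q) := by
  have hc := Real.neg_one_le_cos τ
  have hc' := Real.cos_le_one τ
  have h0 : 0 ≤ 1 + q - q * (1 - Real.cos τ) / (1 + q) := by
    rw [sub_nonneg, div_le_iff₀ (by positivity)]; nlinarith
  refine abs_le_of_sq_le_sq' ?_ h0 |>.2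
  have e : ‖1 + (q : ℂ) * Complex.exp (τ * Complex.I)‖ ^ 2 =
      (1 + q) ^ 2 - 2 * (q * (1 - Real.cos τ)) := by
    rw [← Complex.normSq_eq_norm_sq, Complex.normSq_apply, Complex.exp_mul_I,
      ← Complex.ofReal_cos, ← Complex.ofReal_sin]
    simp only [Complex.add_re, Complex.one_re, Complex.mul_re, Complex.ofReal_re, Complex.ofReal_im,
      Complex.I_re, Complex.I_im, Complex.add_im, Complex.one_im, Complex.mul_im]
    nlinarith [Real.sin_sq_add_cos_sq τ]
  rw [e]
  have : (1 + q - q * (1 - Real.cos τ) / (1 + q)) ^ 2 =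
      (1 + q) ^ 2 - 2 * (q * (1 - Real.cos τ)) + (q * (1 - Real.cos τ) / (1 + q)) ^ 2 := by
    field_simp; ring
  rw [this]; nlinarith [sq_nonneg (q * (1 - Real.cos τ) / (1 + q))]

lemma norm_gpoly_sum_le {m : ℕ} {x : ℝ} (τ : ℝ) :
    ‖∑ j ∈ Finset.range (m + 1), Complex.exp (-x + τ * Complex.I) ^ j‖ ≤
      (gpoly m).eval (rexp (-x)) := by
  rw [gpoly_eval]
  refine (norm_sum_le _ _).trans (Finset.sum_le_sum fun j _ => ?_)
  rw [norm_pow, Complex.norm_exp]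
  simp

lemma norm_gpoly_sum_le_exp {m : ℕ} (hm : 1 ≤ m) {x : ℝ} (hx0 : 0 ≤ x) (hx : x ≤ 1) (τ : ℝ) :
    ‖∑ j ∈ Finset.range (m + 1), Complex.exp (-x + τ * Complex.I) ^ j‖ ≤
      (gpoly m).eval (rexp (-x)) * rexp (-((1 - Real.cos τ) / (6 * (m + 1)))) := by
  set q := rexp (-x) with hq
  have hq0 : 0 < q := Real.exp_pos _
  have hq1 : q ≤ 1 := Real.exp_le_one_iff.2 (by linarith)
  have hq3 : 1 / 3 ≤ q := by
    have h1 : rexp (-1) ≤ q := Real.exp_le_exp.2 (by linarith)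
    have h2 : rexp 1 ≤ 3 := Real.exp_one_lt_three.le
    have h3 : 1 / 3 ≤ rexp (-1) := by
      rw [Real.exp_neg, ← one_div]; gcongr
    linarith
  have hc' := Real.cos_le_one τ
  have hz : Complex.exp (-x + τ * Complex.I) = q * Complex.exp (τ * Complex.I) := by
    rw [Complex.exp_add, hq]; push_cast; rfl
  obtain ⟨k, rfl⟩ : ∃ k, m = k + 1 := ⟨m - 1, by omega⟩
  have hG : (gpoly (k + 1)).eval q = ∑ j ∈ Finset.range k, q ^ (j + 2) + (1 + q) := by
    rw [gpoly_eval, Finset.sum_range_succ', Finset.sum_range_succ']; simp; ring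
  have hGle : (gpoly (k + 1)).eval q ≤ ((k + 1 : ℕ) : ℝ) + 1 := by
    have := gpoly_le (k + 1) hq0.le hq1
    have : ((k + 1 : ℕ) : ℝ) * q ≤ ((k + 1 : ℕ) : ℝ) := mul_le_of_le_one_right (by positivity) hq1
    linarith
  have h1 : ‖∑ j ∈ Finset.range (k + 1 + 1), Complex.exp (-x + τ * Complex.I) ^ j‖ ≤
      (gpoly (k + 1)).eval q - q * (1 - Real.cos τ) / (1 + q) := by
    rw [hG, Finset.sum_range_succ', Finset.sum_range_succ']
    have e : ∑ j ∈ Finset.range k, Complex.exp (-x + τ * Complex.I) ^ (j + 1 + 1) +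
        Complex.exp (-x + τ * Complex.I) ^ (0 + 1) + Complex.exp (-x + τ * Complex.I) ^ 0 =
        ∑ j ∈ Finset.range k, Complex.exp (-x + τ * Complex.I) ^ (j + 2) +
        (1 + (q : ℂ) * Complex.exp (τ * Complex.I)) := by
      rw [← hz]; ring
    rw [e]
    have h2 : ‖∑ j ∈ Finset.range k, Complex.exp (-x + τ * Complex.I) ^ (j + 2)‖ ≤
        ∑ j ∈ Finset.range k, q ^ (j + 2) := by
      refine (norm_sum_le _ _).trans (Finset.sum_le_sum fun j _ => ?_)
      rw [norm_pow, Complex.norm_exp]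
      simp [hq]
    have := norm_one_add_le hq0 τ
    have := norm_add_le (∑ j ∈ Finset.range k, Complex.exp (-x + τ * Complex.I) ^ (j + 2))
      (1 + (q : ℂ) * Complex.exp (τ * Complex.I))
    linarith
  have h3 : (1 - Real.cos τ) / 6 ≤ q * (1 - Real.cos τ) / (1 + q) := by
    rw [div_le_div_iff₀ (by norm_num) (by positivity)]; nlinarith
  have hGpos : 0 < (gpoly (k + 1)).eval q := zero_lt_one.trans_le (one_le_gpoly _ hq0.le)
  have h4 := Real.add_one_le_exp (-((1 - Real.cos τ) / (6 * (((k + 1 : ℕ) : ℝ) + 1))))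
  have h5 : (gpoly (k + 1)).eval q * ((1 - Real.cos τ) / (6 * (((k + 1 : ℕ) : ℝ) + 1))) ≤
      (1 - Real.cos τ) / 6 := by
    calc _ ≤ (((k + 1 : ℕ) : ℝ) + 1) * ((1 - Real.cos τ) / (6 * (((k + 1 : ℕ) : ℝ) + 1))) := by
          gcongr
      _ = _ := by field_simp
  nlinarith [mul_le_mul_of_nonneg_left h4 hGpos.le]

lemma norm_pgen_le {κ : ℝ} (hκ : 0 < κ) {m M : ℕ} (hm : 1 ≤ m) {z : ℝ} (hz : 0 < z)
    (hM : ⌊(1 / z) ^ (1 / κ)⌋₊ ≤ M) (θ : ℝ) :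
    ‖((pgen κ m M).map Complex.ofRealHom).eval (Complex.exp (-z + θ * Complex.I))‖ ≤
      (pgen κ m M).eval (rexp (-z)) *
      rexp (-(4 / (3 * (m + 1)) * minorSum κ ⌊(1 / z) ^ (1 / κ)⌋₊ (|θ| / (2 * π)))) := by
  set N := ⌊(1 / z) ^ (1 / κ)⌋₊
  have e1 : ((pgen κ m M).map Complex.ofRealHom).eval (Complex.exp (-z + θ * Complex.I)) =
      ∏ ℓ ∈ Finset.range M, ∑ j ∈ Finset.range (m + 1),
        Complex.exp (-(psPart κ (ℓ + 1) * z : ℝ) + (psPart κ (ℓ + 1) * θ : ℝ) * Complex.I) ^ j := by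
    simp only [pgen, Polynomial.map_prod, Polynomial.map_sum, Polynomial.map_pow, Polynomial.map_X,
      Polynomial.eval_prod, Polynomial.eval_finsetSum, Polynomial.eval_pow, Polynomial.eval_X]
    refine Finset.prod_congr rfl fun ℓ _ => Finset.sum_congr rfl fun j _ => ?_
    rw [← Complex.exp_nat_mul, ← Complex.exp_nat_mul]; congr 1; push_cast; ring
  have hfac : ∀ ℓ, ‖∑ j ∈ Finset.range (m + 1),
      Complex.exp (-(psPart κ (ℓ + 1) * z : ℝ) + (psPart κ (ℓ + 1) * θ : ℝ) * Complex.I) ^ j‖ ≤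
      (gpoly m).eval (rexp (-(psPart κ (ℓ + 1) * z))) * rexp (if ℓ < N then
        -(4 / (3 * (m + 1)) * dist1 (|θ| / (2 * π) * psPart κ (ℓ + 1)) ^ 2) else 0) := by
    intro ℓ
    split_ifs with h
    · have h1 := psPart_le_of_lt hκ (y := 1 / z) (by positivity) h
      rw [le_div_iff₀ hz] at h1
      refine (norm_gpoly_sum_le_exp hm (by positivity) h1 _).trans ?_
      have hg := zero_le_one.trans (one_le_gpoly m (Real.exp_pos (-(psPart κ (ℓ + 1) * z))).le)
      have h2 := one_sub_cos_ge (|θ| / (2 * π) * psPart κ (ℓ + 1))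
      have e2 : Real.cos (2 * π * (|θ| / (2 * π) * psPart κ (ℓ + 1))) =
          Real.cos (psPart κ (ℓ + 1) * θ) := by
        rw [← Real.cos_abs (psPart κ (ℓ + 1) * θ), abs_mul, Nat.abs_cast]
        congr 1; field_simp
      rw [e2] at h2
      gcongr
      rw [div_mul_eq_mul_div, div_le_div_iff₀ (by positivity) (by positivity)]
      have : (0 : ℝ) < m + 1 := by positivity
      nlinarith
    · rw [Real.exp_zero, mul_one]; exact norm_gpoly_sum_le _
  rw [e1, norm_prod, pgen_eval]
  refine (Finset.prod_le_prod (fun _ _ => norm_nonneg _) fun ℓ _ => hfac ℓ).trans (le_of_eq ?_)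
  rw [Finset.prod_mul_distrib, ← Real.exp_sum]
  congr 2
  rw [← Finset.sum_filter, minorSum, Finset.mul_sum, ← Finset.sum_neg_distrib]
  refine Finset.sum_congr ?_ fun _ _ => rfl
  ext ℓ
  simp only [Finset.mem_filter, Finset.mem_range]
  omega

lemma exists_truncation {κ : ℝ} (hκ : 0 < κ) (m n N : ℕ) {z η : ℝ} (hz : 0 < z) (hη : 0 < η) :
    ∃ M, N ≤ M ∧ (∀ ℓ, M ≤ ℓ → n < psPart κ (ℓ + 1)) ∧ ∀ x, z / 2 ≤ x →
      |∑ ℓ ∈ Finset.range M, gd m 0 (psPart κ (ℓ + 1) * x) - logGen κ m x| ≤ η := by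
  have hs := (logGen_layer hκ m (half_pos hz)).1
  have ht := hs.hasSum.tendsto_sum_nat
  obtain ⟨M, hM1, hM2, hM3⟩ := ((ht.eventually (lt_mem_nhds (sub_lt_self _ hη))).and
    ((eventually_ge_atTop N).and (eventually_ge_atTop (⌈((n : ℝ) + 1) ^ (1 / κ)⌉₊)))).exists
  refine ⟨M, hM2, fun ℓ hℓ => ?_, fun x hx => ?_⟩
  · by_contra h
    rw [not_lt, psPart_le_iff hκ] at h
    omega
  · have hx0 : 0 < x := by linarith
    have hsx := (logGen_layer hκ m hx0).1
    have h1 := hsx.sum_add_tsum_nat_add M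
    have h2 := hs.sum_add_tsum_nat_add M
    have h3 : ∑' ℓ, gd m 0 (psPart κ (ℓ + M + 1) * x) ≤
        ∑' ℓ, gd m 0 (psPart κ (ℓ + M + 1) * (z / 2)) :=
      Summable.tsum_le_tsum (fun ℓ => gd_zero_antitone m (by gcongr))
        ((summable_nat_add_iff M).2 hsx) ((summable_nat_add_iff M).2 hs)
    have h4 : 0 ≤ ∑' ℓ, gd m 0 (psPart κ (ℓ + M + 1) * x) :=
      tsum_nonneg fun ℓ => gd_zero_nonneg m _
    rw [logGen, abs_le]
    constructor <;> linarith

lemma eval_eq_sum_range_of_lt (P : Polynomial ℝ) {N : ℕ} (hN : P.natDegree < N) (x : ℂ) :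
    (P.map Complex.ofRealHom).eval x = ∑ k ∈ Finset.range N, (P.coeff k : ℂ) * x ^ k := by
  rw [Polynomial.eval_map, Polynomial.eval₂_eq_sum_range' _ hN]
  rfl

lemma pgen_charFun_bound {κ : ℝ} (hκ : 0 < κ) {m : ℕ} (hm : 1 ≤ m) {C : ℝ} (hC : 0 < C) :
    ∃ D : ℝ → ℝ, Integrable D ∧ ∀ᶠ z in 𝓝[>] (0 : ℝ), ∀ M : ℕ, ⌊(1 / z) ^ (1 / κ)⌋₊ ≤ M →
      ∀ σ : ℝ, 0 < σ → σ ^ 2 ≤ C * (1 / z) ^ (1 / κ + 2) → ∀ u : ℝ, |u| ≤ π * σ →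
      ‖((pgen κ m M).map Complex.ofRealHom).eval (Complex.exp (-z + (u / σ : ℝ) * Complex.I))‖ ≤
        (pgen κ m M).eval (rexp (-z)) * D u := by
  set α := 1 / κ with hα
  have hα0 : 0 < α := by positivity
  set b : ℝ := 4 / (3 * (m + 1)) with hb
  have hb0 : 0 < b := by positivity
  obtain ⟨c, hc, Y₁, hY₁, h₁⟩ := minorSum_major hκ
  obtain ⟨Y₂, hY₂, h₂⟩ := minorSum_ge_log hκ (K := (α + 2) / b) (by positivity)
  refine ⟨fun u => rexp (-(b * c / (4 * π ^ 2 * C)) * u ^ 2) + (1 + π ^ 2 * C) * (1 + u ^ 2)⁻¹,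
    (integrable_exp_neg_mul_sq (by positivity)).add (integrable_inv_one_add_sq.const_mul _), ?_⟩
  have hinv : Tendsto (fun z : ℝ => 1 / z) (𝓝[>] 0) atTop := by
    simpa using tendsto_inv_nhdsGT_zero (𝕜 := ℝ)
  filter_upwards [self_mem_nhdsWithin, hinv.eventually_ge_atTop Y₁,
    hinv.eventually_ge_atTop Y₂] with z hz hy₁ hy₂ M hM σ hσ hσC u hu
  have hz0 : 0 < z := hz
  refine (norm_pgen_le hκ hm hz0 hM _).trans ?_
  rw [pgen_eval_eq_exp]
  refine mul_le_mul_of_nonneg_left ?_ (Real.exp_pos _).le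
  set y := 1 / z with hy
  have hy0 : 0 < y := by positivity
  set t := |u / σ| / (2 * π) with ht
  have ht0 : 0 ≤ t := by positivity
  have hts : t * (2 * π * σ) = |u| := by
    rw [ht, abs_div, abs_of_pos hσ]; field_simp
  have ht1 : t ≤ 1 / 2 := by
    rw [ht, abs_div, abs_of_pos hσ, div_div, div_le_iff₀ (by positivity)]; linarith
  have hA : 0 ≤ rexp (-(b * c / (4 * π ^ 2 * C)) * u ^ 2) := (Real.exp_pos _).le
  have hB : 0 ≤ (1 + π ^ 2 * C) * (1 + u ^ 2)⁻¹ := by positivity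
  rcases le_or_gt (t * y) (1 / 2) with hty | hty
  · refine le_trans ?_ (le_add_of_nonneg_right hB)
    apply Real.exp_le_exp.2
    rw [neg_mul, neg_le_neg_iff]
    refine le_trans ?_ (mul_le_mul_of_nonneg_left (h₁ y hy₁ t ht0 hty) hb0.le)
    have e : u ^ 2 = (t * (2 * π * σ)) ^ 2 := by rw [hts, sq_abs]
    have e2 : y ^ (α + 2) = y ^ α * y ^ 2 := by
      rw [Real.rpow_add hy0]; norm_cast
    rw [e, div_mul_eq_mul_div, div_le_iff₀ (by positivity)]
    rw [e2] at hσC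
    have : 0 ≤ b * c * (t * (2 * π)) ^ 2 := by positivity
    nlinarith [mul_le_mul_of_nonneg_left hσC this]
  · refine le_trans ?_ (le_add_of_nonneg_left hA)
    have h3 := h₂ y hy₂ t (by rw [div_le_iff₀ (by positivity)]; linarith) ht1
    have hy1 : 1 ≤ y := hY₂.trans hy₂
    have h4 : rexp (-(b * minorSum κ ⌊y ^ (1 / κ)⌋₊ t)) ≤ (y ^ (α + 2))⁻¹ := by
      rw [← Real.rpow_neg hy0.le, Real.rpow_def_of_pos hy0 (-(α + 2))]
      apply Real.exp_le_exp.2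
      have := mul_le_mul_of_nonneg_left h3 hb0.le
      have e : b * ((α + 2) / b * Real.log y) = Real.log y * (α + 2) := by field_simp
      linarith
    refine h4.trans ?_
    have hp : 1 ≤ y ^ (α + 2) := Real.one_le_rpow hy1 (by positivity)
    rw [← div_eq_mul_inv, ← one_div, div_le_div_iff₀ (by positivity) (by positivity)]
    have : u ^ 2 ≤ (π * σ) ^ 2 := sq_le_sq' (by linarith [neg_abs_le u]) ((le_abs_self u).trans hu)
    have h5 := mul_le_mul_of_nonneg_left hσC (sq_nonneg π)
    nlinarith

lemma pkm_local_limit {κ : ℝ} (hκ : 0 < κ) {m : ℕ} (hm : 1 ≤ m) {z σ : ℕ → ℝ} {n : ℕ → ℕ}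
    (hz0 : ∀ j, 0 < z j) (hz : Tendsto z atTop (𝓝 0)) (hσ0 : ∀ j, 0 < σ j)
    (hσ : Tendsto σ atTop atTop) (hσz : Tendsto (fun j => σ j * z j) atTop atTop)
    {C : ℝ} (hC : 0 < C) (hσC : ∀ᶠ j in atTop, σ j ^ 2 ≤ C * (1 / z j) ^ (1 / κ + 2))
    (hs : ∀ s : ℝ, Tendsto (fun j => logGen κ m (z j - s / σ j) - logGen κ m (z j) -
      n j * (s / σ j)) atTop (𝓝 (s ^ 2 / 2))) :
    Tendsto (fun j => σ j * (pkm κ m (n j) * rexp (-(n j * z j) - logGen κ m (z j)))) atTop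
      (𝓝 (1 / Real.sqrt (2 * π))) := by
  have hη : ∀ j : ℕ, (0 : ℝ) < 1 / (j + 1) := fun j => by positivity
  choose M hM1 hM2 hM3 using fun j => exists_truncation hκ m (n j)
    ⌊(1 / z j) ^ (1 / κ)⌋₊ (hz0 j) (hη j)
  have hηt : Tendsto (fun j : ℕ => (1 : ℝ) / (j + 1)) atTop (𝓝 0) :=
    tendsto_one_div_add_atTop_nhds_zero_nat
  set S : ℕ → ℝ → ℝ := fun j x => ∑ ℓ ∈ Finset.range (M j), gd m 0 (psPart κ (ℓ + 1) * x) with hS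
  have hPev : ∀ j x, (pgen κ m (M j)).eval (rexp (-x)) = rexp (S j x) := fun j x =>
    pgen_eval_eq_exp κ m (M j) x
  have happrox : ∀ x : ℕ → ℝ, (∀ᶠ j in atTop, z j / 2 ≤ x j) →
      Tendsto (fun j => S j (x j) - logGen κ m (x j)) atTop (𝓝 0) := fun x hx =>
    squeeze_zero_norm' (hx.mono fun j hj => hM3 j _ hj) hηt
  set N : ℕ → ℕ := fun j => max (pgen κ m (M j)).natDegree (n j) + 1 with hN
  have hNd : ∀ j, (pgen κ m (M j)).natDegree < N j := fun j =>
    Nat.lt_succ_of_le (le_max_left _ _)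
  set w : ℕ → ℕ → ℝ := fun j k => (pgen κ m (M j)).coeff k * rexp (-(k * z j) - S j (z j)) with hw
  obtain ⟨D, hD, hDb⟩ := pgen_charFun_bound hκ hm hC
  have hz' : Tendsto z atTop (𝓝[>] 0) :=
    tendsto_nhdsWithin_iff.2 ⟨hz, Eventually.of_forall hz0⟩
  have hlim := local_limit (N := N) (n := n) (w := w) (σ := σ)
    (fun j k => mul_nonneg (pgen_coeff_nonneg _ _ _ _) (Real.exp_pos _).le) hσ0 hσ
    (fun j => Nat.lt_succ_of_le (le_max_right _ _)) (fun s => ?_) hD ?_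
  · have hc := (Real.continuous_exp.tendsto 0).comp
      (happrox z (Eventually.of_forall fun j => by linarith [hz0 j]))
    rw [Real.exp_zero] at hc
    have := hlim.mul hc
    rw [mul_one] at this
    refine this.congr fun j => ?_
    simp only [hw, Function.comp, pgen_coeff_eq_pkm (hM2 j)]
    rw [mul_assoc, mul_assoc, ← Real.exp_add]
    congr 3; ring
  · have hsz : ∀ᶠ j in atTop, z j / 2 ≤ z j - s / σ j := by
      filter_upwards [hσz.eventually_ge_atTop (2 * s)] with j hj
      have : s / σ j ≤ z j / 2 := by
        rw [div_le_div_iff₀ (hσ0 j) two_pos]; linarith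
      linarith
    have h1 := ((hs s).add (happrox _ hsz)).sub
      (happrox z (Eventually.of_forall fun j => by linarith [hz0 j]))
    rw [add_zero, sub_zero] at h1
    refine ((Real.continuous_exp.tendsto _).comp h1).congr fun j => ?_
    have e := hPev j (z j - s / σ j)
    rw [Polynomial.eval_eq_sum_range' (hNd j)] at e
    have e2 : logGen κ m (z j - s / σ j) - logGen κ m (z j) - n j * (s / σ j) +
        (S j (z j - s / σ j) - logGen κ m (z j - s / σ j)) - (S j (z j) - logGen κ m (z j)) =
        S j (z j - s / σ j) + (-(n j * (s / σ j)) - S j (z j)) := by ring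
    simp only [Function.comp]
    rw [e2, Real.exp_add, ← e, Finset.sum_mul]
    refine Finset.sum_congr rfl fun k _ => ?_
    rw [hw, ← Real.exp_nat_mul, mul_assoc, mul_assoc, ← Real.exp_add, ← Real.exp_add]
    congr 2; ring
  · filter_upwards [hz'.eventually hDb, hσC] with j hj hjC u hu
    have h1 := hj (M j) (hM1 j) (σ j) (hσ0 j) hjC u hu
    rw [hPev, eval_eq_sum_range_of_lt _ (hNd j)] at h1
    have e : ∑ k ∈ Finset.range (N j),
        (w j k : ℂ) * Complex.exp (Complex.I * u * (((k : ℝ) - n j) / σ j : ℝ)) =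
        Complex.exp ((-(u * n j / σ j) : ℝ) * Complex.I) * ((rexp (-S j (z j)) : ℝ) : ℂ) *
        ∑ k ∈ Finset.range (N j), ((pgen κ m (M j)).coeff k : ℂ) *
          Complex.exp (-z j + (u / σ j : ℝ) * Complex.I) ^ k := by
      rw [Finset.mul_sum]
      refine Finset.sum_congr rfl fun k _ => ?_
      have : (σ j : ℂ) ≠ 0 := Complex.ofReal_ne_zero.2 (hσ0 j).ne'
      simp only [hw]
      rw [← Complex.exp_nat_mul]
      push_cast
      rw [mul_assoc, ← Complex.exp_add, mul_left_comm, ← Complex.exp_add, ← Complex.exp_add]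
      congr 2
      field_simp
      ring
    rw [e, norm_mul, norm_mul, Complex.norm_exp_ofReal_mul_I, one_mul, Complex.norm_real,
      Real.norm_of_nonneg (Real.exp_pos _).le]
    calc _ ≤ rexp (-S j (z j)) * (rexp (S j (z j)) * D u) := by gcongr
      _ = D u := by rw [← mul_assoc, ← Real.exp_add]; simp

lemma tendsto_sdev {α β : ℝ} (hα : 0 < α) (hβ : 0 < β) :
    Tendsto (sdev α β) (𝓝[>] 0) atTop :=
  (tendsto_rpow_neg_nhdsGT_zero (by linarith : -((α + 2) / 2) < 0)).const_mul_atTop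
    (Real.sqrt_pos.2 (by positivity))

lemma tendsto_sdev_mul {α β : ℝ} (hα : 0 < α) (hβ : 0 < β) {y : ℝ → ℝ}
    (hy : Tendsto y (𝓝[>] 0) (𝓝 1)) :
    Tendsto (fun ε => sdev α β ε * (ε * y ε)) (𝓝[>] 0) atTop := by
  have h := ((tendsto_rpow_neg_nhdsGT_zero (by linarith : -(α / 2) < 0)).const_mul_atTop
    (Real.sqrt_pos.2 (by positivity : 0 < β * (α + 1)))).atTop_mul_pos one_pos hy
  refine h.congr' ?_
  filter_upwards [self_mem_nhdsWithin] with ε hε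
  have hε0 : 0 < ε := hε
  have : ε ^ (-(α / 2)) = ε ^ (-((α + 2) / 2)) * ε := by
    rw [← Real.rpow_add_one hε0.ne']; congr 1; ring
  rw [sdev, this]; ring

lemma sdev_sq_le {α β : ℝ} (hα : 0 < α) (hβ : 0 < β) {y : ℝ → ℝ}
    (hy : Tendsto y (𝓝[>] 0) (𝓝 1)) :
    ∀ᶠ ε in 𝓝[>] (0 : ℝ), sdev α β ε ^ 2 ≤
      β * (α + 1) * 2 ^ (α + 2) * (1 / (ε * y ε)) ^ (α + 2) := by
  filter_upwards [self_mem_nhdsWithin, hy.eventually (lt_mem_nhds one_pos),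
    hy.eventually (gt_mem_nhds one_lt_two)] with ε hε hy0 hy2
  have hε0 : 0 < ε := hε
  have e : sdev α β ε ^ 2 = β * (α + 1) * (1 / ε) ^ (α + 2) := by
    rw [sdev, mul_pow, Real.sq_sqrt (by positivity), ← Real.rpow_natCast, ← Real.rpow_mul hε0.le,
      one_div, Real.inv_rpow hε0.le, ← Real.rpow_neg hε0.le]
    congr 2; push_cast; ring
  rw [e, mul_assoc _ ((2 : ℝ) ^ (α + 2)), ← Real.mul_rpow two_pos.le (by positivity)]
  gcongr
  rw [mul_one_div, div_le_div_iff₀ hε0 (by positivity)]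
  nlinarith

lemma pkm_asymp {κ : ℝ} (hκ : 0 < κ) {m : ℕ} (hm : 1 ≤ m) {α β δ c : ℝ} (hα : α = 1 / κ)
    (hβ : 0 < β) (hδ : δ = (α + 2) / (2 * (α + 1))) {A : ℕ → ℝ} (hA : A 0 = β / α)
    (hc : Tendsto (fun z => logGen κ m z -
      ∑ h ∈ Finset.range (⌊α⌋₊ + 1), A h * z ^ ((h : ℝ) - α)) (𝓝[>] 0) (𝓝 c)) :
    ∃ lam : ℕ → ℝ, lam 0 = β + A 0 ∧ (1 ≤ ⌊α⌋₊ → lam 1 = A 1) ∧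
      Tendsto (fun n : ℕ => (pkm κ m n : ℝ) /
          ((rexp c / Real.sqrt (2 * π * β * (α + 1))) * (β / (n : ℝ)) ^ δ *
            Real.exp (∑ h ∈ Finset.range (⌊α⌋₊ + 1),
              lam h * ((n : ℝ) / β) ^ ((α - (h : ℝ)) / (α + 1)))))
        atTop (𝓝 1) := by
  have hα0 : 0 < α := by rw [hα]; positivity
  obtain ⟨y, lam, hy, hl0, hl1, hmain, hs⟩ :=
    exists_saddle_log (H := ⌊α⌋₊) hα0 hβ hA (Nat.lt_floor_add_one α) hc
  refine ⟨lam, hl0, hl1, ?_⟩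
  have hy0 : ∀ᶠ ε in 𝓝[>] (0 : ℝ), 0 < y ε := hy.eventually (lt_mem_nhds one_pos)
  set e : ℕ → ℝ := fun n => (β / n) ^ (1 / (α + 1)) with he
  have het : Tendsto e atTop (𝓝[>] 0) := by
    refine tendsto_nhdsWithin_iff.2 ⟨?_, ?_⟩
    · have h1 : Tendsto (fun n : ℕ => β / (n : ℝ)) atTop (𝓝 0) :=
        tendsto_const_div_atTop_nhds_zero_nat β
      have h2 := h1.rpow_const (p := 1 / (α + 1)) (Or.inr (by positivity))
      rwa [Real.zero_rpow (by positivity)] at h2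
    · filter_upwards [eventually_gt_atTop 0] with n hn
      exact Real.rpow_pos_of_pos (by positivity) _
  obtain ⟨J, hJ⟩ := eventually_atTop.1 ((het.eventually hy0).and (eventually_gt_atTop 0))
  have hsh : Tendsto (fun j => j + J) atTop atTop := tendsto_add_atTop_nat J
  set ε : ℕ → ℝ := fun j => e (j + J) with hε
  have hεt : Tendsto ε atTop (𝓝[>] 0) := het.comp hsh
  have hn0 : ∀ j, (0 : ℝ) < ((j + J : ℕ) : ℝ) := fun j =>
    Nat.cast_pos.2 (hJ (j + J) (by omega)).2
  have hε0 : ∀ j, 0 < ε j := fun j => Real.rpow_pos_of_pos (div_pos hβ (hn0 j)) _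
  have hpow : ∀ j (p : ℝ), ε j ^ p = (β / ((j + J : ℕ) : ℝ)) ^ (p / (α + 1)) := fun j p => by
    have : 0 < β / ((j + J : ℕ) : ℝ) := div_pos hβ (hn0 j)
    simp only [hε, he]
    rw [← Real.rpow_mul this.le]; congr 1; ring
  have hnε : ∀ j, β * ε j ^ (-(α + 1)) = ((j + J : ℕ) : ℝ) := fun j => by
    have := hn0 j
    rw [hpow, neg_div, div_self (by positivity), Real.rpow_neg_one]
    field_simp
  have hlim := pkm_local_limit hκ hm (z := fun j => ε j * y (ε j)) (n := fun j => j + J)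
    (σ := fun j => sdev α β (ε j))
    (fun j => mul_pos (hε0 j) (hJ (j + J) (by omega)).1)
    ((tendsto_nhdsWithin_iff.1 ((tendsto_mul_nhdsGT hy).comp hεt)).1)
    (fun j => sdev_pos hα0 hβ (hε0 j)) ((tendsto_sdev hα0 hβ).comp hεt)
    ((tendsto_sdev_mul hα0 hβ hy).comp hεt) (by positivity : 0 < β * (α + 1) * 2 ^ (α + 2))
    (by rw [← hα]; exact hεt.eventually (sdev_sq_le hα0 hβ hy))
    (fun s => ((hs s).comp hεt).congr fun j => by simp only [Function.comp, hnε])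
  rw [← tendsto_add_atTop_iff_nat J]
  have h1 := (Real.continuous_exp.tendsto _).comp ((hmain.comp hεt).sub_const c)
  rw [sub_self, Real.exp_zero] at h1
  have h2 := (hlim.mul_const (Real.sqrt (2 * π))).mul h1
  have hpi : Real.sqrt (2 * π) ≠ 0 := (Real.sqrt_pos.2 (by positivity)).ne'
  rw [one_div, inv_mul_cancel₀ hpi, one_mul] at h2
  refine h2.congr fun j => ?_
  simp only [Function.comp, hnε]
  have hsum : ∑ h ∈ Finset.range (⌊α⌋₊ + 1),
      lam h * (((j + J : ℕ) : ℝ) / β) ^ ((α - (h : ℝ)) / (α + 1)) =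
      ∑ h ∈ Finset.range (⌊α⌋₊ + 1), lam h * ε j ^ ((h : ℝ) - α) := by
    refine Finset.sum_congr rfl fun h _ => ?_
    rw [hpow, ← inv_div β, Real.inv_rpow (div_pos hβ (hn0 j)).le,
      ← Real.rpow_neg (div_pos hβ (hn0 j)).le]
    congr 2; ring
  have hδe : (β / ((j + J : ℕ) : ℝ)) ^ δ = (ε j ^ (-((α + 2) / 2)))⁻¹ := by
    rw [← Real.rpow_neg (hε0 j).le, hpow, hδ]
    congr 1; field_simp
  have hsq : Real.sqrt (2 * π * β * (α + 1)) = Real.sqrt (2 * π) * Real.sqrt (β * (α + 1)) := by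
    rw [← Real.sqrt_mul (by positivity)]; congr 1; ring
  rw [hsum, hδe, hsq, sdev]
  set T := ∑ h ∈ Finset.range (⌊α⌋₊ + 1), lam h * ε j ^ ((h : ℝ) - α)
  have hr : 0 < ε j ^ (-((α + 2) / 2)) := Real.rpow_pos_of_pos (hε0 j) _
  have hs2 : Real.sqrt (β * (α + 1)) ≠ 0 := (Real.sqrt_pos.2 (by positivity)).ne'
  set X := ((j + J : ℕ) : ℝ) * (ε j * y (ε j))
  set L := logGen κ m (ε j * y (ε j))
  have hexp : rexp (-X - L) * rexp (X + L - T - c) = (rexp c * rexp T)⁻¹ := by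
    rw [← Real.exp_add, ← Real.exp_add, ← Real.exp_neg]; congr 1; ring
  calc _ = Real.sqrt (β * (α + 1)) * ε j ^ (-((α + 2) / 2)) * pkm κ m (j + J) *
        Real.sqrt (2 * π) * (rexp (-X - L) * rexp (X + L - T - c)) := by ring
    _ = _ := by
      rw [hexp]
      have := (Real.exp_pos c).ne'
      have := (Real.exp_pos T).ne'
      field_simp

end PS

open PS

theorem stmt0 (κ : ℝ) (hκ : 0 < κ) (m : ℕ) (hm : 1 ≤ m)
    (α β δ z₀ : ℝ) (hα : α = 1 / κ)
    (hβ : β = α * Real.Gamma (α + 1) * (1 - ((m : ℝ) + 1) ^ (-α)) * realZeta (α + 1))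
    (hδ : δ = (α + 2) / (2 * (α + 1)))
    (hz : z₀ = if ∃ j : ℕ, α = (j : ℝ) then -α / (α + 1) else -(1 / 2)) :
    ∃ lam : ℕ → ℝ,
      lam 0 = (1 + κ) * β ∧
      lam 1 = (if 1 < α then
          (1 - ((m : ℝ) + 1) ^ (1 - α)) * realZeta α * Real.Gamma (1 + α) / 2 else 0) ∧
      Tendsto (fun n : ℕ => (pkm κ m n : ℝ) /
          ((((m : ℝ) + 1) ^ z₀ / Real.sqrt (2 * π * β * (α + 1))) * (β / (n : ℝ)) ^ δ *
            Real.exp (∑ h ∈ Finset.range (⌊α⌋₊ + 1),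
              lam h * ((n : ℝ) / β) ^ ((α - (h : ℝ)) / (α + 1)))))
        atTop (𝓝 1) := by
  have hα0 : 0 < α := by rw [hα]; positivity
  have hm0 : (0 : ℝ) < m := by exact_mod_cast hm
  have hm1 : (0 : ℝ) < (m : ℝ) + 1 := by positivity
  have hβ0 : 0 < β := by
    have h1 := realZeta_pos (by linarith : 1 < α + 1)
    have h2 : ((m : ℝ) + 1) ^ (-α) < 1 :=
      Real.rpow_lt_one_of_one_lt_of_neg (by linarith) (by linarith)
    have h3 := Real.Gamma_pos_of_pos (by linarith : 0 < α + 1)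
    have h4 : 0 < 1 - ((m : ℝ) + 1) ^ (-α) := by linarith
    rw [hβ]; positivity
  have hA0 : acoef m α 0 = β / α := by
    rw [acoef_zero_eq m hα0, hβ]; field_simp
  have hl0 : β + β / α = (1 + κ) * β := by
    rw [hα]; field_simp
  set L := Real.log ((m : ℝ) + 1) with hL
  have hmL : ∀ x : ℝ, ((m : ℝ) + 1) ^ x = rexp (L * x) := fun x => Real.rpow_def_of_pos hm1 x
  by_cases hint : ∃ j : ℕ, α = (j : ℝ)
  · rw [if_pos hint] at hz
    obtain ⟨j, hj⟩ := hint
    have hasy := logGen_asymp_nat hκ m (j := j) (hα ▸ hj)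
    rw [← hα] at hasy
    obtain ⟨lam, hlam0, hlam1, hlim⟩ := pkm_asymp hκ hm hα hβ0 hδ hA0 hasy
    have hfl : ⌊α⌋₊ = j := by rw [hj, Nat.floor_natCast]
    have hj1 : 1 ≤ j := by
      rw [Nat.one_le_iff_ne_zero]; rintro rfl; rw [hj] at hα0; simp at hα0
    have hdiff : -L - L * z₀ = -L / (α + 1) := by
      rw [hz]; field_simp; ring
    refine ⟨fun h => if h = j then lam h - L / (α + 1) else lam h, ?_, ?_, ?_⟩
    · have h0 : (0 : ℕ) ≠ j := by omega
      simp only [if_neg h0, hlam0, hA0, hl0]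
    · have h1 := hlam1 (by omega)
      beta_reduce
      by_cases hj2 : j = 1
      · have ha1 : α = 1 := by rw [hj, hj2]; norm_num
        rw [if_pos hj2.symm, h1, ha1, if_neg (lt_irrefl _), acoef_one_one]
        ring
      · have ha1 : 1 < α := by rw [hj]; exact_mod_cast (by omega : 1 < j)
        rw [if_neg (Ne.symm hj2), if_pos ha1, h1, acoef_one_eq m ha1]
    · refine hlim.congr' ?_
      filter_upwards with n
      congr 1
      rw [hmL]
      have hsum : ∑ h ∈ Finset.range (⌊α⌋₊ + 1), (if h = j then lam h - L / (α + 1) else lam h) *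
          ((n : ℝ) / β) ^ ((α - (h : ℝ)) / (α + 1)) =
          ∑ h ∈ Finset.range (⌊α⌋₊ + 1), lam h * ((n : ℝ) / β) ^ ((α - (h : ℝ)) / (α + 1)) -
          L / (α + 1) := by
        rw [hfl, Finset.sum_range_succ, Finset.sum_range_succ, if_pos rfl, hj, sub_self, zero_div,
          Real.rpow_zero, ← hj]
        have : ∀ h ∈ Finset.range j, (if h = j then lam h - L / (α + 1) else lam h) *
            ((n : ℝ) / β) ^ ((α - (h : ℝ)) / (α + 1)) =
            lam h * ((n : ℝ) / β) ^ ((α - (h : ℝ)) / (α + 1)) := fun h hh => by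
          rw [if_neg (Finset.mem_range.1 hh).ne]
        rw [Finset.sum_congr rfl this]; ring
      rw [hsum]
      set T := ∑ h ∈ Finset.range (⌊α⌋₊ + 1), lam h * ((n : ℝ) / β) ^ ((α - (h : ℝ)) / (α + 1))
      have hexp : rexp (-L) * rexp T = rexp (L * z₀) * rexp (T - L / (α + 1)) := by
        rw [← Real.exp_add, ← Real.exp_add]; congr 1
        rw [neg_div] at hdiff; linarith
      linear_combination ((β / (n : ℝ)) ^ δ / Real.sqrt (2 * π * β * (α + 1))) * hexp
  · rw [if_neg hint] at hz
    have hasy := logGen_asymp hκ m (fun j hj => hint ⟨j, hα.trans hj⟩)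
    rw [← hα] at hasy
    obtain ⟨lam, hlam0, hlam1, hlim⟩ := pkm_asymp hκ hm hα hβ0 hδ hA0 hasy
    rw [hz, hmL (-(1 / 2)), mul_comm L]
    by_cases ha1 : 1 < α
    · refine ⟨lam, by rw [hlam0, hA0, hl0], ?_, hlim⟩
      rw [if_pos ha1, hlam1 (Nat.one_le_floor_iff _ |>.2 ha1.le), acoef_one_eq m ha1]
    · have hne : α ≠ 1 := fun h => hint ⟨1, by rw [h]; norm_num⟩
      have hfl : ⌊α⌋₊ = 0 := Nat.floor_eq_zero.2 (lt_of_le_of_ne (not_lt.1 ha1) hne)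
      refine ⟨fun h => if h = 0 then lam 0 else 0, by simp [hlam0, hA0, hl0], by simp [ha1], ?_⟩
      refine hlim.congr fun n => ?_
      rw [hfl]; simp [hL]
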